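/- Let β > β_c and h = 0, and let μ̂ := lim_{m→∞} μ_{β,0}^+( · | η(i,0) = −1 for all i ∈ {−m,…,−1} ) (this weak limit exists by monotonicity). For n ∈ ℕ let A_n be the event that there exists an infinite nearest-neighbor path in ℤ² starting at (n,0), entirely contained in the half-plane D_n := {(x,y) ∈ ℤ² : x ≤ n}, along which all spins equal +1. Then there exists n₀ such that μ̂(A_n) > 0 for all n ≥ n₀. -/

import Mathlib

open MeasureTheory Filter Topology ProbabilityTheory

noncomputable section

/-- Spin value of a Boolean spin: `true ↦ +1`, `false ↦ -1`. -/
def sval (b : Bool) : ℝ := if b then 1 else -1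

/-- Two-dimensional spin configurations. -/
abbrev Cfg2 := ℤ × ℤ → Bool

/-- Two-sided sequences over an alphabet `A`. -/
abbrev ZSeq (A : Type*) := ℤ → A

/-- Pasts: index `k` corresponds to the coordinate `-(k+1)`. -/
abbrev Past (A : Type*) := ℕ → A

/-- The four nearest neighbours of a site of `ℤ²`. -/
def nbrs (x : ℤ × ℤ) : Finset (ℤ × ℤ) :=
  {(x.1 + 1, x.2), (x.1 - 1, x.2), (x.1, x.2 + 1), (x.1, x.2 - 1)}

/-- Boltzmann weight
`exp(β[Σ_{{x,y}⊆Λ, x∼y} ω_x ω_y + Σ_{x∈Λ, y∉Λ, x∼y} ω_x σ_y] − h Σ_{x∈Λ} ω_x)`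
(the sum over unordered pairs inside `Λ` is written as half the ordered sum). -/
def isingWeight (β h : ℝ) (Λ : Finset (ℤ × ℤ)) (σ ω : Cfg2) : ℝ :=
  Real.exp (β * ((∑ x ∈ Λ, ∑ y ∈ Λ.filter (fun y => y ∈ nbrs x),
        sval (ω x) * sval (ω y)) / 2
      + ∑ x ∈ Λ, ∑ y ∈ (nbrs x).filter (fun y => y ∉ Λ), sval (ω x) * sval (σ y))
    - h * ∑ x ∈ Λ, sval (ω x))

/-- Fill in the values `τ` inside `Λ` and `σ` outside. -/
def fill (Λ : Finset (ℤ × ℤ)) (σ : Cfg2) (τ : ↥Λ → Bool) : Cfg2 :=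
  fun x => if hx : x ∈ Λ then τ ⟨x, hx⟩ else σ x

/-- The finite-volume Ising measure in `Λ` with boundary condition `σ`, viewed as a measure on
the full configuration space, the spins outside `Λ` being frozen to `σ`. -/
def isingFV (β h : ℝ) (Λ : Finset (ℤ × ℤ)) (σ : Cfg2) : Measure Cfg2 :=
  (∑ τ : ↥Λ → Bool, ENNReal.ofReal (isingWeight β h Λ σ (fill Λ σ τ)))⁻¹ •
    ∑ τ : ↥Λ → Bool,
      ENNReal.ofReal (isingWeight β h Λ σ (fill Λ σ τ)) • Measure.dirac (fill Λ σ τ)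

/-- The box `[-n,n]²`. -/
def box (n : ℕ) : Finset (ℤ × ℤ) :=
  (Finset.Icc (-(n : ℤ)) (n : ℤ)) ×ˢ (Finset.Icc (-(n : ℤ)) (n : ℤ))

/-- Convergence of a sequence of measures on a product space in the sense of convergence of the
measures of all finite-dimensional cylinder events; for probability measures on `{−1,+1}^ι`
this is exactly weak convergence. -/
def CylTendsto {ι A : Type*} [MeasurableSpace A] (μs : ℕ → Measure (ι → A))
    (μ : Measure (ι → A)) : Prop :=
  ∀ (s : Finset ι) (f : ι → A),
    Tendsto (fun n => μs n {η | ∀ i ∈ s, η i = f i}) atTop (𝓝 (μ {η | ∀ i ∈ s, η i = f i}))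

/-- `μ` is the plus phase `μ_{β,h}^+`: the weak limit of the finite-volume Ising measures on
`[-n,n]²` with all-plus boundary conditions. -/
def IsPlusPhase (β h : ℝ) (μ : Measure Cfg2) : Prop :=
  IsProbabilityMeasure μ ∧ CylTendsto (fun n => isingFV β h (box n) (fun _ => true)) μ

/-- `μ` is the minus phase `μ_{β,h}^-`. -/
def IsMinusPhase (β h : ℝ) (μ : Measure Cfg2) : Prop :=
  IsProbabilityMeasure μ ∧ CylTendsto (fun n => isingFV β h (box n) (fun _ => false)) μ

/-- The critical inverse temperature `β_c = ln(1+√2)/2`. -/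
def betaCrit : ℝ := Real.log (1 + Real.sqrt 2) / 2

/-- Projection of a two-dimensional configuration onto the line `ℤ × {0}`. -/
def lineProj (η : Cfg2) : ZSeq Bool := fun i => η (i, 0)

/-- The Schonmann projection of a measure on `{−1,+1}^{ℤ²}`. -/
def schonmann (μ : Measure Cfg2) : Measure (ZSeq Bool) := μ.map lineProj

/-- Restriction of a two-sided sequence to its strict past; index `k` is coordinate `-(k+1)`. -/
def restrictPast {A : Type*} (ω : ZSeq A) : Past A := fun k => ω (-(k + 1 : ℤ))

/-- The shift on two-sided sequences. -/
def shiftSeq {A : Type*} : ZSeq A → ZSeq A := fun ω i => ω (i + 1)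

/-- The σ-algebra `ℱ_{<0}` generated by the coordinates of negative index. -/
def pastSigma (A : Type*) [MeasurableSpace A] : MeasurableSpace (ZSeq A) :=
  MeasurableSpace.comap (fun ω : ZSeq A => restrictPast ω) inferInstance

/-- The σ-algebra generated by the coordinates in `S`. -/
def sigmaOn {ι A : Type*} [MeasurableSpace A] (S : Set ι) : MeasurableSpace (ι → A) :=
  MeasurableSpace.comap (fun ω : ι → A => S.restrict ω) inferInstance

/-- A g-function on the alphabet `A`: measurable, `[0,1]`-valued, normalized. -/
def IsGFunction {A : Type*} [Fintype A] [MeasurableSpace A] (P : A → Past A → ℝ) : Prop :=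
  (∀ a, Measurable (P a)) ∧ ∀ ω, (∑ a : A, P a ω) = 1 ∧ ∀ a, P a ω ∈ Set.Icc (0 : ℝ) 1

/-- `μ` is a translation-invariant g-measure consistent with the g-function `P`: for each `a`,
`ω ↦ P a (restrictPast ω)` is a version of the conditional probability `μ(X₀ = a | ℱ_{<0})`. -/
def IsGMeasure {A : Type*} [MeasurableSpace A] (μ : Measure (ZSeq A))
    (P : A → Past A → ℝ) : Prop :=
  IsProbabilityMeasure μ ∧ μ.map shiftSeq = μ ∧
    ∀ a : A, (fun ω => P a (restrictPast ω))
      =ᵐ[μ] μ[Set.indicator {ω : ZSeq A | ω 0 = a} (fun _ => (1 : ℝ)) | pastSigma A]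

/-- The `k`-th variation of a g-function: the supremum of `|P a ω − P a σ|` over pasts agreeing
on the coordinates `−k,…,−1`. -/
def varG {A : Type*} (P : A → Past A → ℝ) (k : ℕ) : ℝ :=
  sSup {d : ℝ | ∃ (a : A) (ω σ' : Past A), (∀ j < k, ω j = σ' j) ∧ d = |P a ω - P a σ'|}

/-- Elementary conditional probability `μ(B | A)`, as a real number. -/
def condProbR {X : Type*} [MeasurableSpace X] (μ : Measure X) (B A : Set X) : ℝ :=
  ((μ[|A]) B).toReal

/-- The event that `η_i = ω` (suitably reindexed) for `−n ≤ i ≤ −1` and `η_i = b`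
for `−(n+l) ≤ i ≤ −(n+1)`. -/
def pastEvt (n l : ℕ) (b : Bool) (ω : Past Bool) : Set (ZSeq Bool) :=
  {η | (∀ i : ℤ, -(n : ℤ) ≤ i → i ≤ -1 → η i = ω (i.natAbs - 1)) ∧
       (∀ i : ℤ, -((n : ℤ) + l) ≤ i → i ≤ -((n : ℤ) + 1) → η i = b)}

/-- The event that `η_i = b` for `−(n+l) ≤ i ≤ −n`. -/
def blockEvt (n l : ℕ) (b : Bool) : Set (ZSeq Bool) :=
  {η | ∀ i : ℤ, -((n : ℤ) + l) ≤ i → i ≤ -(n : ℤ) → η i = b}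

/-- The event that `η_i = b` for `−n ≤ i ≤ −1`. -/
def allBlock (n : ℕ) (b : Bool) : Set (ZSeq Bool) :=
  {η | ∀ i : ℤ, -(n : ℤ) ≤ i → i ≤ -1 → η i = b}

/-- `P` is the g-function `P^{+,b}` obtained from `ν` by conditioning on the symbol `b`
in the far past: `P(a|ω) = lim_n lim_l ν(η₀ = a | η = b on [−(n+l),−(n+1)], η = ω on [−n,−1])`,
both iterated limits being required to exist. -/
def IsCondG (ν : Measure (ZSeq Bool)) (b : Bool) (P : Bool → Past Bool → ℝ) : Prop :=
  ∀ (a : Bool) (ω : Past Bool), ∃ L : ℕ → ℝ,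
    (∀ n, Tendsto (fun l => condProbR ν {η | η 0 = a} (pastEvt n l b ω)) atTop (𝓝 (L n))) ∧
    Tendsto L atTop (𝓝 (P a ω))

/-- `ν'` is the iterated weak limit `lim_n lim_l ν( · | η = b on [−(n+l),−n])`. -/
def IsCondLimitMeasure (ν : Measure (ZSeq Bool)) (b : Bool) (ν' : Measure (ZSeq Bool)) : Prop :=
  ∃ νseq : ℕ → Measure (ZSeq Bool),
    (∀ n, CylTendsto (fun l => ν[|blockEvt n l b]) (νseq n)) ∧ CylTendsto νseq ν'

/-- Stochastic domination: `ν ≤ μ` iff `ν B ≤ μ B` for every increasing measurable event `B`. -/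
def StochDom {A : Type*} [MeasurableSpace A] [Preorder A]
    (ν μ : Measure (ZSeq A)) : Prop :=
  ∀ B : Set (ZSeq A), MeasurableSet B → (∀ ⦃x y : ZSeq A⦄, x ≤ y → x ∈ B → y ∈ B) → ν B ≤ μ B

/-- `π` is the i.i.d. product measure with `π(η_i = +1) = ρ` for each coordinate. -/
def IsBernoulliProd (ρ : ℝ) (π : Measure (ZSeq Bool)) : Prop :=
  IsProbabilityMeasure π ∧ ∀ (s : Finset ℤ) (f : ℤ → Bool),
    π {η | ∀ i ∈ s, η i = f i} = ∏ i ∈ s, ENNReal.ofReal (if f i then ρ else 1 - ρ)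

/-- Splicing of pasts: coordinates `−k,…,−1` (indices `< k`) from `ω`, the rest from `σ`. -/
def splice {A : Type*} (σ ω : Past A) (k : ℕ) : Past A := fun j => if j < k then ω j else σ j

/-- `ν'` is an extreme point of the convex set of g-measures consistent with `P`. -/
def ExtremeGMeasure (ν' : Measure (ZSeq Bool)) (P : Bool → Past Bool → ℝ) : Prop :=
  IsGMeasure ν' P ∧
  ∀ ν₁ ν₂ : Measure (ZSeq Bool), IsGMeasure ν₁ P → IsGMeasure ν₂ P →
    ∀ t : ℝ, t ∈ Set.Ioo (0 : ℝ) 1 →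
      ν' = ENNReal.ofReal t • ν₁ + ENNReal.ofReal (1 - t) • ν₂ → ν₁ = ν' ∧ ν₂ = ν'

/-- The event that the spins on the line are `−1` on `{−m,…,−n} × {0}`. -/
def lineMinusEvt (n m : ℕ) : Set Cfg2 :=
  {η | ∀ i : ℤ, -(m : ℤ) ≤ i → i ≤ -(n : ℤ) → η (i, 0) = false}

/-- Nearest-neighbour adjacency in `ℤ²` (`‖x−y‖₁ = 1`). -/
def adj2 (x y : ℤ × ℤ) : Prop := (x.1 - y.1).natAbs + (x.2 - y.2).natAbs = 1

/-- The event `A_n`: there is an infinite nearest-neighbour path of `+1` spins starting at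
`(n,0)` entirely contained in the half-plane `{x ≤ n}`. -/
def plusPathEvt (n : ℕ) : Set Cfg2 :=
  {η | ∃ γ : ℕ → ℤ × ℤ, γ 0 = ((n : ℤ), 0) ∧ (∀ j, adj2 (γ j) (γ (j + 1))) ∧
    Function.Injective γ ∧ (∀ j, (γ j).1 ≤ (n : ℤ)) ∧ ∀ j, η (γ j) = true}

/-- The block map for the decimation `ν_{l,k}`: the `j`-th letter consists of the spins on
`[j(k+l), j(k+l)+l−1]`. -/
def blockMap (l k : ℕ) (η : ZSeq Bool) : ZSeq (Fin l → Bool) :=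
  fun j r => η (j * ((k : ℤ) + l) + r)

end

set_option linter.unusedSectionVars false
set_option linter.unusedFintypeInType false
set_option linter.unusedDecidableInType false

section FiniteSpins

variable {V : Type*} [Fintype V] [DecidableEq V]

/-- The sign by which a Boolean flip acts on a spin: `true` flips, `false` does not. -/
noncomputable def flipSign (b : Bool) : ℝ := if b then -1 else 1

/-- The configuration `η` with the spins of the sites in `{c = true}` flipped. -/
def twist (c η : V → Bool) : V → Bool := fun x => xor (η x) (c x)

/-- Boltzmann weight `exp (∑ J x y s_x s_y)` with pair couplings `J`. -/
noncomputable def pairWt (J : V → V → ℝ) (η : V → Bool) : ℝ :=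
  Real.exp (∑ x, ∑ y, J x y * (sval (η x) * sval (η y)))

/-- Unnormalized expectation for the weight `pairWt J`. -/
noncomputable def pairSum (J : V → V → ℝ) (F : (V → Bool) → ℝ) : ℝ := ∑ η, pairWt J η * F η

/-- Indicator of `η = ω` on `P`. -/
def agreeOn (P : Finset V) (ω η : V → Bool) : ℝ := if ∀ x ∈ P, η x = ω x then 1 else 0

/-- The all-plus configuration. -/
def allPlus : V → Bool := fun _ => true

/-- The cone generated by monomials in the spins with nonnegative coefficients. -/
inductive SpinCone : ((V → Bool) → ℝ) → Prop
  | mon (c : ℝ) (hc : 0 ≤ c) (n : V → ℕ) : SpinCone (fun η => c * ∏ x, sval (η x) ^ n x)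
  | add (f g : (V → Bool) → ℝ) : SpinCone f → SpinCone g → SpinCone (fun η => f η + g η)

theorem sval_xor (a b : Bool) : sval (xor a b) = sval a * flipSign b := by
  cases a <;> cases b <;> simp [sval, flipSign]

theorem flipSign_mul_self (b : Bool) : flipSign b * flipSign b = 1 := by
  cases b <;> simp [flipSign]

theorem sval_twist (c η : V → Bool) (x : V) : sval (twist c η x) = sval (η x) * flipSign (c x) :=
  sval_xor _ _

theorem sval_not (b : Bool) : sval (!b) = - sval b := by cases b <;> simp [sval]

theorem sval_eq_or (b : Bool) : sval b = 1 ∨ sval b = -1 := by cases b <;> simp [sval]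

theorem abs_sval (b : Bool) : |sval b| = 1 := by cases b <;> simp [sval]

theorem pairWt_pos (J : V → V → ℝ) (η : V → Bool) : 0 < pairWt J η := Real.exp_pos _

theorem pairWt_add (J K : V → V → ℝ) (η : V → Bool) :
    pairWt (fun x y => J x y + K x y) η = pairWt J η * pairWt K η := by
  simp only [pairWt, ← Real.exp_add, ← Finset.sum_add_distrib]
  congr 1
  refine Finset.sum_congr rfl fun x _ => Finset.sum_congr rfl fun y _ => by ring

theorem pairWt_twist (J : V → V → ℝ) (c η : V → Bool) :
    pairWt J (twist c η) = pairWt (fun x y => J x y * (flipSign (c x) * flipSign (c y))) η := by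
  simp only [pairWt, sval_twist]
  congr 1
  refine Finset.sum_congr rfl fun x _ => Finset.sum_congr rfl fun y _ => by ring

theorem agreeOn_nonneg (P : Finset V) (ω η : V → Bool) : 0 ≤ agreeOn P ω η := by
  unfold agreeOn; split_ifs <;> norm_num

theorem twist_twist (c η : V → Bool) : twist c (twist c η) = η := by
  funext x; simp [twist]

/-- Summing over pairs of configurations by summing over the first one and the twist. -/
theorem sum_pair_eq_sum_twist (F : (V → Bool) → (V → Bool) → ℝ) :
    ∑ σ, ∑ σ', F σ σ' = ∑ c, ∑ σ, F σ (twist c σ) := by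
  rw [Finset.sum_comm (s := (Finset.univ : Finset (V → Bool)))
    (f := fun c σ => F σ (twist c σ))]
  refine Finset.sum_congr rfl fun σ _ => ?_
  refine Finset.sum_bij' (fun σ' _ => twist σ' σ) (fun c _ => twist c σ)
    (fun _ _ => Finset.mem_univ _) (fun _ _ => Finset.mem_univ _) ?_ ?_ ?_
  · intro a _; funext x; simp [twist]
  · intro a _; funext x; simp [twist]
  · intro a _
    congr 1
    funext x; simp [twist]

namespace SpinCone

theorem const {c : ℝ} (hc : 0 ≤ c) : SpinCone (V := V) (fun _ => c) := by
  simpa using SpinCone.mon (V := V) c hc 0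

theorem spin (x : V) : SpinCone (fun η : V → Bool => sval (η x)) := by
  have := SpinCone.mon (V := V) 1 zero_le_one (fun z => if z = x then 1 else 0)
  simpa [Finset.prod_ite_eq', pow_ite] using this

theorem mul {f g : (V → Bool) → ℝ} (hf : SpinCone f) (hg : SpinCone g) :
    SpinCone (fun η => f η * g η) := by
  induction hf with
  | mon c hc n =>
    induction hg with
    | mon d hd k =>
      have := SpinCone.mon (V := V) (c * d) (mul_nonneg hc hd) (n + k)
      convert this using 2 with η
      simp only [Pi.add_apply, pow_add, Finset.prod_mul_distrib]; ring
    | add g₁ g₂ _ _ h₁ h₂ => simpa only [mul_add] using SpinCone.add _ _ h₁ h₂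
  | add f₁ f₂ _ _ h₁ h₂ => simpa only [add_mul] using SpinCone.add _ _ h₁ h₂

theorem sum {ι : Type*} (s : Finset ι) {f : ι → (V → Bool) → ℝ} (hf : ∀ i ∈ s, SpinCone (f i)) :
    SpinCone (fun η => ∑ i ∈ s, f i η) := by
  classical
  induction s using Finset.induction_on with
  | empty => simpa using const (V := V) le_rfl
  | insert a s ha ih =>
    simp only [Finset.sum_insert ha]
    exact .add _ _ (hf a (by simp)) (ih fun i hi => hf i (by simp [hi]))

theorem prod {ι : Type*} (s : Finset ι) {f : ι → (V → Bool) → ℝ} (hf : ∀ i ∈ s, SpinCone (f i)) :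
    SpinCone (fun η => ∏ i ∈ s, f i η) := by
  classical
  induction s using Finset.induction_on with
  | empty => simpa using const (V := V) zero_le_one
  | insert a s ha ih =>
    simp only [Finset.prod_insert ha]
    exact (hf a (by simp)).mul (ih fun i hi => hf i (by simp [hi]))

theorem exp_pair {a : ℝ} (ha : 0 ≤ a) (x y : V) :
    SpinCone (fun η : V → Bool => Real.exp (a * (sval (η x) * sval (η y)))) := by
  have h : SpinCone (fun η : V → Bool =>
      Real.cosh a + Real.sinh a * (sval (η x) * sval (η y))) :=
    .add _ _ (const (Real.cosh_pos a).le)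
      ((const (Real.sinh_nonneg_iff.2 ha)).mul ((spin x).mul (spin y)))
  convert h using 2 with η
  have : sval (η x) * sval (η y) = 1 ∨ sval (η x) * sval (η y) = -1 := by
    rcases sval_eq_or (η x) with h | h <;> rcases sval_eq_or (η y) with h' | h' <;> simp [h, h']
  rcases this with h | h
  · rw [h, mul_one, mul_one, Real.cosh_add_sinh]
  · rw [h, mul_neg_one, mul_neg_one, ← sub_eq_add_neg, Real.cosh_sub_sinh]

theorem pairWt {J : V → V → ℝ} (hJ : ∀ x y, 0 ≤ J x y) : SpinCone (pairWt J) := by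
  have : SpinCone (fun η : V → Bool =>
      ∏ x, ∏ y, Real.exp (J x y * (sval (η x) * sval (η y)))) :=
    prod _ fun x _ => prod _ fun y _ => exp_pair (hJ x y) x y
  convert this using 2 with η
  simp only [_root_.pairWt, Real.exp_sum]

theorem agreeOn_plus (P : Finset V) : SpinCone (agreeOn P allPlus) := by
  have h : SpinCone (fun η : V → Bool => ∏ x ∈ P, (1 / 2 + 1 / 2 * sval (η x))) :=
    prod _ fun x _ => .add _ _ (const (by norm_num)) ((const (by norm_num)).mul (spin x))
  convert h using 2 with η
  unfold agreeOn allPlus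
  split_ifs with hP
  · refine (Finset.prod_eq_one fun x hx => ?_).symm
    rw [hP x hx]; norm_num [sval]
  · push Not at hP
    obtain ⟨x, hx, hx'⟩ := hP
    refine (Finset.prod_eq_zero hx ?_).symm
    cases hb : η x
    · norm_num [sval]
    · exact absurd hb hx'

theorem sum_nonneg {f : (V → Bool) → ℝ} (hf : SpinCone f) : 0 ≤ ∑ η, f η := by
  induction hf with
  | mon c hc n =>
    rw [← Finset.mul_sum]
    refine mul_nonneg hc ?_
    have := (Finset.prod_univ_sum (fun _ : V => (Finset.univ : Finset Bool))
      (fun x b => sval b ^ n x))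
    rw [Fintype.piFinset_univ] at this
    rw [← this]
    refine Finset.prod_nonneg fun x _ => ?_
    rcases Nat.even_or_odd (n x) with h | h <;> simp [sval, h.neg_one_pow]
  | add f g _ _ hf hg => rw [Finset.sum_add_distrib]; exact add_nonneg hf hg

theorem prod_flipSign (c : V → Bool) (n : V → ℕ) :
    ∏ x, flipSign (c x) ^ n x = 1 ∨ ∏ x, flipSign (c x) ^ n x = -1 := by
  refine sq_eq_one_iff.1 ?_
  rw [← Finset.prod_pow]
  refine Finset.prod_eq_one fun x _ => ?_
  rw [← pow_mul, mul_comm, pow_mul, sq, flipSign_mul_self, one_pow]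

theorem twist_eq (c η : V → Bool) (n : V → ℕ) :
    ∏ x, sval (twist c η x) ^ n x = (∏ x, flipSign (c x) ^ n x) * ∏ x, sval (η x) ^ n x := by
  simp only [sval_twist, mul_pow, Finset.prod_mul_distrib]; ring

theorem sub_twist {f : (V → Bool) → ℝ} (hf : SpinCone f) (c : V → Bool) :
    SpinCone (fun η => f η - f (twist c η)) := by
  induction hf with
  | mon a ha n =>
    simp only [twist_eq]
    rcases prod_flipSign c n with h | h
    · simpa [h] using const (V := V) le_rfl
    · convert SpinCone.mon (V := V) (2 * a) (by positivity) n using 2 with η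
      rw [h]; ring
  | add f g _ _ hf hg =>
    convert hf.add _ _ hg using 2 with η
    ring

theorem add_twist {f : (V → Bool) → ℝ} (hf : SpinCone f) (c : V → Bool) :
    SpinCone (fun η => f η + f (twist c η)) := by
  induction hf with
  | mon a ha n =>
    simp only [twist_eq]
    rcases prod_flipSign c n with h | h
    · convert SpinCone.mon (V := V) (2 * a) (by positivity) n using 2 with η
      rw [h]; ring
    · simpa [h] using const (V := V) le_rfl
  | add f g _ _ hf hg =>
    convert hf.add _ _ hg using 2 with η
    ring

end SpinCone

theorem agreeOn_mul_twist {P P' : Finset V} (hP : P ⊆ P') (ω c η : V → Bool) :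
    agreeOn P' allPlus η * agreeOn P ω (twist c η) =
      agreeOn P' allPlus η * (if ∀ x ∈ P, c x = !ω x then 1 else 0) := by
  unfold agreeOn
  split_ifs with h1 h2 h3 h3 <;> try simp
  · exact h3 fun x hx => by
      have := h2 x hx; rw [twist, h1 x (hP hx)] at this; simpa [allPlus] using congrArg not this
  · exact h2 fun x hx => by
      rw [twist, h1 x (hP hx), h3 x hx]; simp [allPlus]

/-- Ginibre's inequality for two systems with comparable couplings, the spins being frozen to `+`
on `P'` in the system with the larger couplings and to `ω` on `P ⊆ P'` in the other one. -/
theorem ginibre {K K' : V → V → ℝ} (hK : ∀ x y, |K x y| ≤ K' x y) {P P' : Finset V} (hP : P ⊆ P')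
    (ω : V → Bool) {f : (V → Bool) → ℝ} (hf : SpinCone f) :
    pairSum K (fun η => f η * agreeOn P ω η) * pairSum K' (agreeOn P' allPlus) ≤
      pairSum K' (fun η => f η * agreeOn P' allPlus η) * pairSum K (agreeOn P ω) := by
  rw [← sub_nonneg]
  have key : pairSum K' (fun η => f η * agreeOn P' allPlus η) * pairSum K (agreeOn P ω) -
      pairSum K (fun η => f η * agreeOn P ω η) * pairSum K' (agreeOn P' allPlus) =
      ∑ σ, ∑ σ', (f σ - f σ') * (pairWt K' σ * pairWt K σ') *
        (agreeOn P' allPlus σ * agreeOn P ω σ') := by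
    rw [mul_comm (pairSum K _)]
    simp only [pairSum, Finset.sum_mul_sum, ← Finset.sum_sub_distrib]
    refine Finset.sum_congr rfl fun σ _ => Finset.sum_congr rfl fun σ' _ => by ring
  rw [key, sum_pair_eq_sum_twist]
  refine Finset.sum_nonneg fun c _ => SpinCone.sum_nonneg ?_
  simp only [agreeOn_mul_twist hP, pairWt_twist K, ← pairWt_add]
  refine ((hf.sub_twist c).mul (SpinCone.pairWt fun x y => ?_)).mul
    ((SpinCone.agreeOn_plus P').mul (SpinCone.const ?_))
  · have h := hK x y
    have h2 : flipSign (c x) * flipSign (c y) = 1 ∨ flipSign (c x) * flipSign (c y) = -1 := by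
      cases c x <;> cases c y <;> simp [flipSign]
    rcases h2 with h2 | h2 <;> rw [h2] <;> linarith [neg_abs_le (K x y), le_abs_self (K x y)]
  · split_ifs <;> norm_num

theorem pairSum_pos {J : V → V → ℝ} {F : (V → Bool) → ℝ} (hF : ∀ η, 0 ≤ F η) {η₀ : V → Bool}
    (h : 0 < F η₀) : 0 < pairSum J F :=
  Finset.sum_pos' (fun η _ => mul_nonneg (pairWt_pos J η).le (hF η))
    ⟨η₀, Finset.mem_univ _, mul_pos (pairWt_pos J η₀) h⟩

theorem pairSum_agreeOn_pos (J : V → V → ℝ) (P : Finset V) (ω : V → Bool) :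
    0 < pairSum J (agreeOn P ω) :=
  pairSum_pos (agreeOn_nonneg P ω) (η₀ := ω) (by simp [agreeOn])

end FiniteSpins

section FiniteSpins

variable {V : Type*} [Fintype V] [DecidableEq V]

theorem pairSum_mono {J K : V → V → ℝ} (h : ∀ x y, J x y ≤ K x y) (hJ : ∀ x y, 0 ≤ J x y)
    {f : (V → Bool) → ℝ} (hf : SpinCone f) (hf0 : ∀ η, 0 ≤ f η) : pairSum J f ≤ pairSum K f := by
  rw [← sub_nonneg, pairSum, pairSum, ← Finset.sum_sub_distrib]
  have hcone : SpinCone (fun η => pairWt J η * f η *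
      ∑ x, ∑ y, (K x y - J x y) * (sval (η x) * sval (η y))) :=
    ((SpinCone.pairWt hJ).mul hf).mul (SpinCone.sum _ fun x _ => SpinCone.sum _ fun y _ =>
      (SpinCone.const (sub_nonneg.2 (h x y))).mul ((SpinCone.spin x).mul (SpinCone.spin y)))
  refine hcone.sum_nonneg.trans (Finset.sum_le_sum fun η _ => ?_)
  have hK : pairWt K η = pairWt J η * pairWt (fun x y => K x y - J x y) η := by
    rw [← pairWt_add]; congr 1; funext x y; ring
  have h1 := Real.add_one_le_exp (∑ x, ∑ y, (K x y - J x y) * (sval (η x) * sval (η y)))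
  change _ ≤ pairWt (fun x y => K x y - J x y) η at h1
  rw [hK]
  have h2 := mul_nonneg (pairWt_pos J η).le (hf0 η)
  nlinarith

/-- The couplings `2 J` restricted to pairs inside `{A = true}`. -/
def resCoupling (J : V → V → ℝ) (A : V → Bool) : V → V → ℝ :=
  fun x y => if A x = true ∧ A y = true then 2 * J x y else 0

/-- Partition function with the doubled couplings inside `A` and boundary condition `ω` on `P`. -/
noncomputable def resZ (J : V → V → ℝ) (P : Finset V) (ω A : V → Bool) : ℝ :=
  pairSum (resCoupling J A) (agreeOn P ω)

theorem resZ_pos (J : V → V → ℝ) (P : Finset V) (ω A : V → Bool) : 0 < resZ J P ω A :=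
  pairSum_agreeOn_pos _ _ _

variable {J : V → V → ℝ}

theorem resCoupling_nonneg (hJ : ∀ x y, 0 ≤ J x y) (A : V → Bool) (x y : V) : 0 ≤ resCoupling J A x y := by
  unfold resCoupling; split_ifs <;> nlinarith [hJ x y]

theorem resCoupling_mono (hJ : ∀ x y, 0 ≤ J x y) {A B : V → Bool} (h : A ≤ B) (x y : V) :
    resCoupling J A x y ≤ resCoupling J B x y := by
  unfold resCoupling
  split_ifs with h1 h2 h2
  · exact le_rfl
  · exact absurd ⟨h x h1.1, h y h1.2⟩ h2
  · nlinarith [hJ x y]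
  · exact le_rfl

theorem pairSum_mul_pairWt (K L : V → V → ℝ) (f : (V → Bool) → ℝ) :
    pairSum K (fun η => pairWt (fun x y => L x y - K x y) η * f η) = pairSum L f := by
  refine Finset.sum_congr rfl fun η _ => ?_
  rw [← mul_assoc, ← pairWt_add]
  congr 2; funext x y; ring

/-- Griffiths-type inequality: removing couplings favours arbitrary boundary conditions. -/
theorem resZ_mul_le (hJ : ∀ x y, 0 ≤ J x y) {A' A : V → Bool} (h : A' ≤ A) {P P' : Finset V} (hP : P ⊆ P') (ω : V → Bool) :
    resZ J P ω A * resZ J P' allPlus A' ≤ resZ J P' allPlus A * resZ J P ω A' := by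
  have := ginibre (K := resCoupling J A') (K' := resCoupling J A')
    (fun x y => (abs_of_nonneg (resCoupling_nonneg hJ A' x y)).le) hP ω
    (SpinCone.pairWt (J := fun x y => resCoupling J A x y - resCoupling J A' x y)
      fun x y => sub_nonneg.2 (resCoupling_mono hJ h x y))
  rwa [pairSum_mul_pairWt, pairSum_mul_pairWt] at this

theorem resZ_supermodular (hJ : ∀ x y, 0 ≤ J x y) (P : Finset V) (A B : V → Bool) :
    resZ J P allPlus A * resZ J P allPlus B ≤
      resZ J P allPlus (A ⊓ B) * resZ J P allPlus (A ⊔ B) := by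
  have h1 := ginibre (K := resCoupling J (A ⊓ B)) (K' := resCoupling J B)
    (fun x y => (abs_of_nonneg (resCoupling_nonneg hJ _ x y)).le.trans
      (resCoupling_mono hJ inf_le_right x y)) (subset_refl P) allPlus
    (SpinCone.pairWt (J := fun x y => resCoupling J A x y - resCoupling J (A ⊓ B) x y)
      fun x y => sub_nonneg.2 (resCoupling_mono hJ inf_le_left x y))
  rw [pairSum_mul_pairWt] at h1
  have h2 : pairSum (resCoupling J B) (fun η =>
      pairWt (fun x y => resCoupling J A x y - resCoupling J (A ⊓ B) x y) η *
        agreeOn P allPlus η) ≤ pairSum (resCoupling J (A ⊔ B)) (agreeOn P allPlus) := by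
    have h3 : pairSum (resCoupling J B) (fun η =>
      pairWt (fun x y => resCoupling J A x y - resCoupling J (A ⊓ B) x y) η *
        agreeOn P allPlus η) =
        pairSum (fun x y => resCoupling J B x y +
          (resCoupling J A x y - resCoupling J (A ⊓ B) x y)) (agreeOn P allPlus) := by
      refine Finset.sum_congr rfl fun η _ => ?_
      rw [← mul_assoc, ← pairWt_add]
    rw [h3]
    refine pairSum_mono (fun x y => ?_) (fun x y => ?_) (SpinCone.agreeOn_plus P)
      (agreeOn_nonneg P _)
    · have := hJ x y
      unfold resCoupling
      have hmin : ∀ a b : Bool, (a ⊓ b) = true ↔ a = true ∧ b = true := by decide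
      have hmax : ∀ a b : Bool, (a ⊔ b) = true ↔ a = true ∨ b = true := by decide
      simp only [Pi.inf_apply, Pi.sup_apply, hmin, hmax]
      by_cases h1 : A x = true <;> by_cases h2 : B x = true <;> by_cases h3 : A y = true <;>
        by_cases h4 : B y = true <;> simp [h1, h2, h3, h4] <;> linarith
    · exact add_nonneg (resCoupling_nonneg hJ _ x y)
        (sub_nonneg.2 (resCoupling_mono hJ inf_le_left x y))
  calc resZ J P allPlus A * resZ J P allPlus B
      ≤ _ := h1
    _ ≤ resZ J P allPlus (A ⊔ B) * resZ J P allPlus (A ⊓ B) :=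
        mul_le_mul_of_nonneg_right h2 (resZ_pos J P _ _).le
    _ = _ := mul_comm _ _

/-- Functions of disjoint sets of spins are uncorrelated under counting measure. -/
theorem card_mul_sum_mul (c : V → Bool) (F G : (V → Bool) → ℝ)
    (hF : ∀ η η', (∀ x, c x = true → η x = η' x) → F η = F η')
    (hG : ∀ η η', (∀ x, c x = false → η x = η' x) → G η = G η') :
    (Fintype.card (V → Bool) : ℝ) * ∑ η, F η * G η = (∑ η, F η) * ∑ η, G η := by
  have hinv : Function.Involutive (fun p : (V → Bool) × (V → Bool) =>
      ((fun x => if c x then p.1 x else p.2 x : V → Bool),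
        (fun x => if c x then p.2 x else p.1 x : V → Bool))) := by
    rintro ⟨a, b⟩
    ext x <;> simp only <;> split_ifs <;> rfl
  let e : ((V → Bool) × (V → Bool)) ≃ ((V → Bool) × (V → Bool)) := hinv.toPerm _
  rw [Finset.sum_mul_sum, ← Fintype.sum_prod_type',
    ← Equiv.sum_comp e (fun p : (V → Bool) × (V → Bool) => F p.1 * G p.2)]
  have : ∀ p : (V → Bool) × (V → Bool), F (e p).1 * G (e p).2 = F p.1 * G p.1 := by
    rintro ⟨a, b⟩
    congr 1
    · exact hF _ _ fun x hx => by simp [e, Function.Involutive.toPerm, hx]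
    · exact hG _ _ fun x hx => by simp [e, Function.Involutive.toPerm, hx]
  simp only [this]
  rw [Fintype.sum_prod_type]
  simp [Finset.mul_sum]

end FiniteSpins

section FiniteSpins

variable {V : Type*} [Fintype V] [DecidableEq V] {J : V → V → ℝ}

/-- The all-minus configuration. -/
def allMinus : V → Bool := fun _ => false

/-- Indicator that `c` separates `O` (where it is `true`) from `T` (where it is `false`). -/
def separates (O T : Finset V) (c : V → Bool) : ℝ :=
  if (∀ x ∈ O, c x = true) ∧ ∀ x ∈ T, c x = false then 1 else 0

theorem pairWt_mul_twist (J : V → V → ℝ) (c η : V → Bool) :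
    pairWt J η * pairWt J (twist c η) =
      pairWt (resCoupling J c) η * pairWt (resCoupling J fun x => !c x) η := by
  rw [pairWt_twist, ← pairWt_add, ← pairWt_add]
  congr 1
  funext x y
  unfold resCoupling flipSign
  by_cases hx : c x = true <;> by_cases hy : c y = true <;> simp [hx, hy] <;> ring

theorem boundary_mul_twist (O T : Finset V) (ω c η : V → Bool) :
    (agreeOn O allPlus η * agreeOn T ω η) *
        (agreeOn O allMinus (twist c η) * agreeOn T ω (twist c η)) =
      separates O T c * (agreeOn O allPlus η * agreeOn T ω η) := by
  by_cases h1 : ∀ x ∈ O, η x = true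
  · by_cases h2 : ∀ x ∈ T, η x = ω x
    · have e1 : agreeOn O allPlus η = 1 := if_pos h1
      have e2 : agreeOn T ω η = 1 := if_pos h2
      have e3 : (∀ x ∈ O, twist c η x = false) ↔ ∀ x ∈ O, c x = true := by
        refine forall₂_congr fun x hx => ?_
        rw [twist, h1 x hx]; cases c x <;> simp
      have e4 : (∀ x ∈ T, twist c η x = ω x) ↔ ∀ x ∈ T, c x = false := by
        refine forall₂_congr fun x hx => ?_
        rw [twist, h2 x hx]; cases c x <;> simp
      rw [e1, e2]
      unfold agreeOn separates allMinus
      simp only [e3, e4]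
      by_cases a : ∀ x ∈ O, c x = true
      · by_cases b : ∀ x ∈ T, c x = false
        · rw [if_pos a, if_pos b, if_pos ⟨a, b⟩]; norm_num
        · rw [if_pos a, if_neg b, if_neg (fun h : _ ∧ _ => b h.2)]; norm_num
      · rw [if_neg a, if_neg (fun h : _ ∧ _ => a h.1)]; norm_num
    · have : agreeOn T ω η = 0 := if_neg h2
      simp [this]
  · have : agreeOn O allPlus η = 0 := if_neg h1
    simp [this]

theorem agreeOn_congr {P : Finset V} {ω η η' : V → Bool} (h : ∀ x ∈ P, η x = η' x) :
    agreeOn P ω η = agreeOn P ω η' := by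
  unfold agreeOn
  simp only [forall₂_congr fun x hx => (by rw [h x hx] : η x = ω x ↔ η' x = ω x)]

theorem pairWt_resCoupling_congr {A η η' : V → Bool} (h : ∀ x, A x = true → η x = η' x) :
    pairWt (resCoupling J A) η = pairWt (resCoupling J A) η' := by
  unfold pairWt resCoupling
  congr 1
  refine Finset.sum_congr rfl fun x _ => Finset.sum_congr rfl fun y _ => ?_
  split_ifs with hA
  · rw [h x hA.1, h y hA.2]
  · simp

theorem double_sum_decouple (J : V → V → ℝ) (O T : Finset V) (ω : V → Bool)
    (g G : (V → Bool) → (V → Bool) → ℝ) (hg : ∀ c σ, g σ (twist c σ) = G c σ)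
    (hG : ∀ c η η', (∀ x, c x = true → η x = η' x) → G c η = G c η') :
    (Fintype.card (V → Bool) : ℝ) * ∑ σ, ∑ σ', g σ σ' * (pairWt J σ * pairWt J σ') *
        ((agreeOn O allPlus σ * agreeOn T ω σ) * (agreeOn O allMinus σ' * agreeOn T ω σ')) =
      ∑ c, separates O T c * (pairSum (resCoupling J c) (fun η => G c η * agreeOn O allPlus η) *
        resZ J T ω (fun x => !c x)) := by
  rw [sum_pair_eq_sum_twist, Finset.mul_sum]
  refine Finset.sum_congr rfl fun c _ => ?_
  simp only [boundary_mul_twist, hg, pairWt_mul_twist]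
  by_cases hs : (∀ x ∈ O, c x = true) ∧ ∀ x ∈ T, c x = false
  · have : separates O T c = 1 := if_pos hs
    simp only [this, one_mul]
    rw [resZ, pairSum, pairSum, ← card_mul_sum_mul c]
    · congr 1
      refine Finset.sum_congr rfl fun η _ => by ring
    · intro η η' h
      rw [pairWt_resCoupling_congr h, hG c η η' h, agreeOn_congr fun x hx => h x (hs.1 x hx)]
    · intro η η' h
      rw [pairWt_resCoupling_congr (fun x hx => h x (by simpa using hx)),
        agreeOn_congr fun x hx => h x (hs.2 x hx)]
  · have : separates O T c = 0 := if_neg hs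
    simp [this]

/-- Unnormalized expectation with boundary condition `ε` on `O` and `ω` on `T`. -/
noncomputable def bdSum (J : V → V → ℝ) (O : Finset V) (ε : V → Bool) (T : Finset V)
    (ω : V → Bool) (F : (V → Bool) → ℝ) : ℝ :=
  pairSum J (fun η => F η * (agreeOn O ε η * agreeOn T ω η))

theorem bdSum_one_pos (J : V → V → ℝ) {O T : Finset V} (h : Disjoint O T) (ε ω : V → Bool) :
    0 < bdSum J O ε T ω (fun _ => 1) := by
  refine pairSum_pos (fun η => ?_) (η₀ := fun x => if x ∈ O then ε x else ω x) ?_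
  · exact mul_nonneg zero_le_one (mul_nonneg (agreeOn_nonneg _ _ _) (agreeOn_nonneg _ _ _))
  · have h1 : agreeOn O ε (fun x => if x ∈ O then ε x else ω x) = 1 :=
      if_pos fun x hx => by simp [hx]
    have h2 : agreeOn T ω (fun x => if x ∈ O then ε x else ω x) = 1 :=
      if_pos fun x hx => by simp [Finset.disjoint_right.1 h hx]
    simp [h1, h2]

/-- The magnetization at `x` with boundary condition `ε` on `O` and `ω` on `T`. -/
noncomputable def bdMag (J : V → V → ℝ) (O : Finset V) (ε : V → Bool) (T : Finset V)
    (ω : V → Bool) (x : V) : ℝ :=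
  bdSum J O ε T ω (fun η => sval (η x)) / bdSum J O ε T ω (fun _ => 1)

/-- The magnetization at `x` in the cluster weight `{c = true}` with plus boundary condition. -/
noncomputable def clusterMag (J : V → V → ℝ) (O : Finset V) (x : V) (c : V → Bool) : ℝ :=
  if c x = true then
    pairSum (resCoupling J c) (fun η => sval (η x) * agreeOn O allPlus η) / resZ J O allPlus c
  else 0

theorem bdMag_sub_bdMag (J : V → V → ℝ) {O T : Finset V} (hOT : Disjoint O T) (ω : V → Bool)
    (x : V) :
    bdMag J O allPlus T ω x - bdMag J O allMinus T ω x =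
      2 * (∑ c, separates O T c * (clusterMag J O x c * resZ J O allPlus c *
        resZ J T ω (fun x => !c x))) /
      ∑ c, separates O T c * (resZ J O allPlus c * resZ J T ω (fun x => !c x)) := by
  have h1 := double_sum_decouple J O T ω (fun _ _ => 1) (fun _ _ => 1) (fun _ _ => rfl)
    (fun _ _ _ _ => rfl)
  have h2 := double_sum_decouple J O T ω (fun σ σ' => sval (σ x) - sval (σ' x))
    (fun c η => if c x = true then 2 * sval (η x) else 0)
    (fun c σ => by rw [sval_twist]; cases c x <;> simp [flipSign]; ring)
    (fun c η η' h => by by_cases hc : c x = true <;> simp [hc, h x])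
  have hp := bdSum_one_pos J hOT allPlus ω
  have hm := bdSum_one_pos J hOT allMinus ω
  have e1 : ∑ σ, ∑ σ', (1 : ℝ) * (pairWt J σ * pairWt J σ') *
        ((agreeOn O allPlus σ * agreeOn T ω σ) * (agreeOn O allMinus σ' * agreeOn T ω σ')) =
      bdSum J O allPlus T ω (fun _ => 1) * bdSum J O allMinus T ω (fun _ => 1) := by
    simp only [bdSum, pairSum, Finset.sum_mul_sum]
    refine Finset.sum_congr rfl fun σ _ => Finset.sum_congr rfl fun σ' _ => by ring
  have e2 : ∑ σ, ∑ σ', (sval (σ x) - sval (σ' x)) * (pairWt J σ * pairWt J σ') *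
        ((agreeOn O allPlus σ * agreeOn T ω σ) * (agreeOn O allMinus σ' * agreeOn T ω σ')) =
      bdSum J O allPlus T ω (fun η => sval (η x)) * bdSum J O allMinus T ω (fun _ => 1) -
      bdSum J O allPlus T ω (fun _ => 1) * bdSum J O allMinus T ω (fun η => sval (η x)) := by
    simp only [bdSum, pairSum, Finset.sum_mul_sum, ← Finset.sum_sub_distrib]
    refine Finset.sum_congr rfl fun σ _ => Finset.sum_congr rfl fun σ' _ => by ring
  rw [e1] at h1
  rw [e2] at h2
  have hcard : (0 : ℝ) < Fintype.card (V → Bool) := by exact_mod_cast Fintype.card_pos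
  have h3 : ∑ c, separates O T c * (pairSum (resCoupling J c)
        (fun η => (if c x = true then 2 * sval (η x) else 0) * agreeOn O allPlus η) *
        resZ J T ω (fun x => !c x)) = 2 * ∑ c, separates O T c *
        (clusterMag J O x c * resZ J O allPlus c * resZ J T ω (fun x => !c x)) := by
    rw [Finset.mul_sum]
    refine Finset.sum_congr rfl fun c _ => ?_
    unfold clusterMag
    by_cases hc : c x = true
    · simp only [hc, if_true]
      rw [div_mul_cancel₀ _ (resZ_pos J O allPlus c).ne']
      have : pairSum (resCoupling J c) (fun η => 2 * sval (η x) * agreeOn O allPlus η) =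
          2 * pairSum (resCoupling J c) (fun η => sval (η x) * agreeOn O allPlus η) := by
        simp only [pairSum, Finset.mul_sum]
        refine Finset.sum_congr rfl fun η _ => by ring
      rw [this]; ring
    · simp [hc, pairSum]
  rw [h3] at h2
  rw [← h2]
  have h4 : ∑ c, separates O T c * (resZ J O allPlus c * resZ J T ω (fun x => !c x)) =
      Fintype.card (V → Bool) * (bdSum J O allPlus T ω (fun _ => 1) *
        bdSum J O allMinus T ω (fun _ => 1)) := by
    rw [h1]
    simp only [one_mul]; rfl
  rw [h4, mul_div_mul_left _ _ hcard.ne', bdMag, bdMag, div_sub_div _ _ hp.ne' hm.ne']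

theorem separates_nonneg (O T : Finset V) (c : V → Bool) : 0 ≤ separates O T c := by
  unfold separates; split_ifs <;> norm_num

theorem separates_lattice (O T : Finset V) (a b : V → Bool) :
    separates O T a * separates O T b ≤ separates O T (a ⊓ b) * separates O T (a ⊔ b) := by
  by_cases ha : (∀ x ∈ O, a x = true) ∧ ∀ x ∈ T, a x = false
  · by_cases hb : (∀ x ∈ O, b x = true) ∧ ∀ x ∈ T, b x = false
    · have h1 : separates O T (a ⊓ b) = 1 := if_pos
        ⟨fun x hx => by simp [ha.1 x hx, hb.1 x hx], fun x hx => by simp [ha.2 x hx, hb.2 x hx]⟩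
      have h2 : separates O T (a ⊔ b) = 1 := if_pos
        ⟨fun x hx => by simp [ha.1 x hx, hb.1 x hx], fun x hx => by simp [ha.2 x hx, hb.2 x hx]⟩
      rw [h1, h2, separates, separates, if_pos ha, if_pos hb]
    · have : separates O T b = 0 := if_neg hb
      rw [this, mul_zero]
      exact mul_nonneg (separates_nonneg _ _ _) (separates_nonneg _ _ _)
  · have : separates O T a = 0 := if_neg ha
    rw [this, zero_mul]
    exact mul_nonneg (separates_nonneg _ _ _) (separates_nonneg _ _ _)

/-- The weight of the cluster of disagreement for plus boundary condition on `T`. -/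
noncomputable def clusterWt (J : V → V → ℝ) (O T : Finset V) (c : V → Bool) : ℝ :=
  separates O T c * (resZ J O allPlus c * resZ J T allPlus (fun x => !c x))

theorem clusterWt_nonneg (J : V → V → ℝ) (O T : Finset V) (c : V → Bool) :
    0 ≤ clusterWt J O T c :=
  mul_nonneg (separates_nonneg _ _ _) (mul_nonneg (resZ_pos _ _ _ _).le (resZ_pos _ _ _ _).le)

theorem not_comp_le_not_comp {a b : V → Bool} (h : a ≤ b) : (fun x => !b x) ≤ fun x => !a x := fun x => by
  have hd : ∀ p q : Bool, p ≤ q → (!q) ≤ !p := by decide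
  exact hd _ _ (h x)

theorem clusterWt_lattice (hJ : ∀ x y, 0 ≤ J x y) (O T : Finset V) (a b : V → Bool) :
    clusterWt J O T a * clusterWt J O T b ≤ clusterWt J O T (a ⊓ b) * clusterWt J O T (a ⊔ b) := by
  have h1 := separates_lattice O T a b
  have h2 := resZ_supermodular hJ O a b
  have h3 := resZ_supermodular hJ T (fun x => !a x) (fun x => !b x)
  have e1 : (fun x => !a x) ⊓ (fun x => !b x) = fun x => !(a ⊔ b) x := by
    funext x; simp only [Pi.inf_apply, Pi.sup_apply]
    cases a x <;> cases b x <;> rfl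
  have e2 : (fun x => !a x) ⊔ (fun x => !b x) = fun x => !(a ⊓ b) x := by
    funext x; simp only [Pi.inf_apply, Pi.sup_apply]
    cases a x <;> cases b x <;> rfl
  rw [e1, e2] at h3
  have h4 := mul_le_mul h1 (mul_le_mul h2 h3
    (mul_pos (resZ_pos _ _ _ _) (resZ_pos _ _ _ _)).le
    (mul_pos (resZ_pos _ _ _ _) (resZ_pos _ _ _ _)).le)
    (mul_pos (mul_pos (resZ_pos _ _ _ _) (resZ_pos _ _ _ _))
      (mul_pos (resZ_pos _ _ _ _) (resZ_pos _ _ _ _))).le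
    (mul_nonneg (separates_nonneg _ _ _) (separates_nonneg _ _ _))
  unfold clusterWt
  nlinarith [h4]

theorem clusterMag_nonneg (hJ : ∀ x y, 0 ≤ J x y) (O : Finset V) (x : V) :
    0 ≤ clusterMag J O x := fun c => by
  simp only [clusterMag, Pi.zero_apply]
  split_ifs
  · refine div_nonneg ?_ (resZ_pos _ _ _ _).le
    exact ((SpinCone.pairWt (resCoupling_nonneg hJ c)).mul
      ((SpinCone.spin x).mul (SpinCone.agreeOn_plus O))).sum_nonneg
  · exact le_rfl

theorem clusterMag_mono (hJ : ∀ x y, 0 ≤ J x y) (O : Finset V) (x : V) :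
    Monotone (clusterMag J O x) := fun c c' h => by
  by_cases hc : c x = true
  · have hc' : c' x = true := h x hc
    simp only [clusterMag, hc, hc', if_true]
    rw [div_le_div_iff₀ (resZ_pos _ _ _ _) (resZ_pos _ _ _ _)]
    exact ginibre (K := resCoupling J c) (K' := resCoupling J c')
      (fun a b => (abs_of_nonneg (resCoupling_nonneg hJ _ a b)).le.trans
        (resCoupling_mono hJ h a b)) (subset_refl O) allPlus (SpinCone.spin x)
  · have := clusterMag_nonneg hJ O x c'
    rw [clusterMag, if_neg hc]
    exact this

theorem bdMag_sub_bdMag_plus (J : V → V → ℝ) {O T : Finset V} (hOT : Disjoint O T) (x : V) :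
    bdMag J O allPlus T allPlus x - bdMag J O allMinus T allPlus x =
      2 * (∑ c, clusterWt J O T c * clusterMag J O x c) / ∑ c, clusterWt J O T c := by
  rw [bdMag_sub_bdMag J hOT]
  congr 2
  refine Finset.sum_congr rfl fun c _ => by unfold clusterWt; ring

theorem clusterWt_sum_pos (J : V → V → ℝ) {O T : Finset V} (hOT : Disjoint O T) :
    0 < ∑ c, clusterWt J O T c := by
  refine Finset.sum_pos' (fun c _ => clusterWt_nonneg J O T c)
    ⟨fun x => decide (x ∈ O), Finset.mem_univ _, ?_⟩
  have : separates O T (fun x => decide (x ∈ O)) = 1 :=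
    if_pos ⟨fun x hx => by simp [hx], fun x hx => by simp [Finset.disjoint_right.1 hOT hx]⟩
  rw [clusterWt, this, one_mul]
  exact mul_pos (resZ_pos _ _ _ _) (resZ_pos _ _ _ _)

/-- Among all boundary conditions on `T`, the constant one minimizes the influence of the boundary
condition on `O` on the magnetization. -/
theorem bdMag_influence_ge (hJ : ∀ x y, 0 ≤ J x y) {O T : Finset V} (hOT : Disjoint O T)
    (ω : V → Bool) (x : V) :
    bdMag J O allPlus T allPlus x - bdMag J O allMinus T allPlus x ≤
      bdMag J O allPlus T ω x - bdMag J O allMinus T ω x := by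
  set ρ : (V → Bool) → ℝ := fun c =>
    resZ J T ω (fun x => !c x) / resZ J T allPlus (fun x => !c x) with hρ
  have hρmono : Monotone ρ := fun c c' h => by
    simp only [hρ]
    rw [div_le_div_iff₀ (resZ_pos _ _ _ _) (resZ_pos _ _ _ _)]
    rw [mul_comm (resZ J T ω fun x => !c' x)]
    exact resZ_mul_le hJ (not_comp_le_not_comp h) (subset_refl T) ω
  have hρ0 : 0 ≤ ρ := fun c => div_nonneg (resZ_pos _ _ _ _).le (resZ_pos _ _ _ _).le
  have key := fkg (μ := clusterWt J O T) (f := ρ) (g := clusterMag J O x)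
    (clusterWt_nonneg J O T) hρ0 (clusterMag_nonneg hJ O x) hρmono (clusterMag_mono hJ O x)
    (clusterWt_lattice hJ O T)
  have hw : ∀ c, clusterWt J O T c * ρ c =
      separates O T c * (resZ J O allPlus c * resZ J T ω (fun x => !c x)) := fun c => by
    simp only [clusterWt, hρ]
    field_simp [(resZ_pos J T allPlus fun x => !c x).ne']
  have hpos : 0 < ∑ c, clusterWt J O T c * ρ c := by
    have h0 := clusterWt_sum_pos J hOT
    obtain ⟨c, -, hc⟩ := Finset.exists_lt_of_sum_lt (s := Finset.univ)
      (f := fun _ : V → Bool => (0 : ℝ)) (g := clusterWt J O T) (by simpa using h0)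
    exact Finset.sum_pos' (fun c _ => mul_nonneg (clusterWt_nonneg _ _ _ _) (hρ0 c))
      ⟨c, Finset.mem_univ _, mul_pos hc (div_pos (resZ_pos _ _ _ _) (resZ_pos _ _ _ _))⟩
  rw [bdMag_sub_bdMag_plus J hOT, bdMag_sub_bdMag J hOT]
  have e1 : ∑ c, separates O T c * (clusterMag J O x c * resZ J O allPlus c *
        resZ J T ω (fun x => !c x)) = ∑ c, clusterWt J O T c * (ρ c * clusterMag J O x c) := by
    refine Finset.sum_congr rfl fun c _ => ?_
    linear_combination (-clusterMag J O x c) * hw c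
  have e2 : ∑ c, separates O T c * (resZ J O allPlus c * resZ J T ω (fun x => !c x)) =
      ∑ c, clusterWt J O T c * ρ c := Finset.sum_congr rfl fun c _ => (hw c).symm
  rw [e1, e2, div_le_div_iff₀ (clusterWt_sum_pos J hOT) hpos]
  nlinarith [key]

/-- Freezing additional spins to plus decreases the influence of the boundary condition on `O`. -/
theorem bdMag_influence_anti (hJ : ∀ x y, 0 ≤ J x y) {O T T' : Finset V} (hTT' : T ⊆ T')
    (hOT : Disjoint O T') (x : V) :
    bdMag J O allPlus T' allPlus x - bdMag J O allMinus T' allPlus x ≤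
      bdMag J O allPlus T allPlus x - bdMag J O allMinus T allPlus x := by
  have hOT0 : Disjoint O T := hOT.mono_right hTT'
  set k : (V → Bool) → ℝ := fun c => (if ∀ x ∈ T', c x = false then 1 else 0) *
    (resZ J T' allPlus (fun x => !c x) / resZ J T allPlus (fun x => !c x)) with hk
  have hk0 : ∀ c, 0 ≤ k c := fun c => by
    simp only [hk]
    refine mul_nonneg (by split_ifs <;> norm_num) (div_nonneg (resZ_pos _ _ _ _).le
      (resZ_pos _ _ _ _).le)
  have hkanti : Antitone k := fun c c' h => by
    by_cases hc : ∀ x ∈ T', c' x = false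
    · have hc2 : ∀ x ∈ T', c x = false := fun y hy => by
        have := h y
        rw [hc y hy] at this
        exact Bool.eq_false_of_le_false this
      have e : ∀ d : V → Bool, (∀ x ∈ T', d x = false) → k d =
          resZ J T' allPlus (fun x => !d x) / resZ J T allPlus (fun x => !d x) := fun d hd => by
        simp only [hk]; rw [if_pos hd, one_mul]
      rw [e _ hc, e _ hc2, div_le_div_iff₀ (resZ_pos _ _ _ _) (resZ_pos _ _ _ _)]
      rw [mul_comm]
      exact resZ_mul_le hJ (not_comp_le_not_comp h) hTT' allPlus
    · have : k c' = 0 := by simp only [hk]; rw [if_neg hc, zero_mul]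
      rw [this]; exact hk0 c
  have hk1 : ∀ c, k c ≤ 1 := fun c => by
    simp only [hk]
    refine mul_le_one₀ (by split_ifs <;> norm_num) (div_nonneg (resZ_pos _ _ _ _).le
      (resZ_pos _ _ _ _).le) ((div_le_one (resZ_pos _ _ _ _)).2 ?_)
    refine Finset.sum_le_sum fun η _ => mul_le_mul_of_nonneg_left ?_ (pairWt_pos _ _).le
    unfold agreeOn
    split_ifs with h1 h2
    · exact le_rfl
    · exact absurd (fun x hx => h1 x (hTT' hx)) h2
    · norm_num
    · exact le_rfl
  have key := fkg (μ := clusterWt J O T) (f := fun c => 1 - k c) (g := clusterMag J O x)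
    (clusterWt_nonneg J O T) (fun c => sub_nonneg.2 (hk1 c)) (clusterMag_nonneg hJ O x)
    (fun c c' h => sub_le_sub_left (hkanti h) 1) (clusterMag_mono hJ O x)
    (clusterWt_lattice hJ O T)
  have hw : ∀ c, clusterWt J O T c * k c = clusterWt J O T' c := fun c => by
    simp only [clusterWt, hk]
    have h1 := (resZ_pos J T allPlus fun x => !c x).ne'
    have h2 : separates O T c * (if ∀ x ∈ T', c x = false then 1 else 0) = separates O T' c := by
      unfold separates
      by_cases a : ∀ x ∈ O, c x = true
      · by_cases b : ∀ x ∈ T', c x = false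
        · rw [if_pos ⟨a, fun x hx => b x (hTT' hx)⟩, if_pos b, if_pos ⟨a, b⟩, one_mul]
        · rw [if_neg b, mul_zero, if_neg (fun h : _ ∧ _ => b h.2)]
      · rw [if_neg (fun h : _ ∧ _ => a h.1), zero_mul, if_neg (fun h : _ ∧ _ => a h.1)]
    rw [← h2]
    field_simp
  simp only [mul_sub, mul_one, sub_mul, one_mul, Finset.sum_sub_distrib, ← mul_assoc, hw] at key
  rw [bdMag_sub_bdMag_plus J hOT, bdMag_sub_bdMag_plus J hOT0,
    div_le_div_iff₀ (clusterWt_sum_pos J hOT) (clusterWt_sum_pos J hOT0)]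
  nlinarith [key]

end FiniteSpins

section FiniteSpins

variable {V : Type*} [Fintype V] [DecidableEq V]

theorem sum_config_not (F : (V → Bool) → ℝ) : ∑ η : V → Bool, F (fun x => !η x) = ∑ η, F η :=
  Equiv.sum_comp (Function.Involutive.toPerm (fun η : V → Bool => fun x => !η x)
    (fun η => by funext x; simp)) F

theorem pairWt_not (J : V → V → ℝ) (η : V → Bool) : pairWt J (fun x => !η x) = pairWt J η := by
  simp [pairWt, sval_not]

theorem agreeOn_not (P : Finset V) (ω η : V → Bool) :
    agreeOn P ω (fun x => !η x) = agreeOn P (fun x => !ω x) η := by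
  unfold agreeOn
  have : ∀ x, ((!η x) = ω x) ↔ (η x = !ω x) := fun x => by
    cases η x <;> cases ω x <;> simp
  simp only [this]

/-- Global spin flip symmetry. -/
theorem bdMag_allMinus (J : V → V → ℝ) (O T : Finset V) (ω : V → Bool) (x : V) :
    bdMag J O allMinus T ω x = - bdMag J O allPlus T (fun y => !ω y) x := by
  have hf : ∀ η : V → Bool, agreeOn O allMinus η = agreeOn O allPlus (fun y => !η y) := fun η => by
    rw [agreeOn_not]; rfl
  have hT : ∀ η : V → Bool, agreeOn T ω η = agreeOn T (fun y => !ω y) (fun y => !η y) :=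
    fun η => by rw [agreeOn_not]; simp
  have h1 : bdSum J O allMinus T ω (fun _ => 1) =
      bdSum J O allPlus T (fun y => !ω y) (fun _ => 1) := by
    rw [bdSum, bdSum, pairSum, pairSum, ← sum_config_not]
    refine Finset.sum_congr rfl fun η _ => ?_
    rw [pairWt_not, hf, hT]; simp
  have h2 : bdSum J O allMinus T ω (fun η => sval (η x)) =
      - bdSum J O allPlus T (fun y => !ω y) (fun η => sval (η x)) := by
    rw [bdSum, bdSum, pairSum, pairSum, ← sum_config_not, ← Finset.sum_neg_distrib]
    refine Finset.sum_congr rfl fun η _ => ?_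
    rw [pairWt_not, hf, hT, sval_not]; simp
  rw [bdMag, bdMag, h1, h2, neg_div]

/-- Comparison of the response to flipping an arbitrary boundary condition on `T` with the response
to flipping a constant boundary condition on a larger set. -/
theorem bdMag_gap (J : V → V → ℝ) (hJ : ∀ x y, 0 ≤ J x y) {O T T' : Finset V} (hTT' : T ⊆ T')
    (hOT : Disjoint O T') (ω : V → Bool) (x : V) :
    bdMag J O allPlus T' allPlus x + bdMag J O allPlus T' allMinus x ≤
      bdMag J O allPlus T ω x + bdMag J O allPlus T (fun y => !ω y) x := by
  have h1 := bdMag_influence_anti hJ hTT' hOT x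
  have h2 := bdMag_influence_ge hJ (hOT.mono_right hTT') ω x
  rw [bdMag_allMinus] at h1 h2
  have h3 := bdMag_allMinus J O T ω x
  have h4 : (fun y => !(allPlus : V → Bool) y) = allMinus := by funext y; rfl
  rw [h4] at h1
  rw [h3] at h2
  linarith [bdMag_allMinus J O T allPlus x]

/-- Lebowitz–Pfister inequality comparing a plus boundary condition with an arbitrary one. -/
theorem pairSum_pair_ge {K : V → V → ℝ} (hK : ∀ x y, 0 ≤ K x y) (P : Finset V) (ω : V → Bool)
    (x y : V) :
    pairSum K (fun η => sval (η x) * agreeOn P allPlus η) *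
        pairSum K (fun η => sval (η y) * agreeOn P ω η) -
      pairSum K (fun η => sval (η x) * agreeOn P ω η) *
        pairSum K (fun η => sval (η y) * agreeOn P allPlus η) ≤
    pairSum K (fun η => sval (η x) * sval (η y) * agreeOn P allPlus η) *
        pairSum K (agreeOn P ω) -
      pairSum K (fun η => sval (η x) * sval (η y) * agreeOn P ω η) *
        pairSum K (agreeOn P allPlus) := by
  rw [← sub_nonneg]
  have key : pairSum K (fun η => sval (η x) * sval (η y) * agreeOn P allPlus η) *
        pairSum K (agreeOn P ω) -
      pairSum K (fun η => sval (η x) * sval (η y) * agreeOn P ω η) *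
        pairSum K (agreeOn P allPlus) -
      (pairSum K (fun η => sval (η x) * agreeOn P allPlus η) *
        pairSum K (fun η => sval (η y) * agreeOn P ω η) -
      pairSum K (fun η => sval (η x) * agreeOn P ω η) *
        pairSum K (fun η => sval (η y) * agreeOn P allPlus η)) =
      ∑ σ, ∑ σ', ((sval (σ x) + sval (σ' x)) * (sval (σ y) - sval (σ' y))) *
        (pairWt K σ * pairWt K σ') * (agreeOn P allPlus σ * agreeOn P ω σ') := by
    rw [mul_comm (pairSum K fun η => sval (η x) * sval (η y) * agreeOn P ω η),
      mul_comm (pairSum K fun η => sval (η x) * agreeOn P ω η)]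
    simp only [pairSum, Finset.sum_mul_sum, ← Finset.sum_sub_distrib]
    refine Finset.sum_congr rfl fun σ _ => Finset.sum_congr rfl fun σ' _ => by ring
  rw [key, sum_pair_eq_sum_twist]
  refine Finset.sum_nonneg fun c _ => SpinCone.sum_nonneg ?_
  simp only [agreeOn_mul_twist (subset_refl P), pairWt_twist K, ← pairWt_add]
  refine ((((SpinCone.spin x).add_twist c).mul ((SpinCone.spin y).sub_twist c)).mul
    (SpinCone.pairWt fun a b => ?_)).mul ((SpinCone.agreeOn_plus P).mul (SpinCone.const ?_))
  · have h := hK a b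
    have h2 : flipSign (c a) * flipSign (c b) = 1 ∨ flipSign (c a) * flipSign (c b) = -1 := by
      cases c a <;> cases c b <;> simp [flipSign]
    rcases h2 with h2 | h2 <;> rw [h2] <;> linarith
  · split_ifs <;> norm_num

/-- Partition functions increase when an arbitrary boundary condition is replaced by plus. -/
theorem pairSum_agreeOn_le_plus {K : V → V → ℝ} (hK : ∀ x y, 0 ≤ K x y) (P : Finset V)
    (ω : V → Bool) : pairSum K (agreeOn P ω) ≤ pairSum K (agreeOn P allPlus) := by
  have h := ginibre (K := fun _ _ : V => (0 : ℝ)) (K' := fun _ _ => 0) (by simp)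
    (subset_refl P) ω (SpinCone.pairWt hK)
  have h0 : ∀ f : (V → Bool) → ℝ, pairSum (fun _ _ => 0) f = ∑ η, f η := fun f => by
    simp [pairSum, pairWt]
  have hcount : ∑ η, agreeOn P ω η = ∑ η, agreeOn P allPlus η := by
    have e := Equiv.sum_comp (Function.Involutive.toPerm (twist fun x => !ω x)
      (twist_twist _)) (agreeOn P allPlus)
    rw [← e]
    refine Finset.sum_congr rfl fun η _ => ?_
    change _ = agreeOn P allPlus (twist (fun x => !ω x) η)
    unfold agreeOn
    have : ∀ x, η x = ω x ↔ twist (fun x => !ω x) η x = allPlus x := fun x => by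
      have hd : ∀ p q : Bool, p = q ↔ xor p (!q) = true := by decide
      exact hd _ _
    simp only [this]
  simp only [h0, hcount] at h
  have hp : 0 < ∑ η, agreeOn P allPlus η := by
    have := pairSum_agreeOn_pos (fun _ _ : V => (0 : ℝ)) P allPlus
    rwa [h0] at this
  exact le_of_mul_le_mul_right h hp

theorem hasDerivAt_pairSum (a : V → V → ℝ) (F : (V → Bool) → ℝ) (t : ℝ) :
    HasDerivAt (fun t => pairSum (fun x y => t * a x y) F)
      (∑ x, ∑ y, a x y * pairSum (fun x y => t * a x y) (fun η => sval (η x) * sval (η y) * F η))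
      t := by
  have h : ∀ η : V → Bool, HasDerivAt (fun t => pairWt (fun x y => t * a x y) η * F η)
      (pairWt (fun x y => t * a x y) η * (∑ x, ∑ y, a x y * (sval (η x) * sval (η y))) * F η) t := by
    intro η
    have h1 : (fun t => pairWt (fun x y => t * a x y) η) =
        fun t => Real.exp (t * ∑ x, ∑ y, a x y * (sval (η x) * sval (η y))) := by
      funext t
      simp only [pairWt, Finset.mul_sum, mul_assoc]
    have h2 := ((hasDerivAt_id t).mul_const
      (∑ x, ∑ y, a x y * (sval (η x) * sval (η y)))).exp
    refine HasDerivAt.mul_const ?_ _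
    have h3 := congrFun h1 t
    beta_reduce at h3
    rw [h1, h3]
    simpa using h2
  have h2 := HasDerivAt.fun_sum (u := Finset.univ) fun η _ => h η
  refine h2.congr_deriv ?_
  simp only [pairSum, Finset.mul_sum, Finset.sum_mul]
  symm
  rw [Finset.sum_congr rfl fun x _ => Finset.sum_comm, Finset.sum_comm]
  refine Finset.sum_congr rfl fun η _ => ?_
  refine Finset.sum_congr rfl fun x _ => Finset.sum_congr rfl fun y _ => by ring

end FiniteSpins

section FiniteSpins

variable {V : Type*} [Fintype V] [DecidableEq V]

theorem sval_mul_agreeOn {P : Finset V} {x : V} (hx : x ∈ P) (ω η : V → Bool) :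
    sval (η x) * agreeOn P ω η = sval (ω x) * agreeOn P ω η := by
  unfold agreeOn
  split_ifs with h
  · rw [h x hx]
  · simp

/-- The energy difference between plus and mixed boundary conditions is bounded below by the number
of disjoint paths joining the minus part of the boundary to its plus part. -/
theorem energy_gap {K a : V → V → ℝ} (hK : ∀ x y, 0 ≤ K x y) (ha : ∀ x y, 0 ≤ a x y)
    (P : Finset V) (ω : V → Bool) {m : ℝ} (hm0 : 0 < m)
    (hm : ∀ x, m * pairSum K (agreeOn P allPlus) ≤
      pairSum K (fun η => sval (η x) * agreeOn P allPlus η))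
    {ι : Type*} [DecidableEq ι] (I : Finset ι) (k : ℕ) (v : ι → ℕ → V)
    (hinj : Set.InjOn (fun p : ι × ℕ => v p.1 p.2) (I ×ˢ Finset.range k : Finset (ι × ℕ)))
    {α : ℝ} (hα0 : 0 ≤ α) (hα : ∀ i ∈ I, ∀ j < k, α ≤ a (v i j) (v i (j + 1)))
    (h0 : ∀ i ∈ I, v i 0 ∈ P ∧ ω (v i 0) = false)
    (hk : ∀ i ∈ I, v i k ∈ P ∧ ω (v i k) = true) :
    2 * α * m ^ 2 * I.card ≤
      (∑ x, ∑ y, a x y * pairSum K (fun η => sval (η x) * sval (η y) * agreeOn P allPlus η)) /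
        pairSum K (agreeOn P allPlus) -
      (∑ x, ∑ y, a x y * pairSum K (fun η => sval (η x) * sval (η y) * agreeOn P ω η)) /
        pairSum K (agreeOn P ω) := by
  set Zp := pairSum K (agreeOn P allPlus) with hZp
  set Zm := pairSum K (agreeOn P ω) with hZm
  have hp : 0 < Zp := pairSum_agreeOn_pos _ _ _
  have hmn : 0 < Zm := pairSum_agreeOn_pos _ _ _
  set mp : V → ℝ := fun x => pairSum K (fun η => sval (η x) * agreeOn P allPlus η) / Zp with hmp
  set mm : V → ℝ := fun x => pairSum K (fun η => sval (η x) * agreeOn P ω η) / Zm with hmm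
  have hmp' : ∀ x, m ≤ mp x := fun x => by rw [hmp]; exact (le_div_iff₀ hp).2 (hm x)
  set D : V → V → ℝ := fun x y =>
    pairSum K (fun η => sval (η x) * sval (η y) * agreeOn P allPlus η) / Zp -
    pairSum K (fun η => sval (η x) * sval (η y) * agreeOn P ω η) / Zm with hD
  have hDge : ∀ x y, mp x * mm y - mm x * mp y ≤ D x y := fun x y => by
    have h := pairSum_pair_ge hK P ω x y
    simp only [hD, hmp, hmm]
    rw [div_mul_div_comm, div_mul_div_comm, mul_comm Zm Zp, ← sub_div,
      div_sub_div _ _ hp.ne' hmn.ne']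
    refine div_le_div_of_nonneg_right ?_ (mul_pos hp hmn).le
    simp only [← hZp, ← hZm] at h ⊢
    linarith
  have hDsymm : ∀ x y, D x y = D y x := fun x y => by
    simp only [hD]
    have : ∀ η : V → Bool, sval (η x) * sval (η y) = sval (η y) * sval (η x) :=
      fun η => mul_comm _ _
    simp only [this]
  set r : V → ℝ := fun x => mm x / mp x with hr
  have hmm' : ∀ x, mm x = r x * mp x := fun x => by
    simp only [hr]; rw [div_mul_cancel₀ _ (hm0.trans_le (hmp' x)).ne']
  have hD0 : ∀ x y, 0 ≤ D x y := fun x y => by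
    have h1 := hDge x y
    have h2 := hDge y x
    rw [hDsymm y x] at h2
    nlinarith
  have hDr : ∀ x y, m ^ 2 * (r y - r x) ≤ D x y := fun x y => by
    rcases le_total (r y - r x) 0 with h | h
    · exact (mul_nonpos_of_nonneg_of_nonpos (sq_nonneg m) h).trans (hD0 x y)
    · have h1 := hDge x y
      rw [hmm' x, hmm' y] at h1
      have h2 : m * m ≤ mp x * mp y :=
        mul_le_mul (hmp' x) (hmp' y) hm0.le (hm0.le.trans (hmp' x))
      nlinarith [mul_le_mul_of_nonneg_right h2 h]
  have hrP : ∀ x ∈ P, r x = sval (ω x) := fun x hx => by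
    have h1 : mp x = 1 := by
      have e : ∀ η, sval (η x) * agreeOn P allPlus η = agreeOn P allPlus η := fun η => by
        rw [sval_mul_agreeOn hx]; simp [allPlus, sval]
      simp only [hmp, e]
      exact div_self hp.ne'
    have h2 : mm x = sval (ω x) := by
      have e : ∀ η, sval (η x) * agreeOn P ω η = sval (ω x) * agreeOn P ω η :=
        fun η => sval_mul_agreeOn hx ω η
      simp only [hmm, e]
      have : pairSum K (fun η => sval (ω x) * agreeOn P ω η) = sval (ω x) * Zm := by
        simp only [hZm, pairSum, Finset.mul_sum]
        exact Finset.sum_congr rfl fun η _ => by ring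
      rw [this, mul_div_cancel_right₀ _ hmn.ne']
    simp only [hr, h1, h2, div_one]
  have hsum : (∑ x, ∑ y, a x y *
        pairSum K (fun η => sval (η x) * sval (η y) * agreeOn P allPlus η)) / Zp -
      (∑ x, ∑ y, a x y * pairSum K (fun η => sval (η x) * sval (η y) * agreeOn P ω η)) / Zm =
      ∑ q : V × V, a q.1 q.2 * D q.1 q.2 := by
    rw [Fintype.sum_prod_type]
    simp only [Finset.sum_div, ← Finset.sum_sub_distrib]
    refine Finset.sum_congr rfl fun x _ => Finset.sum_congr rfl fun y _ => ?_
    simp only [hD]; ring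
  rw [hsum]
  set φ : ι × ℕ → V × V := fun p => (v p.1 p.2, v p.1 (p.2 + 1)) with hφ
  have hφinj : Set.InjOn φ (I ×ˢ Finset.range k : Finset (ι × ℕ)) := fun p hp q hq h =>
    hinj hp hq (congrArg Prod.fst h)
  calc 2 * α * m ^ 2 * I.card
      = ∑ i ∈ I, ∑ j ∈ Finset.range k, α * (m ^ 2 * (r (v i (j + 1)) - r (v i j))) := by
        rw [mul_comm _ (I.card : ℝ), ← nsmul_eq_mul, ← Finset.sum_const]
        refine Finset.sum_congr rfl fun i hi => ?_
        rw [← Finset.mul_sum, ← Finset.mul_sum, Finset.sum_range_sub (fun j => r (v i j)),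
          hrP _ (h0 i hi).1, hrP _ (hk i hi).1, (h0 i hi).2, (hk i hi).2]
        norm_num [sval]; ring
    _ ≤ ∑ i ∈ I, ∑ j ∈ Finset.range k, a (v i j) (v i (j + 1)) * D (v i j) (v i (j + 1)) := by
        refine Finset.sum_le_sum fun i hi => Finset.sum_le_sum fun j hj => ?_
        exact (mul_le_mul_of_nonneg_left (hDr _ _) hα0).trans
          (mul_le_mul_of_nonneg_right (hα i hi j (Finset.mem_range.1 hj)) (hD0 _ _))
    _ = ∑ q ∈ (I ×ˢ Finset.range k).image φ, a q.1 q.2 * D q.1 q.2 := by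
        rw [Finset.sum_image hφinj, Finset.sum_product]
    _ ≤ ∑ q : V × V, a q.1 q.2 * D q.1 q.2 :=
        Finset.sum_le_sum_of_subset_of_nonneg (Finset.subset_univ _)
          fun q _ _ => mul_nonneg (ha _ _) (hD0 _ _)

/-- Positivity of the surface tension in the low temperature phase. -/
theorem surface_tension {a : V → V → ℝ} (ha : ∀ x y, 0 ≤ a x y) {O P : Finset V} (hOP : O ⊆ P)
    (ω : V → Bool) {β₁ β : ℝ} (hβ₁ : 0 ≤ β₁) (hβ : β₁ ≤ β) {m : ℝ} (hm0 : 0 < m)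
    (hm : ∀ x, m * pairSum (fun x y => β₁ * a x y) (agreeOn O allPlus) ≤
      pairSum (fun x y => β₁ * a x y) (fun η => sval (η x) * agreeOn O allPlus η))
    {ι : Type*} [DecidableEq ι] (I : Finset ι) (k : ℕ) (v : ι → ℕ → V)
    (hinj : Set.InjOn (fun p : ι × ℕ => v p.1 p.2) (I ×ˢ Finset.range k : Finset (ι × ℕ)))
    {α : ℝ} (hα0 : 0 ≤ α) (hα : ∀ i ∈ I, ∀ j < k, α ≤ a (v i j) (v i (j + 1)))
    (h0 : ∀ i ∈ I, v i 0 ∈ P ∧ ω (v i 0) = false)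
    (hk : ∀ i ∈ I, v i k ∈ P ∧ ω (v i k) = true) :
    Real.exp (2 * α * m ^ 2 * I.card * (β - β₁)) *
      pairSum (fun x y => β * a x y) (agreeOn P ω) ≤
        pairSum (fun x y => β * a x y) (agreeOn P allPlus) := by
  set Zp : ℝ → ℝ := fun t => pairSum (fun x y => t * a x y) (agreeOn P allPlus) with hZp
  set Zm : ℝ → ℝ := fun t => pairSum (fun x y => t * a x y) (agreeOn P ω) with hZm
  have hp : ∀ t, 0 < Zp t := fun t => pairSum_agreeOn_pos _ _ _
  have hmn : ∀ t, 0 < Zm t := fun t => pairSum_agreeOn_pos _ _ _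
  set κ := 2 * α * m ^ 2 * I.card with hκ
  set ψ : ℝ → ℝ := fun t => Real.log (Zp t) - Real.log (Zm t) - κ * t with hψ
  have hder := fun t => (((hasDerivAt_pairSum a (agreeOn P allPlus) t).log (hp t).ne').sub
    ((hasDerivAt_pairSum a (agreeOn P ω) t).log (hmn t).ne')).sub ((hasDerivAt_id t).const_mul κ)
  have hmono : MonotoneOn ψ (Set.Icc β₁ β) := by
    refine monotoneOn_of_deriv_nonneg (convex_Icc _ _)
      (fun t _ => (hder t).continuousAt.continuousWithinAt)
      (fun t _ => (hder t).differentiableAt.differentiableWithinAt) fun t ht => ?_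
    rw [interior_Icc] at ht
    have ht0 : 0 ≤ t := hβ₁.trans ht.1.le
    have hd : deriv ψ t = _ := (hder t).deriv
    rw [hd, sub_nonneg, mul_one]
    refine energy_gap (fun x y => mul_nonneg ht0 (ha x y)) ha P ω hm0 (fun x => ?_) I k v hinj
      hα0 hα h0 hk
    have hg := ginibre (K := fun x y => β₁ * a x y) (K' := fun x y => t * a x y)
      (fun x y => by
        rw [abs_of_nonneg (mul_nonneg hβ₁ (ha x y))]
        exact mul_le_mul_of_nonneg_right ht.1.le (ha x y)) hOP allPlus (SpinCone.spin x)
    have hz : 0 < pairSum (fun x y => β₁ * a x y) (agreeOn O allPlus) := pairSum_agreeOn_pos _ _ _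
    refine le_of_mul_le_mul_right ?_ hz
    calc m * Zp t * _ = (m * pairSum (fun x y => β₁ * a x y) (agreeOn O allPlus)) * Zp t := by ring
      _ ≤ _ := mul_le_mul_of_nonneg_right (hm x) (hp t).le
      _ ≤ _ := hg
  have h1 := hmono (Set.left_mem_Icc.2 hβ) (Set.right_mem_Icc.2 hβ) hβ
  have h2 : Real.log (Zm β₁) ≤ Real.log (Zp β₁) := Real.log_le_log (hmn _)
    (pairSum_agreeOn_le_plus (fun x y => mul_nonneg hβ₁ (ha x y)) P ω)
  have h3 : κ * (β - β₁) + Real.log (Zm β) ≤ Real.log (Zp β) := by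
    simp only [hψ] at h1; linarith
  calc Real.exp (κ * (β - β₁)) * Zm β = Real.exp (κ * (β - β₁) + Real.log (Zm β)) := by
        rw [Real.exp_add, Real.exp_log (hmn β)]
    _ ≤ Real.exp (Real.log (Zp β)) := Real.exp_le_exp.2 h3
    _ = Zp β := Real.exp_log (hp β)

end FiniteSpins

section StripFields

/-- A spin field on the rectangle `[-n,n] × [0,K)`, extended by zero, together with the spin flip
maps of its sample space. -/
structure StripField (Ω : Type*) (n K : ℕ) where
  /-- The spins. -/
  S : Ω → ℤ → ℕ → ℝ
  spin : ∀ ω i j, -(n : ℤ) ≤ i → i ≤ n → j < K → S ω i j = 1 ∨ S ω i j = -1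
  zero : ∀ ω i j, ¬(-(n : ℤ) ≤ i ∧ i ≤ n ∧ j < K) → S ω i j = 0
  /-- The maps flipping the spins in a given set. -/
  flip : (ℤ → ℕ → Bool) → Ω ≃ Ω
  S_flip : ∀ A ω i j, S (flip A ω) i j = (if A i j then -1 else 1) * S ω i j

namespace StripField

variable {Ω : Type*} [Fintype Ω] {n K : ℕ} (X : StripField Ω n K) (β : ℝ)

/-- The Ising energy with free boundary conditions. -/
noncomputable def energy (ω : Ω) : ℝ :=
  ∑ i ∈ Finset.Icc (-(n : ℤ) - 1) n, ∑ j ∈ Finset.range K,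
    (X.S ω i j * X.S ω (i + 1) j + X.S ω i j * X.S ω i (j + 1))

/-- The disorder operator on the bottom `k` horizontal edges from column `i` to column `i + 1`. -/
noncomputable def disorder (i : ℤ) (k : ℕ) (ω : Ω) : ℝ :=
  Real.exp (-2 * β * ∑ j ∈ Finset.range k, X.S ω i j * X.S ω (i + 1) j)

/-- Unnormalized expectation. -/
noncomputable def ev (F : Ω → ℝ) : ℝ := ∑ ω, Real.exp (β * X.energy ω) * F ω

theorem energy_flip_column (i : ℤ) (hi : -(n : ℤ) ≤ i) (hi' : i ≤ n) (k : ℕ) (hk : k < K)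
    (ω : Ω) :
    X.energy (X.flip (fun i' j => decide (i' = i ∧ j ≤ k)) ω) = X.energy ω
      - 2 * ∑ j ∈ Finset.range (k + 1), X.S ω i j * X.S ω (i + 1) j
      - 2 * ∑ j ∈ Finset.range (k + 1), X.S ω (i - 1) j * X.S ω (i - 1 + 1) j
      - 2 * (X.S ω i k * X.S ω i (k + 1)) := by
  have hsub : (Finset.range K).filter (fun j => j ≤ k) = Finset.range (k + 1) := by
    ext j; simp; omega
  have key : ∀ i' j, X.S (X.flip (fun i' j => decide (i' = i ∧ j ≤ k)) ω) i' j *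
        X.S (X.flip (fun i' j => decide (i' = i ∧ j ≤ k)) ω) (i' + 1) j +
      X.S (X.flip (fun i' j => decide (i' = i ∧ j ≤ k)) ω) i' j *
        X.S (X.flip (fun i' j => decide (i' = i ∧ j ≤ k)) ω) i' (j + 1) =
      (X.S ω i' j * X.S ω (i' + 1) j + X.S ω i' j * X.S ω i' (j + 1)) +
      (if i' = i then (if j ≤ k then -2 * (X.S ω i' j * X.S ω (i' + 1) j) else 0) else 0) +
      (if i' = i - 1 then (if j ≤ k then -2 * (X.S ω i' j * X.S ω (i' + 1) j) else 0) else 0) +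
      (if i' = i then (if j = k then -2 * (X.S ω i' j * X.S ω i' (j + 1)) else 0) else 0) := by
    intro i' j
    simp only [X.S_flip, decide_eq_true_eq]
    rcases eq_or_ne i' i with rfl | h1
    · have : ¬ (i' = i' - 1) := by omega
      rcases lt_trichotomy j k with h | h | h
      · simp [this, h.le, h.ne, Nat.succ_le_of_lt h]; ring
      · subst h; simp [this]; ring
      · have : ¬ j ≤ k := by omega
        have : ¬ j + 1 ≤ k := by omega
        simp [*, h.ne']
    · rcases eq_or_ne i' (i - 1) with rfl | h2
      · by_cases h : j ≤ k
        · simp [h]; ring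
        · simp [h]
      · have : i' + 1 ≠ i := by omega
        simp [*]
  unfold energy
  simp only [key, Finset.sum_add_distrib]
  have e1 : ∀ f : ℤ → ℕ → ℝ, ∀ i₀ ∈ Finset.Icc (-(n : ℤ) - 1) n,
      ∑ i' ∈ Finset.Icc (-(n : ℤ) - 1) n, ∑ j ∈ Finset.range K,
        (if i' = i₀ then f i' j else 0) = ∑ j ∈ Finset.range K, f i₀ j := fun f i₀ hi₀ => by
    rw [Finset.sum_eq_single i₀]
    · simp
    · intro b _ hb; simp [hb]
    · exact fun h => absurd hi₀ h
  rw [e1 (fun i' j => if j ≤ k then -2 * (X.S ω i' j * X.S ω (i' + 1) j) else 0) i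
      (by simp; omega),
    e1 (fun i' j => if j ≤ k then -2 * (X.S ω i' j * X.S ω (i' + 1) j) else 0) (i - 1)
      (by simp; omega),
    e1 (fun i' j => if j = k then -2 * (X.S ω i' j * X.S ω i' (j + 1)) else 0) i
      (by simp; omega)]
  simp only [← Finset.sum_filter, hsub, ← Finset.mul_sum, Finset.filter_eq', Finset.mem_range, hk,
    if_true, Finset.sum_singleton]
  ring

theorem energy_flip_left (i : ℤ) (hi : -(n : ℤ) ≤ i) (hi' : i ≤ n) (ω : Ω) :
    X.energy (X.flip (fun i' _ => decide (i' ≤ i)) ω) = X.energy ω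
      - 2 * ∑ j ∈ Finset.range K, X.S ω i j * X.S ω (i + 1) j := by
  have key : ∀ i' j, X.S (X.flip (fun i' _ => decide (i' ≤ i)) ω) i' j *
        X.S (X.flip (fun i' _ => decide (i' ≤ i)) ω) (i' + 1) j +
      X.S (X.flip (fun i' _ => decide (i' ≤ i)) ω) i' j *
        X.S (X.flip (fun i' _ => decide (i' ≤ i)) ω) i' (j + 1) =
      (X.S ω i' j * X.S ω (i' + 1) j + X.S ω i' j * X.S ω i' (j + 1)) +
      (if i' = i then -2 * (X.S ω i' j * X.S ω (i' + 1) j) else 0) := by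
    intro i' j
    simp only [X.S_flip, decide_eq_true_eq]
    rcases lt_trichotomy i' i with h | rfl | h
    · simp [h.le, h.ne, Int.add_one_le_of_lt h]
    · simp; ring
    · have : ¬ i' ≤ i := by omega
      have : ¬ i' + 1 ≤ i := by omega
      simp [*, h.ne']
  unfold energy
  simp only [key, Finset.sum_add_distrib]
  rw [Finset.sum_eq_single i (s := Finset.Icc (-(n : ℤ) - 1) n)
    (f := fun i' => ∑ j ∈ Finset.range K, if i' = i then _ else _)]
  · simp only [if_true, ← Finset.mul_sum]; ring
  · intro b _ hb; simp [hb]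
  · exact fun h => absurd (by simp; omega) h

theorem ev_flip (A : ℤ → ℕ → Bool) (F : Ω → ℝ) :
    X.ev β F = ∑ ω, Real.exp (β * X.energy (X.flip A ω)) * F (X.flip A ω) :=
  ((X.flip A).sum_comp fun ω => Real.exp (β * X.energy ω) * F ω).symm

/-- Full-height disorder operators have the same expectation as the identity. -/
theorem ev_disorder_top (i : ℤ) (hi : -(n : ℤ) ≤ i) (hi' : i ≤ n) :
    X.ev β (X.disorder β i K) = X.ev β fun _ => 1 := by
  rw [X.ev_flip β (fun i' _ => decide (i' ≤ i)) fun _ => 1]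
  refine Finset.sum_congr rfl fun ω _ => ?_
  rw [X.energy_flip_left i hi hi', disorder, mul_one, ← Real.exp_add]
  ring_nf

theorem abs_S_le (ω : Ω) (i : ℤ) (j : ℕ) : |X.S ω i j| ≤ 1 := by
  by_cases h : -(n : ℤ) ≤ i ∧ i ≤ n ∧ j < K
  · rcases X.spin ω i j h.1 h.2.1 h.2.2 with h | h <;> simp [h]
  · simp [X.zero ω i j h]

theorem abs_ev_disorder_top_le (i : ℤ) (hi : -(n : ℤ) ≤ i) (hi' : i ≤ n) (j j' : ℕ) (i' : ℤ) :
    |X.ev β fun ω => X.S ω i' j' * (X.disorder β i K ω * X.S ω i j)| ≤ X.ev β fun _ => 1 := by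
  rw [← X.ev_disorder_top β i hi hi']
  refine (Finset.abs_sum_le_sum_abs _ _).trans (Finset.sum_le_sum fun ω _ => ?_)
  have hd : 0 < X.disorder β i K ω := Real.exp_pos _
  rw [abs_mul, abs_mul, abs_mul, abs_of_pos hd, Real.abs_exp]
  refine mul_le_mul_of_nonneg_left ?_ (Real.exp_pos _).le
  have h1 := X.abs_S_le ω i' j'
  have h2 := X.abs_S_le ω i j
  calc _ ≤ 1 * (X.disorder β i K ω * 1) := by gcongr
    _ = _ := by ring

theorem exp_neg_mul_spin {s t : ℝ} (hs : s = 1 ∨ s = -1) (ht : t = 1 ∨ t = -1) (β : ℝ) :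
    Real.exp (-2 * β * (s * t)) * s = Real.cosh (2 * β) * s - Real.sinh (2 * β) * t := by
  have h1 := Real.cosh_add_sinh (2 * β)
  have h2 := Real.cosh_sub_sinh (2 * β)
  rcases hs with rfl | rfl <;> rcases ht with rfl | rfl
  · rw [show -2 * β * (1 * 1) = -(2 * β) by ring, ← h2]; ring
  · rw [show -2 * β * (1 * -1) = (2 * β) by ring, ← h1]; ring
  · rw [show -2 * β * (-1 * 1) = (2 * β) by ring, ← h1]; ring
  · rw [show -2 * β * (-1 * -1) = -(2 * β) by ring, ← h2]; ring

/-- The sign picked up by the spin at the origin when flipping column `i`. -/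
def originSign (i : ℤ) : ℝ := if i = 0 then -1 else 1

theorem exp_energy_flip_column (i : ℤ) (hi : -(n : ℤ) ≤ i) (hi' : i ≤ n) (k : ℕ) (hk : k < K)
    (ω : Ω) :
    Real.exp (β * X.energy (X.flip (fun i' j => decide (i' = i ∧ j ≤ k)) ω)) *
        X.disorder β (i - 1) (k + 1) (X.flip (fun i' j => decide (i' = i ∧ j ≤ k)) ω) =
      Real.exp (β * X.energy ω) * (X.disorder β i (k + 1) ω *
        Real.exp (-2 * β * (X.S ω i k * X.S ω i (k + 1)))) := by
  have : ∑ j ∈ Finset.range (k + 1),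
      X.S (X.flip (fun i' j => decide (i' = i ∧ j ≤ k)) ω) (i - 1) j *
        X.S (X.flip (fun i' j => decide (i' = i ∧ j ≤ k)) ω) (i - 1 + 1) j =
      -∑ j ∈ Finset.range (k + 1), X.S ω (i - 1) j * X.S ω (i - 1 + 1) j := by
    rw [← Finset.sum_neg_distrib]
    refine Finset.sum_congr rfl fun j hj => ?_
    have : j ≤ k := by simpa [Nat.lt_succ_iff] using hj
    simp [X.S_flip, this]
  rw [disorder, this, X.energy_flip_column i hi hi' k hk, disorder, ← Real.exp_add,
    ← Real.exp_add, ← Real.exp_add]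
  ring_nf

theorem ev_disorder_succ_below (i : ℤ) (hi : -(n : ℤ) ≤ i) (hi' : i ≤ n) (k : ℕ) (hk : k < K) :
    (X.ev β fun ω => X.S ω 0 0 * (X.disorder β (i - 1) (k + 1) ω * X.S ω i k)) =
      -originSign i * X.ev β fun ω => X.S ω 0 0 * (X.disorder β i (k + 1) ω *
        (Real.exp (-2 * β * (X.S ω i k * X.S ω i (k + 1))) * X.S ω i k)) := by
  rw [X.ev_flip β (fun i' j => decide (i' = i ∧ j ≤ k)), ev, Finset.mul_sum]
  refine Finset.sum_congr rfl fun ω _ => ?_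
  have h := X.exp_energy_flip_column β i hi hi' k hk ω
  have h1 : X.S (X.flip (fun i' j => decide (i' = i ∧ j ≤ k)) ω) 0 0 =
      originSign i * X.S ω 0 0 := by
    simp [X.S_flip, originSign, @eq_comm ℤ 0 i]
  have h2 : X.S (X.flip (fun i' j => decide (i' = i ∧ j ≤ k)) ω) i k = -X.S ω i k := by
    simp [X.S_flip]
  rw [h1, h2]
  linear_combination (-originSign i * X.S ω 0 0 * X.S ω i k) * h

theorem ev_disorder_succ_above (i : ℤ) (hi : -(n : ℤ) ≤ i) (hi' : i ≤ n) (k : ℕ)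
    (hk : k + 1 < K) :
    (X.ev β fun ω => X.S ω 0 0 * (X.disorder β (i - 1) (k + 1) ω * X.S ω i (k + 1))) =
      originSign i * X.ev β fun ω => X.S ω 0 0 * (X.disorder β i (k + 1) ω *
        (Real.exp (-2 * β * (X.S ω i (k + 1) * X.S ω i k)) * X.S ω i (k + 1))) := by
  rw [X.ev_flip β (fun i' j => decide (i' = i ∧ j ≤ k)), ev, Finset.mul_sum]
  refine Finset.sum_congr rfl fun ω _ => ?_
  have h := X.exp_energy_flip_column β i hi hi' k (by omega) ω
  have h1 : X.S (X.flip (fun i' j => decide (i' = i ∧ j ≤ k)) ω) 0 0 =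
      originSign i * X.S ω 0 0 := by
    simp [X.S_flip, originSign, @eq_comm ℤ 0 i]
  have h2 : X.S (X.flip (fun i' j => decide (i' = i ∧ j ≤ k)) ω) i (k + 1) =
      X.S ω i (k + 1) := by
    simp [X.S_flip]
  rw [h1, h2, mul_comm (X.S ω i (k + 1)) (X.S ω i k)]
  linear_combination (originSign i * X.S ω 0 0 * X.S ω i (k + 1)) * h

theorem lattice_column_sum {x y xr yr : ℕ → ℝ} {M : ℕ} {σ ch sh l θ : ℝ}
    (h1 : l * (ch - 1) = θ * sh) (h2 : l * sh = θ * (ch + 1)) (hx0 : xr 0 = x 0)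
    (hx : ∀ k < M, xr (k + 1) = σ * (ch * x (k + 1) - sh * y k))
    (hy : ∀ k < M, yr k = -σ * (ch * y k - sh * x (k + 1))) (hyM : yr M = -σ * y M) :
    ∑ k ∈ Finset.range (M + 1), l ^ k * (xr k - θ * yr k) =
      (1 - σ) * x 0 + σ * (∑ k ∈ Finset.range (M + 1), l ^ k * (x k - θ * y k) +
        2 * θ * l ^ M * y M) := by
  have key : ∀ m ≤ M, ∑ k ∈ Finset.range m, l ^ k * (xr k - θ * yr k) + l ^ m * xr m =
      (1 - σ) * x 0 + σ * (∑ k ∈ Finset.range m, l ^ k * (x k - θ * y k) + l ^ m * x m) := by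
    intro m
    induction m with
    | zero => intro _; simp [hx0]; ring
    | succ m ih =>
      intro hm
      have h := ih (by omega)
      rw [Finset.sum_range_succ, Finset.sum_range_succ, hy m (by omega), hx m (by omega)]
      rw [pow_succ]
      linear_combination h + (l ^ m * σ * x (m + 1)) * h1 - (l ^ m * σ * y m) * h2
  have h := key M le_rfl
  rw [Finset.sum_range_succ, Finset.sum_range_succ, hyM]
  linear_combination h

/-- The fermionic observable to the left of column edge `i`. -/
noncomputable def obsL (l θ : ℝ) (i : ℤ) : ℝ :=
  ∑ k ∈ Finset.range K, l ^ k *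
    ((X.ev β fun ω => X.S ω 0 0 * (X.disorder β i k ω * X.S ω i k)) -
      θ * X.ev β fun ω => X.S ω 0 0 * (X.disorder β i (k + 1) ω * X.S ω i k))

/-- The fermionic observable to the right of column edge `i - 1`. -/
noncomputable def obsR (l θ : ℝ) (i : ℤ) : ℝ :=
  ∑ k ∈ Finset.range K, l ^ k *
    ((X.ev β fun ω => X.S ω 0 0 * (X.disorder β (i - 1) k ω * X.S ω i k)) -
      θ * X.ev β fun ω => X.S ω 0 0 * (X.disorder β (i - 1) (k + 1) ω * X.S ω i k))

theorem ev_congr {F G : Ω → ℝ} (h : ∀ ω, F ω = G ω) : X.ev β F = X.ev β G := by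
  rw [funext h]

theorem ev_sub_mul (F G : Ω → ℝ) (a b : ℝ) :
    X.ev β (fun ω => a * F ω - b * G ω) = a * X.ev β F - b * X.ev β G := by
  simp only [ev, Finset.mul_sum, ← Finset.sum_sub_distrib]
  exact Finset.sum_congr rfl fun ω _ => by ring

theorem obsR_eq {M : ℕ} (hM : K = M + 1) {l θ : ℝ}
    (h1 : l * (Real.cosh (2 * β) - 1) = θ * Real.sinh (2 * β))
    (h2 : l * Real.sinh (2 * β) = θ * (Real.cosh (2 * β) + 1)) (i : ℤ)
    (hi : -(n : ℤ) ≤ i) (hi' : i ≤ n) :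
    X.obsR β l θ i = (1 - originSign i) * (X.ev β fun ω => X.S ω 0 0 * X.S ω i 0) +
      originSign i * (X.obsL β l θ i + 2 * θ * l ^ M *
        X.ev β fun ω => X.S ω 0 0 * (X.disorder β i K ω * X.S ω i M)) := by
  subst hM
  have h0 : ∀ i ω, X.disorder β i 0 ω = 1 := fun i ω => by simp [disorder]
  have hx0 : (X.ev β fun ω => X.S ω 0 0 * X.S ω i 0) =
      X.ev β fun ω => X.S ω 0 0 * (X.disorder β i 0 ω * X.S ω i 0) :=
    X.ev_congr β fun ω => by rw [h0, one_mul]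
  rw [hx0]
  refine lattice_column_sum (x := fun k =>
      X.ev β fun ω => X.S ω 0 0 * (X.disorder β i k ω * X.S ω i k))
    (y := fun k => X.ev β fun ω => X.S ω 0 0 * (X.disorder β i (k + 1) ω * X.S ω i k))
    h1 h2 ?_ (fun k hk => ?_) (fun k hk => ?_) ?_
  · exact X.ev_congr β fun ω => by rw [h0, h0]
  · rw [X.ev_disorder_succ_above β i hi hi' k (by omega), ← X.ev_sub_mul]
    congr 1
    refine X.ev_congr β fun ω => ?_
    rw [exp_neg_mul_spin (X.spin _ _ _ hi hi' (by omega)) (X.spin _ _ _ hi hi' (by omega))]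
    ring
  · rw [X.ev_disorder_succ_below β i hi hi' k (by omega), ← X.ev_sub_mul]
    congr 1
    refine X.ev_congr β fun ω => ?_
    rw [exp_neg_mul_spin (X.spin _ _ _ hi hi' (by omega)) (X.spin _ _ _ hi hi' (by omega))]
    ring
  · rw [X.ev_disorder_succ_below β i hi hi' M (by omega)]
    congr 1
    refine X.ev_congr β fun ω => ?_
    rw [X.zero ω i (M + 1) (by omega)]
    simp

theorem obsL_eq_obsR {l θ : ℝ} (hθ : θ = Real.exp (-2 * β)) (i : ℤ) (hi : -(n : ℤ) ≤ i)
    (hi' : i < n) : X.obsL β l θ i = X.obsR β l θ (i + 1) := by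
  refine Finset.sum_congr rfl fun k hk => ?_
  have hk : k < K := Finset.mem_range.1 hk
  congr 1
  have e : ∀ F G : Ω → ℝ, X.ev β F - θ * X.ev β G = X.ev β fun ω => 1 * F ω - θ * G ω :=
    fun F G => by rw [X.ev_sub_mul]; ring
  rw [e, e]
  refine X.ev_congr β fun ω => ?_
  have hd : X.disorder β i (k + 1) ω =
      X.disorder β i k ω * Real.exp (-2 * β * (X.S ω i k * X.S ω (i + 1) k)) := by
    rw [disorder, disorder, ← Real.exp_add, Finset.sum_range_succ, mul_add]
  rw [add_sub_cancel_right, hd]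
  have he : Real.exp (-2 * β) * Real.exp (2 * β) = 1 := by
    rw [← Real.exp_add, show -2 * β + 2 * β = 0 by ring, Real.exp_zero]
  rcases X.spin ω i k hi (by omega) hk with h1 | h1 <;>
    rcases X.spin ω (i + 1) k (by omega) (by omega) hk with h2 | h2 <;> rw [h1, h2]
  · rw [hθ, show -2 * β * (1 * -1) = 2 * β by ring]
    linear_combination (-2 * X.S ω 0 0 * X.disorder β i k ω) * he
  · rw [hθ, show -2 * β * (-1 * 1) = 2 * β by ring]
    linear_combination (2 * X.S ω 0 0 * X.disorder β i k ω) * he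

/-- Exact low temperature bound: the boundary two-point functions cannot all be small. -/
theorem two_point_lower_bound {M : ℕ} (hM : K = M + 1) {l θ : ℝ} (hl : 0 ≤ l)
    (hθ : θ = Real.exp (-2 * β))
    (h1 : l * (Real.cosh (2 * β) - 1) = θ * Real.sinh (2 * β))
    (h2 : l * Real.sinh (2 * β) = θ * (Real.cosh (2 * β) + 1)) :
    (2 - (2 * n + 1) * (2 * θ * l ^ M)) * (X.ev β fun _ => 1) ≤
      (1 - θ) * ∑ k ∈ Finset.range K, l ^ k *
        ((X.ev β fun ω => X.S ω 0 0 * X.S ω (-n) k) +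
          X.ev β fun ω => X.S ω 0 0 * X.S ω n k) := by
  set Z := X.ev β fun _ => 1 with hZ
  have hθ0 : 0 < θ := hθ ▸ Real.exp_pos _
  set e := 2 * θ * l ^ M * Z with he
  have hc : 0 ≤ 2 * θ * l ^ M := by positivity
  have herr : ∀ i : ℤ, -(n : ℤ) ≤ i → i ≤ n → |2 * θ * l ^ M *
      X.ev β fun ω => X.S ω 0 0 * (X.disorder β i K ω * X.S ω i M)| ≤ e := fun i hi hi' => by
    rw [abs_mul, abs_of_nonneg hc]
    exact mul_le_mul_of_nonneg_left (X.abs_ev_disorder_top_le β i hi hi' M 0 0) hc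
  have hstep : ∀ i : ℤ, -(n : ℤ) ≤ i → i ≤ n → i ≠ 0 →
      |X.obsR β l θ i - X.obsL β l θ i| ≤ e := fun i hi hi' h0 => by
    rw [X.obsR_eq β hM h1 h2 i hi hi', originSign, if_neg h0]
    convert herr i hi hi' using 2
    ring
  have hzero : 2 * Z - e ≤ X.obsR β l θ 0 + X.obsL β l θ 0 := by
    have h := X.obsR_eq β hM h1 h2 0 (by omega) (by omega)
    have hs : (X.ev β fun ω => X.S ω 0 0 * X.S ω 0 0) = Z := X.ev_congr β fun ω => by
      rcases X.spin ω 0 0 (by omega) (by omega) (by omega) with h | h <;> rw [h] <;> norm_num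
    rw [hs, originSign, if_pos rfl] at h
    have := (abs_le.1 (herr 0 (by omega) (by omega))).2
    linarith
  have hleft : ∀ t : ℕ, t ≤ n → X.obsR β l θ 0 ≤ X.obsR β l θ (-t) + t * e := by
    intro t
    induction t with
    | zero => intro _; simp
    | succ t ih =>
      intro ht
      have h3 := hstep (-((t : ℤ) + 1)) (by omega) (by omega) (by omega)
      have h4 := X.obsL_eq_obsR (l := l) β hθ (-((t : ℤ) + 1)) (by omega) (by omega)
      rw [show -((t : ℤ) + 1) + 1 = -t by ring] at h4
      have := (abs_le.1 h3).1
      have := ih (by omega)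
      push_cast
      linarith
  have hright : ∀ t : ℕ, t ≤ n → X.obsL β l θ 0 ≤ X.obsL β l θ t + t * e := by
    intro t
    induction t with
    | zero => intro _; simp
    | succ t ih =>
      intro ht
      have h3 := hstep ((t : ℤ) + 1) (by omega) (by omega) (by omega)
      have h4 := X.obsL_eq_obsR (l := l) β hθ t (by omega) (by omega)
      have := (abs_le.1 h3).2
      have := ih (by omega)
      push_cast
      linarith
  have hL := hleft n le_rfl
  have hR := hright n le_rfl
  have d1 : ∀ k ω, X.disorder β n k ω = 1 := fun k ω => by
    rw [disorder, Finset.sum_eq_zero, mul_zero, Real.exp_zero]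
    intro j _
    rw [X.zero ω (n + 1) j (by omega), mul_zero]
  have d2 : ∀ k ω, X.disorder β (-n - 1) k ω = 1 := fun k ω => by
    rw [disorder, Finset.sum_eq_zero, mul_zero, Real.exp_zero]
    intro j _
    rw [X.zero ω (-n - 1) j (by omega), zero_mul]
  have f1 : X.obsL β l θ n = (1 - θ) * ∑ k ∈ Finset.range K, l ^ k *
      X.ev β fun ω => X.S ω 0 0 * X.S ω n k := by
    rw [obsL, Finset.mul_sum]
    refine Finset.sum_congr rfl fun k _ => ?_
    simp only [d1, one_mul]; ring
  have f2 : X.obsR β l θ (-n) = (1 - θ) * ∑ k ∈ Finset.range K, l ^ k *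
      X.ev β fun ω => X.S ω 0 0 * X.S ω (-n) k := by
    rw [obsR, Finset.mul_sum]
    refine Finset.sum_congr rfl fun k _ => ?_
    simp only [d2, one_mul]; ring
  simp only [mul_add, Finset.sum_add_distrib] at *
  rw [← f1, ← f2]
  simp only [he] at *
  linarith

end StripField

end StripFields

section Magnetization

/-- Indicator of the oriented edges of `ℤ²`. -/
noncomputable def orient (x y : ℤ × ℤ) : ℝ :=
  if y = (x.1 + 1, x.2) ∨ y = (x.1, x.2 + 1) then 1 else 0

theorem orient_nonneg (x y : ℤ × ℤ) : 0 ≤ orient x y := by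
  unfold orient; split_ifs <;> norm_num

/-- The spin at `z`, extended by zero outside `U`. -/
noncomputable def spinAt (U : Finset (ℤ × ℤ)) (η : ↥U → Bool) (z : ℤ × ℤ) : ℝ :=
  if h : z ∈ U then sval (η ⟨z, h⟩) else 0

theorem spinAt_coe {U : Finset (ℤ × ℤ)} (η : ↥U → Bool) (x : ↥U) :
    spinAt U η x = sval (η x) := by simp [spinAt]

/-- The spins of `U` which are not in `Λ`. -/
def outside (U Λ : Finset (ℤ × ℤ)) : Finset ↥U := Finset.univ.filter fun x => (x : ℤ × ℤ) ∉ Λ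

theorem sum_orient_mul {U : Finset (ℤ × ℤ)} {S : ℤ × ℤ → ℝ} (hS : ∀ z ∉ U, S z = 0) (x : ℤ × ℤ) :
    ∑ y ∈ U, orient x y * S y = S (x.1 + 1, x.2) + S (x.1, x.2 + 1) := by
  have h : ∀ y, orient x y * S y = (if y = (x.1 + 1, x.2) then S y else 0) +
      (if y = (x.1, x.2 + 1) then S y else 0) := fun y => by
    unfold orient
    rcases eq_or_ne y (x.1 + 1, x.2) with rfl | h1
    · have : ¬ ((x.1 + 1, x.2) = (x.1, x.2 + 1)) := by simp
      simp
    · simp [h1]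
  simp only [h, Finset.sum_add_distrib, Finset.sum_ite_eq']
  congr 1 <;> split_ifs with h2
  · rfl
  · exact (hS _ h2).symm
  · rfl
  · exact (hS _ h2).symm

theorem sum_sum_orient {U R : Finset (ℤ × ℤ)} (hR : R ⊆ U) {S : ℤ × ℤ → ℝ}
    (hS : ∀ z ∉ R, S z = 0) :
    ∑ x : ↥U, ∑ y : ↥U, orient x y * (S x * S y) =
      ∑ x ∈ R, (S x * S (x.1 + 1, x.2) + S x * S (x.1, x.2 + 1)) := by
  have h1 : ∀ x : ↥U, ∑ y : ↥U, orient x y * (S x * S y) =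
      S x * S ((x : ℤ × ℤ).1 + 1, (x : ℤ × ℤ).2) + S x * S ((x : ℤ × ℤ).1, (x : ℤ × ℤ).2 + 1) :=
    fun x => by
    rw [← mul_add, ← sum_orient_mul (fun z hz => hS z fun h => hz (hR h)), Finset.mul_sum,
      ← Finset.sum_coe_sort U]
    exact Finset.sum_congr rfl fun y _ => by ring
  simp only [h1]
  rw [Finset.sum_coe_sort U fun x : ℤ × ℤ =>
    S x * S (x.1 + 1, x.2) + S x * S (x.1, x.2 + 1)]
  refine (Finset.sum_subset hR fun x _ hx => ?_).symm
  simp [hS x hx]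

/-- The rectangle `[a-n,a+n] × [b,b+K)`. -/
noncomputable def rect (a b : ℤ) (n K : ℕ) : Finset (ℤ × ℤ) :=
  (Finset.Icc (a - n) (a + n)) ×ˢ (Finset.Ico b (b + K))

theorem twist_twist_cancel {V : Type*} (c η : V → Bool) : twist c (twist c η) = η := by
  funext x; simp [twist]

/-- The spins of a rectangle inside `U` as a strip field. -/
noncomputable def rectField (U : Finset (ℤ × ℤ)) (a b : ℤ) (n K : ℕ) (hU : rect a b n K ⊆ U) :
    StripField (↥U → Bool) n K where
  S η i j := if -(n : ℤ) ≤ i ∧ i ≤ n ∧ j < K then spinAt U η (a + i, b + j) else 0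
  spin η i j h1 h2 h3 := by
    have hz : (a + i, b + (j : ℤ)) ∈ U := hU (by simp [rect]; omega)
    rw [if_pos ⟨h1, h2, h3⟩, spinAt, dif_pos hz]
    exact sval_eq_or _
  zero η i j h := if_neg h
  flip A := ⟨twist fun z => A ((z : ℤ × ℤ).1 - a) ((z : ℤ × ℤ).2 - b).toNat,
    twist fun z => A ((z : ℤ × ℤ).1 - a) ((z : ℤ × ℤ).2 - b).toNat,
    twist_twist_cancel _, twist_twist_cancel _⟩
  S_flip A η i j := by
    split_ifs with h1 h2 h2
    · have hz : (a + i, b + (j : ℤ)) ∈ U := hU (by simp [rect]; omega)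
      simp [spinAt, hz, twist, h2, sval_not]
    · have hz : (a + i, b + (j : ℤ)) ∈ U := hU (by simp [rect]; omega)
      simp [spinAt, hz, twist, h2]
    · simp
    · simp

theorem rectField_energy (U : Finset (ℤ × ℤ)) (a b : ℤ) (n K : ℕ) (hU : rect a b n K ⊆ U)
    (η : ↥U → Bool) :
    (rectField U a b n K hU).energy η = ∑ x : ↥U, ∑ y : ↥U,
      (if (x : ℤ × ℤ) ∈ rect a b n K ∧ (y : ℤ × ℤ) ∈ rect a b n K then orient x y else 0) *
        (sval (η x) * sval (η y)) := by
  set T : ℤ × ℤ → ℝ := fun z => if z ∈ rect a b n K then spinAt U η z else 0 with hT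
  have hT0 : ∀ z ∉ rect a b n K, T z = 0 := fun z hz => by simp [hT, hz]
  have e1 : ∀ x y : ↥U,
      (if (x : ℤ × ℤ) ∈ rect a b n K ∧ (y : ℤ × ℤ) ∈ rect a b n K then orient x y else 0) *
        (sval (η x) * sval (η y)) = orient x y * (T x * T y) := fun x y => by
    simp only [hT, spinAt_coe]
    by_cases h1 : (x : ℤ × ℤ) ∈ rect a b n K <;> by_cases h2 : (y : ℤ × ℤ) ∈ rect a b n K <;>
      simp [h1, h2]
  simp only [e1]
  rw [sum_sum_orient hU hT0]
  have hS : ∀ (i : ℤ) (j : ℕ), (rectField U a b n K hU).S η i j = T (a + i, b + j) := fun i j => by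
    simp only [rectField, hT]
    refine if_congr ?_ rfl rfl
    simp [rect]
    omega
  unfold StripField.energy
  simp only [hS]
  rw [← Finset.sum_product']
  symm
  refine Finset.sum_of_injOn (fun x => (x.1 - a, (x.2 - b).toNat)) ?_ ?_ ?_ ?_
  · rintro ⟨x1, x2⟩ hx ⟨y1, y2⟩ hy h
    simp [rect] at hx hy h ⊢
    omega
  · rintro ⟨x1, x2⟩ hx
    simp [rect] at hx ⊢
    omega
  · rintro ⟨i, j⟩ hij h
    have : T (a + i, b + j) = 0 := hT0 _ fun h' => h ⟨_, h', by simp⟩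
    simp [this]
  · rintro ⟨x1, x2⟩ hx
    simp [rect] at hx
    have h1 : ((x2 - b).toNat : ℤ) = x2 - b := Int.toNat_of_nonneg (by omega)
    push_cast [h1]
    rw [show a + (x1 - a) = x1 by ring, show b + (x2 - b) = x2 by ring,
      show a + (x1 - a + 1) = x1 + 1 by ring, show b + (x2 - b + 1) = x2 + 1 by ring]

theorem rectField_ev (U : Finset (ℤ × ℤ)) (a b : ℤ) (n K : ℕ) (hU : rect a b n K ⊆ U) (β : ℝ)
    (F : (↥U → Bool) → ℝ) :
    (rectField U a b n K hU).ev β F = pairSum (fun x y : ↥U => if (x : ℤ × ℤ) ∈ rect a b n K ∧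
      (y : ℤ × ℤ) ∈ rect a b n K then β * orient x y else 0) F := by
  refine Finset.sum_congr rfl fun η _ => ?_
  rw [rectField_energy, pairWt]
  congr 2
  simp only [Finset.mul_sum]
  refine Finset.sum_congr rfl fun x _ => Finset.sum_congr rfl fun y _ => ?_
  split_ifs <;> ring

theorem low_temperature_parameters {β : ℝ} (hβ : betaCrit < β) :
    ∃ l θ : ℝ, 0 ≤ l ∧ l < 1 ∧ 0 < θ ∧ θ < 1 ∧ θ = Real.exp (-2 * β) ∧
      l * (Real.cosh (2 * β) - 1) = θ * Real.sinh (2 * β) ∧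
      l * Real.sinh (2 * β) = θ * (Real.cosh (2 * β) + 1) := by
  have h2 : (0 : ℝ) < Real.sqrt 2 := Real.sqrt_pos.2 (by norm_num)
  have hsq : Real.sqrt 2 * Real.sqrt 2 = 2 := Real.mul_self_sqrt (by norm_num)
  set y := Real.exp (2 * β) with hy
  have hy1 : 1 + Real.sqrt 2 < y := by
    rw [hy, ← Real.log_lt_iff_lt_exp (by positivity)]
    unfold betaCrit at hβ
    linarith
  have hy0 : 0 < y := Real.exp_pos _
  have hθ : Real.exp (-2 * β) = y⁻¹ := by rw [hy, ← Real.exp_neg]; ring_nf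
  have hc : Real.cosh (2 * β) = (y + y⁻¹) / 2 := by rw [Real.cosh_eq, Real.exp_neg]
  have hs : Real.sinh (2 * β) = (y - y⁻¹) / 2 := by rw [Real.sinh_eq, Real.exp_neg]
  have hy2 : 0 < y - 1 := by linarith
  refine ⟨(y + 1) / (y * (y - 1)), y⁻¹, by positivity, ?_, inv_pos.2 hy0,
    inv_lt_one_of_one_lt₀ (by linarith), hθ.symm, ?_, ?_⟩
  · rw [div_lt_one (by positivity)]
    nlinarith
  · rw [hc, hs]; field_simp; ring
  · rw [hc, hs]; field_simp; ring

theorem pairSum_spin_spin_outside {U Λ : Finset (ℤ × ℤ)} (K : ↥U → ↥U → ℝ) (x y : ↥U)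
    (hy : (y : ℤ × ℤ) ∉ Λ) :
    pairSum K (fun η => sval (η x) * sval (η y) * agreeOn (outside U Λ) allPlus η) =
      pairSum K (fun η => sval (η x) * agreeOn (outside U Λ) allPlus η) := by
  refine Finset.sum_congr rfl fun η _ => ?_
  have := sval_mul_agreeOn (P := outside U Λ) (x := y) (by simp [outside, hy]) allPlus η
  simp only [mul_assoc, this]
  simp [allPlus, sval]

/-- Uniform positivity of the magnetization of plus boxes below the critical temperature. -/
theorem exists_magnetization_bound {β : ℝ} (hβ : betaCrit < β) :
    ∃ m₀ : ℝ, 0 < m₀ ∧ ∀ (L : ℕ) (x : ℤ × ℤ), x ∈ box L →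
      ∃ (U : Finset (ℤ × ℤ)) (hx : x ∈ U), box (L + 1) ⊆ U ∧
        m₀ * pairSum (fun x y : ↥U => β * orient x y) (agreeOn (outside U (box L)) allPlus) ≤
          pairSum (fun x y : ↥U => β * orient x y)
            (fun η => sval (η ⟨x, hx⟩) * agreeOn (outside U (box L)) allPlus η) := by
  obtain ⟨l, θ, hl0, hl1, hθ0, hθ1, hθ, h1, h2⟩ := low_temperature_parameters hβ
  have hβ0 : 0 ≤ β := by
    have : 0 ≤ betaCrit := div_nonneg (Real.log_nonneg (by linarith [Real.sqrt_nonneg 2]))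
      (by norm_num)
    linarith
  refine ⟨(1 - l) / (2 * (1 - θ)), div_pos (by linarith) (by linarith), fun L x hx => ?_⟩
  obtain ⟨a, b⟩ := x
  set n := 2 * L + 1 with hn
  obtain ⟨M, hM⟩ : ∃ M : ℕ, (2 * (n : ℝ) + 1) * (2 * θ * l ^ M) ≤ 1 := by
    have ht : Tendsto (fun M : ℕ => (2 * (n : ℝ) + 1) * (2 * θ * l ^ M)) atTop
        (𝓝 ((2 * (n : ℝ) + 1) * (2 * θ * 0))) :=
      ((tendsto_pow_atTop_nhds_zero_of_lt_one hl0 hl1).const_mul _).const_mul _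
    rw [mul_zero, mul_zero] at ht
    exact ((ht.eventually_le_const one_pos).exists)
  set R := rect a b n (M + 1) with hR
  set U := box (L + 1) ∪ R with hU
  have hRU : R ⊆ U := Finset.subset_union_right
  have hxR : (a, b) ∈ R := by simp [hR, rect]
  refine ⟨U, hRU hxR, Finset.subset_union_left, ?_⟩
  set K : ↥U → ↥U → ℝ := fun x y => if (x : ℤ × ℤ) ∈ R ∧ (y : ℤ × ℤ) ∈ R then
    β * orient x y else 0 with hK
  set K' : ↥U → ↥U → ℝ := fun x y => β * orient x y with hK'
  set X := rectField U a b n (M + 1) hRU with hX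
  have hev : ∀ F, X.ev β F = pairSum K F := fun F => rectField_ev _ _ _ _ _ _ _ _
  have hmain := X.two_point_lower_bound β rfl hl0 hθ h1 h2
  set Z := pairSum K fun _ => 1 with hZ
  set Z' := pairSum K' (agreeOn (outside U (box L)) allPlus) with hZ'
  set m := pairSum K' (fun η => sval (η ⟨(a, b), hRU hxR⟩) *
    agreeOn (outside U (box L)) allPlus η) with hm
  have hZ0 : 0 < Z := pairSum_pos (fun _ => zero_le_one) (η₀ := allPlus) one_pos
  have hZ0' : 0 < Z' := pairSum_agreeOn_pos _ _ _
  have hS : ∀ (η : ↥U → Bool) (i : ℤ) (j : ℕ) (h : (a + i, b + (j : ℤ)) ∈ R),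
      X.S η i j = sval (η ⟨_, hRU h⟩) := fun η i j h => by
    have h' : -(n : ℤ) ≤ i ∧ i ≤ n ∧ j < M + 1 := by simp [hR, rect] at h; omega
    simp only [hX, rectField, if_pos h', spinAt, dif_pos (hRU h)]
  have hgin : ∀ (i : ℤ) (k : ℕ), k < M + 1 → i = n ∨ i = -n →
      (X.ev β fun ω => X.S ω 0 0 * X.S ω i k) ≤ m / Z' * Z := fun i k hk hi => by
    have hy : (a + i, b + (k : ℤ)) ∈ R := by simp [hR, rect]; omega
    have hy' : (a + i, b + (k : ℤ)) ∉ box L := by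
      simp only [box, Finset.mem_product, Finset.mem_Icc] at hx ⊢
      omega
    have h0 : (a + (0 : ℤ), b + ((0 : ℕ) : ℤ)) ∈ R := by simp [hR, rect]
    have h3 := ginibre (K := K) (K' := K') (fun x y => by
      simp only [hK, hK']
      have := mul_nonneg hβ0 (orient_nonneg x y)
      split_ifs
      · rw [abs_of_nonneg this]
      · simpa using this) (Finset.empty_subset (outside U (box L))) allPlus
      ((SpinCone.spin (⟨(a, b), hRU hxR⟩ : ↥U)).mul (SpinCone.spin (⟨_, hRU hy⟩ : ↥U)))
    rw [pairSum_spin_spin_outside K' _ _ hy'] at h3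
    have h4 : ∀ η : ↥U → Bool, agreeOn ∅ allPlus η = 1 := fun η => by simp [agreeOn]
    have h5 : pairSum K (agreeOn ∅ allPlus) = Z := congrArg (pairSum K) (funext h4)
    rw [h5] at h3
    rw [hev, div_mul_eq_mul_div, le_div_iff₀ hZ0']
    have h6 : (fun η => X.S η 0 0 * X.S η i k) = fun η =>
        sval (η ⟨(a, b), hRU hxR⟩) * sval (η ⟨_, hRU hy⟩) * agreeOn ∅ allPlus η := by
      funext η
      have h7 : (⟨(a, b), hRU hxR⟩ : ↥U) = ⟨_, hRU h0⟩ := Subtype.ext (by simp)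
      rw [h4, mul_one, hS _ _ _ h0, hS _ _ _ hy, h7]
    rw [h6]
    exact h3
  rw [hev] at hmain
  have hle : ∑ k ∈ Finset.range (M + 1), l ^ k *
        ((X.ev β fun ω => X.S ω 0 0 * X.S ω (-n) k) + X.ev β fun ω => X.S ω 0 0 * X.S ω n k) ≤
      (∑ k ∈ Finset.range (M + 1), l ^ k) * (2 * (m / Z' * Z)) := by
    rw [Finset.sum_mul]
    refine Finset.sum_le_sum fun k hk => mul_le_mul_of_nonneg_left ?_ (pow_nonneg hl0 k)
    have hk := Finset.mem_range.1 hk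
    linarith [hgin n k hk (Or.inl rfl), hgin (-n) k hk (Or.inr rfl)]
  have hG : (∑ k ∈ Finset.range (M + 1), l ^ k) ≤ (1 - l)⁻¹ := by
    rw [← tsum_geometric_of_lt_one hl0 hl1]
    exact (summable_geometric_of_lt_one hl0 hl1).sum_le_tsum _ fun k _ => pow_nonneg hl0 k
  have hG0 : 0 ≤ ∑ k ∈ Finset.range (M + 1), l ^ k :=
    Finset.sum_nonneg fun k _ => pow_nonneg hl0 k
  have h6 : Z ≤ (1 - θ) * ((∑ k ∈ Finset.range (M + 1), l ^ k) * (2 * (m / Z' * Z))) := by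
    refine le_trans ?_ (hmain.trans (mul_le_mul_of_nonneg_left hle (by linarith)))
    have : 1 * Z ≤ (2 - (2 * (n : ℝ) + 1) * (2 * θ * l ^ M)) * Z :=
      mul_le_mul_of_nonneg_right (by linarith) hZ0.le
    linarith
  have h7 : 1 ≤ (1 - θ) * ((∑ k ∈ Finset.range (M + 1), l ^ k) * (2 * (m / Z'))) := by
    refine le_of_mul_le_mul_right ?_ hZ0
    linarith
  have hm0 : 0 ≤ m / Z' := by
    by_contra hneg
    push Not at hneg
    have : (1 - θ) * ((∑ k ∈ Finset.range (M + 1), l ^ k) * (2 * (m / Z'))) ≤ 0 :=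
      mul_nonpos_of_nonneg_of_nonpos (by linarith)
        (mul_nonpos_of_nonneg_of_nonpos hG0 (by linarith))
    linarith
  have h8 : 1 ≤ (1 - θ) * ((1 - l)⁻¹ * (2 * (m / Z'))) :=
    h7.trans (mul_le_mul_of_nonneg_left (mul_le_mul_of_nonneg_right hG (by linarith))
      (by linarith))
  have hl' : 0 < 1 - l := by linarith
  have hθ' : 0 < 1 - θ := by linarith
  rw [← le_div_iff₀ hZ0', div_le_iff₀ (by positivity)]
  calc 1 - l = (1 - l) * 1 := by ring
    _ ≤ (1 - l) * ((1 - θ) * ((1 - l)⁻¹ * (2 * (m / Z')))) :=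
        mul_le_mul_of_nonneg_left h8 hl'.le
    _ = m / Z' * (2 * (1 - θ)) := by field_simp

end Magnetization

section DropletRepresentation

/-- Indicator of nearest-neighbour pairs. -/
noncomputable def adjInd (x y : ℤ × ℤ) : ℝ := if y ∈ nbrs x then 1 else 0

/-- Number of ordered nearest-neighbour pairs between `A` and `B`. -/
noncomputable def edgeCount (A B : Finset (ℤ × ℤ)) : ℝ := ∑ x ∈ A, ∑ y ∈ B, adjInd x y

/-- The size of the edge boundary of `D`. -/
noncomputable def bdry (D : Finset (ℤ × ℤ)) : ℝ := 4 * D.card - edgeCount D D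

/-- The weight of the configuration whose set of minus spins is `D`. -/
noncomputable def dropWt (β : ℝ) (D : Finset (ℤ × ℤ)) : ℝ := Real.exp (-2 * β * bdry D)

/-- The configuration whose set of minus spins is `D`. -/
def cfg (D : Finset (ℤ × ℤ)) : Cfg2 := fun x => decide (x ∉ D)

theorem cfg_eq_true {D : Finset (ℤ × ℤ)} {x : ℤ × ℤ} : cfg D x = true ↔ x ∉ D := by simp [cfg]

theorem cfg_eq_false {D : Finset (ℤ × ℤ)} {x : ℤ × ℤ} : cfg D x = false ↔ x ∈ D := by simp [cfg]

theorem mem_nbrs {x y : ℤ × ℤ} : y ∈ nbrs x ↔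
    (y.1 = x.1 + 1 ∧ y.2 = x.2) ∨ (y.1 = x.1 - 1 ∧ y.2 = x.2) ∨ (y.1 = x.1 ∧ y.2 = x.2 + 1) ∨
      (y.1 = x.1 ∧ y.2 = x.2 - 1) := by
  simp [nbrs, Prod.ext_iff]

theorem mem_nbrs_comm {x y : ℤ × ℤ} : y ∈ nbrs x ↔ x ∈ nbrs y := by
  simp only [mem_nbrs]; omega

theorem card_nbrs (x : ℤ × ℤ) : (nbrs x).card = 4 := by
  rw [nbrs, Finset.card_insert_of_notMem, Finset.card_insert_of_notMem,
    Finset.card_insert_of_notMem, Finset.card_singleton]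
  all_goals simp [Prod.ext_iff]
  all_goals omega

theorem adjInd_comm (x y : ℤ × ℤ) : adjInd x y = adjInd y x := by
  simp only [adjInd, mem_nbrs_comm (x := x)]

theorem adjInd_nonneg (x y : ℤ × ℤ) : 0 ≤ adjInd x y := by unfold adjInd; split_ifs <;> norm_num

theorem adjInd_eq_orient (x y : ℤ × ℤ) : adjInd x y = orient x y + orient y x := by
  simp only [adjInd, orient, mem_nbrs, Prod.ext_iff]
  by_cases h1 : y.1 = x.1 + 1 ∧ y.2 = x.2 ∨ y.1 = x.1 ∧ y.2 = x.2 + 1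
  · rw [if_pos (by omega), if_pos h1, if_neg (by omega), add_zero]
  · by_cases h2 : x.1 = y.1 + 1 ∧ x.2 = y.2 ∨ x.1 = y.1 ∧ x.2 = y.2 + 1
    · rw [if_pos (by omega), if_neg h1, if_pos h2, zero_add]
    · rw [if_neg (by omega), if_neg h1, if_neg h2, zero_add]

theorem sum_adjInd {U : Finset (ℤ × ℤ)} {x : ℤ × ℤ} (h : nbrs x ⊆ U) :
    ∑ y ∈ U, adjInd x y = 4 := by
  simp only [adjInd, Finset.sum_ite_mem, Finset.inter_eq_right.2 h]
  simp [card_nbrs]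

theorem dropWt_pos (β : ℝ) (D : Finset (ℤ × ℤ)) : 0 < dropWt β D := Real.exp_pos _

theorem edgeCount_comm (A B : Finset (ℤ × ℤ)) : edgeCount A B = edgeCount B A := by
  rw [edgeCount, Finset.sum_comm, edgeCount]
  simp only [adjInd_comm]

theorem edgeCount_union_left {A B : Finset (ℤ × ℤ)} (h : Disjoint A B) (C : Finset (ℤ × ℤ)) :
    edgeCount (A ∪ B) C = edgeCount A C + edgeCount B C := Finset.sum_union h

theorem edgeCount_union_right {A B : Finset (ℤ × ℤ)} (h : Disjoint A B) (C : Finset (ℤ × ℤ)) :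
    edgeCount C (A ∪ B) = edgeCount C A + edgeCount C B := by
  rw [edgeCount_comm, edgeCount_union_left h, edgeCount_comm A, edgeCount_comm B]

theorem edgeCount_singleton_le (x : ℤ × ℤ) (B : Finset (ℤ × ℤ)) : edgeCount {x} B ≤ 4 := by
  rw [edgeCount, Finset.sum_singleton, ← sum_adjInd (Finset.subset_union_left (s₂ := B))]
  exact Finset.sum_le_sum_of_subset_of_nonneg Finset.subset_union_right
    fun _ _ _ => adjInd_nonneg _ _

theorem edgeCount_self_singleton (x : ℤ × ℤ) : edgeCount {x} {x} = 0 := by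
  simp only [edgeCount, adjInd, mem_nbrs, Finset.sum_singleton]
  exact if_neg (by omega)

/-- Submodularity of the edge boundary. -/
theorem bdry_submodular (A B : Finset (ℤ × ℤ)) :
    bdry (A ∩ B) + bdry (A ∪ B) ≤ bdry A + bdry B := by
  have hdecomp : ∀ C ⊆ A ∪ B, edgeCount C C = ∑ x ∈ A ∪ B, ∑ y ∈ A ∪ B,
      (if x ∈ C then 1 else 0) * (if y ∈ C then 1 else 0) * adjInd x y := fun C hC => by
    have h : ∀ x, ∑ y ∈ A ∪ B, (if x ∈ C then 1 else 0) * (if y ∈ C then 1 else 0) * adjInd x y =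
        if x ∈ C then ∑ y ∈ C, adjInd x y else 0 := fun x => by
      split_ifs with hx
      · simp only [one_mul, ite_mul, zero_mul, Finset.sum_ite_mem, Finset.inter_eq_right.2 hC]
      · simp
    simp only [h, Finset.sum_ite_mem, Finset.inter_eq_right.2 hC, edgeCount]
  have hcard : ((A ∩ B).card : ℝ) + (A ∪ B).card = A.card + B.card := by
    exact_mod_cast Finset.card_inter_add_card_union A B
  have h : edgeCount A A + edgeCount B B ≤
      edgeCount (A ∩ B) (A ∩ B) + edgeCount (A ∪ B) (A ∪ B) := by
    rw [hdecomp A Finset.subset_union_left, hdecomp B Finset.subset_union_right,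
      hdecomp (A ∩ B) (Finset.inter_subset_left.trans Finset.subset_union_left),
      hdecomp (A ∪ B) subset_rfl]
    simp only [← Finset.sum_add_distrib, ← add_mul]
    refine Finset.sum_le_sum fun x _ => Finset.sum_le_sum fun y _ =>
      mul_le_mul_of_nonneg_right ?_ (adjInd_nonneg _ _)
    by_cases h1 : x ∈ A <;> by_cases h2 : x ∈ B <;> by_cases h3 : y ∈ A <;>
      by_cases h4 : y ∈ B <;> simp [h1, h2, h3, h4]
  unfold bdry
  linarith

theorem dropWt_supermodular {β : ℝ} (hβ : 0 ≤ β) (A B : Finset (ℤ × ℤ)) :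
    dropWt β A * dropWt β B ≤ dropWt β (A ∩ B) * dropWt β (A ∪ B) := by
  simp only [dropWt, ← Real.exp_add]
  exact Real.exp_le_exp.2 (by nlinarith [mul_le_mul_of_nonneg_left (bdry_submodular A B) hβ])

open Classical in
/-- Unnormalized probability of `E` in the volume `Λ` with plus boundary condition. -/
noncomputable def dropSum (β : ℝ) (Λ : Finset (ℤ × ℤ)) (E : Set Cfg2) : ℝ :=
  ∑ D ∈ Λ.powerset with cfg D ∈ E, dropWt β D

/-- The finite volume plus measure in `Λ`. -/
noncomputable def plusProb (β : ℝ) (Λ : Finset (ℤ × ℤ)) (E : Set Cfg2) : ℝ :=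
  dropSum β Λ E / dropSum β Λ Set.univ

theorem dropSum_nonneg (β : ℝ) (Λ : Finset (ℤ × ℤ)) (E : Set Cfg2) : 0 ≤ dropSum β Λ E :=
  Finset.sum_nonneg fun _ _ => (dropWt_pos _ _).le

theorem dropSum_mono (β : ℝ) (Λ : Finset (ℤ × ℤ)) {E F : Set Cfg2}
    (h : ∀ D ⊆ Λ, cfg D ∈ E → cfg D ∈ F) : dropSum β Λ E ≤ dropSum β Λ F := by
  classical
  refine Finset.sum_le_sum_of_subset_of_nonneg (fun D hD => ?_) fun _ _ _ => (dropWt_pos _ _).le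
  rw [Finset.mem_filter, Finset.mem_powerset] at hD ⊢
  exact ⟨hD.1, h D hD.1 hD.2⟩

theorem dropSum_univ (β : ℝ) (Λ : Finset (ℤ × ℤ)) :
    dropSum β Λ Set.univ = ∑ D ∈ Λ.powerset, dropWt β D := by
  simp [dropSum]

theorem dropSum_univ_pos (β : ℝ) (Λ : Finset (ℤ × ℤ)) : 0 < dropSum β Λ Set.univ := by
  rw [dropSum_univ]
  exact Finset.sum_pos (fun _ _ => dropWt_pos _ _) ⟨∅, by simp⟩

theorem dropSum_pos {β : ℝ} {Λ D : Finset (ℤ × ℤ)} {E : Set Cfg2} (hD : D ⊆ Λ) (h : cfg D ∈ E) :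
    0 < dropSum β Λ E := by
  classical
  exact Finset.sum_pos (fun _ _ => dropWt_pos _ _) ⟨D, by simp [hD, h]⟩

/-- The FKG lattice inequality in a form suitable for increasing or decreasing events. -/
theorem dropSum_fkg {β : ℝ} (hβ : 0 ≤ β) (Λ : Finset (ℤ × ℤ)) {A B C D : Set Cfg2}
    (h : ∀ a ∈ A, ∀ b ∈ B, a ⊓ b ∈ C ∧ a ⊔ b ∈ D) :
    dropSum β Λ A * dropSum β Λ B ≤ dropSum β Λ C * dropSum β Λ D := by
  classical
  have hinf : ∀ S T : Finset (ℤ × ℤ), cfg (S ∪ T) = cfg S ⊓ cfg T := fun S T => by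
    funext x; by_cases h1 : x ∈ S <;> by_cases h2 : x ∈ T <;> simp [cfg, h1, h2]
  have hsup : ∀ S T : Finset (ℤ × ℤ), cfg (S ∩ T) = cfg S ⊔ cfg T := fun S T => by
    funext x; by_cases h1 : x ∈ S <;> by_cases h2 : x ∈ T <;> simp [cfg, h1, h2]
  refine (Finset.four_functions_theorem Λ (f₁ := dropWt β) (f₂ := dropWt β) (f₃ := dropWt β)
    (f₄ := dropWt β) (fun _ => (dropWt_pos _ _).le) (fun _ => (dropWt_pos _ _).le)
    (fun _ => (dropWt_pos _ _).le) (fun _ => (dropWt_pos _ _).le)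
    (fun s _ t _ => dropWt_supermodular hβ s t) (Finset.filter_subset _ _)
    (Finset.filter_subset _ _)).trans ?_
  rw [mul_comm]
  have hnn : ∀ T : Finset (Finset (ℤ × ℤ)), 0 ≤ ∑ D ∈ T, dropWt β D := fun T =>
    Finset.sum_nonneg fun _ _ => (dropWt_pos _ _).le
  refine mul_le_mul ?_ ?_ (hnn _) (hnn _)
  · refine Finset.sum_le_sum_of_subset_of_nonneg (fun T hT => ?_) fun _ _ _ => (dropWt_pos _ _).le
    obtain ⟨S, hS, S', hS', rfl⟩ := Finset.mem_sups.1 hT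
    rw [Finset.mem_filter, Finset.mem_powerset] at hS hS' ⊢
    rw [Finset.sup_eq_union, hinf]
    exact ⟨Finset.union_subset hS.1 hS'.1, (h _ hS.2 _ hS'.2).1⟩
  · refine Finset.sum_le_sum_of_subset_of_nonneg (fun T hT => ?_) fun _ _ _ => (dropWt_pos _ _).le
    obtain ⟨S, hS, S', hS', rfl⟩ := Finset.mem_infs.1 hT
    rw [Finset.mem_filter, Finset.mem_powerset] at hS hS' ⊢
    rw [Finset.inf_eq_inter, hsup]
    exact ⟨Finset.inter_subset_left.trans hS.1, (h _ hS.2 _ hS'.2).2⟩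

theorem plusProb_fkg {β : ℝ} (hβ : 0 ≤ β) (Λ : Finset (ℤ × ℤ)) {A B C D : Set Cfg2}
    (h : ∀ a ∈ A, ∀ b ∈ B, a ⊓ b ∈ C ∧ a ⊔ b ∈ D) :
    plusProb β Λ A * plusProb β Λ B ≤ plusProb β Λ C * plusProb β Λ D := by
  simp only [plusProb, div_mul_div_comm]
  exact div_le_div_of_nonneg_right (dropSum_fkg hβ Λ h)
    (mul_self_nonneg _)

end DropletRepresentation

section Bridges

theorem sval_cfg (D : Finset (ℤ × ℤ)) (x : ℤ × ℤ) :
    sval (cfg D x) = 1 - 2 * (if x ∈ D then 1 else 0) := by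
  by_cases h : x ∈ D <;> norm_num [cfg, sval, h]

theorem sum_sum_spin {U D : Finset (ℤ × ℤ)} (hD : D ⊆ U) (w : ℤ × ℤ → ℤ × ℤ → ℝ) :
    ∑ x ∈ U, ∑ y ∈ U, w x y * (sval (cfg D x) * sval (cfg D y)) =
      (∑ x ∈ U, ∑ y ∈ U, w x y) - 2 * (∑ x ∈ D, ∑ y ∈ U, (w x y + w y x)) +
        4 * ∑ x ∈ D, ∑ y ∈ D, w x y := by
  have e : ∀ x y, w x y * (sval (cfg D x) * sval (cfg D y)) = w x y -
      2 * (if x ∈ D then w x y else 0) - 2 * (if y ∈ D then w x y else 0) +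
      4 * (if x ∈ D then (if y ∈ D then w x y else 0) else 0) := fun x y => by
    rw [sval_cfg, sval_cfg]
    split_ifs <;> ring
  simp only [e, Finset.sum_add_distrib, Finset.sum_sub_distrib, ← Finset.mul_sum]
  have h1 : ∀ f : ℤ × ℤ → ℤ × ℤ → ℝ, ∀ B, ∑ x ∈ U, ∑ y ∈ B, (if x ∈ D then f x y else 0) =
      ∑ x ∈ D, ∑ y ∈ B, f x y := fun f B => by
    have : ∀ x, ∑ y ∈ B, (if x ∈ D then f x y else 0) = if x ∈ D then ∑ y ∈ B, f x y else 0 :=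
      fun x => by split_ifs <;> simp
    simp only [this, Finset.sum_ite_mem, Finset.inter_eq_right.2 hD]
  have h2 : ∑ x ∈ U, ∑ y ∈ U, (if y ∈ D then w x y else 0) = ∑ x ∈ D, ∑ y ∈ U, w y x := by
    rw [Finset.sum_comm, h1 fun x y => w y x]
  rw [h1, h1, h2]
  simp only [Finset.sum_ite_mem, Finset.inter_eq_right.2 hD]
  ring

theorem sum_orient_self (D : Finset (ℤ × ℤ)) :
    ∑ x ∈ D, ∑ y ∈ D, orient x y = edgeCount D D / 2 := by
  have : edgeCount D D = ∑ x ∈ D, ∑ y ∈ D, orient x y + ∑ x ∈ D, ∑ y ∈ D, orient y x := by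
    simp only [edgeCount, adjInd_eq_orient, Finset.sum_add_distrib]
  rw [this, Finset.sum_comm (f := fun x y => orient y x)]
  ring

theorem sum_orient_spin {U D : Finset (ℤ × ℤ)} (hD : ∀ x ∈ D, nbrs x ⊆ U) (hDU : D ⊆ U) :
    ∑ x ∈ U, ∑ y ∈ U, orient x y * (sval (cfg D x) * sval (cfg D y)) =
      (∑ x ∈ U, ∑ y ∈ U, orient x y) - 2 * bdry D := by
  rw [sum_sum_spin hDU, sum_orient_self D, bdry]
  simp only [← adjInd_eq_orient]
  rw [Finset.sum_congr rfl fun x hx => sum_adjInd (hD x hx)]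
  simp
  ring

theorem exists_isingWeight_eq (β : ℝ) (Λ : Finset (ℤ × ℤ)) :
    ∃ c : ℝ, 0 < c ∧ ∀ D ⊆ Λ, isingWeight β 0 Λ (fun _ => true) (cfg D) = c * dropWt β D := by
  set A : ℝ := ∑ x ∈ Λ, ∑ y ∈ Λ, adjInd x y with hA
  set B : ℝ := ∑ x ∈ Λ, (4 - ∑ y ∈ Λ, adjInd x y) with hB
  refine ⟨Real.exp (β * (A / 2 + B)), Real.exp_pos _, fun D hD => ?_⟩
  have e1 : ∑ x ∈ Λ, ∑ y ∈ Λ.filter (fun y => y ∈ nbrs x), sval (cfg D x) * sval (cfg D y) =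
      A - 2 * (∑ x ∈ D, ∑ y ∈ Λ, (adjInd x y + adjInd y x)) + 4 * edgeCount D D := by
    rw [hA, edgeCount, ← sum_sum_spin hD]
    refine Finset.sum_congr rfl fun x _ => ?_
    rw [Finset.sum_filter]
    exact Finset.sum_congr rfl fun y _ => by simp [adjInd]
  have e2 : ∀ x, ∑ y ∈ (nbrs x).filter (fun y => y ∉ Λ), sval (cfg D x) * sval true =
      sval (cfg D x) * (4 - ∑ y ∈ Λ, adjInd x y) := fun x => by
    have h3 : (((nbrs x).filter (fun y => y ∉ Λ)).card : ℝ) = 4 - ∑ y ∈ Λ, adjInd x y := by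
      have h4 := Finset.card_filter_add_card_filter_not (s := nbrs x) (fun y => y ∈ Λ)
      rw [card_nbrs] at h4
      have h5 : ∑ y ∈ Λ, adjInd x y = (((nbrs x).filter (fun y => y ∈ Λ)).card : ℝ) := by
        simp only [adjInd, Finset.sum_ite_mem, Finset.sum_const, nsmul_eq_mul, mul_one]
        rw [Finset.inter_comm, ← Finset.filter_mem_eq_inter]
      rw [h5, eq_sub_iff_add_eq']
      exact_mod_cast h4
    simp [← h3, sval]
  have e3 : ∑ x ∈ Λ, sval (cfg D x) * (4 - ∑ y ∈ Λ, adjInd x y) =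
      B - 2 * ∑ x ∈ D, (4 - ∑ y ∈ Λ, adjInd x y) := by
    have : ∀ x, sval (cfg D x) * (4 - ∑ y ∈ Λ, adjInd x y) = (4 - ∑ y ∈ Λ, adjInd x y) -
        2 * (if x ∈ D then (4 - ∑ y ∈ Λ, adjInd x y) else 0) := fun x => by
      rw [sval_cfg]; split_ifs <;> ring
    simp only [this]
    rw [Finset.sum_sub_distrib, ← Finset.mul_sum, Finset.sum_ite_mem, Finset.inter_eq_right.2 hD]
  unfold isingWeight dropWt
  simp only [e2]
  rw [e1, e3, ← Real.exp_add, bdry]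
  simp only [adjInd_comm _, Finset.sum_sub_distrib, Finset.sum_add_distrib]
  congr 1
  simp
  ring

/-- Configurations on `U` are parametrized by their set of minus spins. -/
theorem sum_config_eq_sum_powerset {M : Type*} [AddCommMonoid M] (U : Finset (ℤ × ℤ))
    (G : (↥U → Bool) → M) :
    ∑ τ, G τ = ∑ D ∈ U.powerset, G fun x => cfg D x := by
  classical
  refine Finset.sum_bij' (fun τ _ => (U.attach.filter fun x => τ x = false).map
      (Function.Embedding.subtype _)) (fun D _ => fun x => cfg D x) ?_ ?_ ?_ ?_ ?_
  · intro τ _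
    simp only [Finset.mem_powerset]
    intro x hx
    obtain ⟨y, _, rfl⟩ := Finset.mem_map.1 hx
    exact y.2
  · intro D _; exact Finset.mem_univ _
  · intro τ _
    funext x
    by_cases h : τ x = false
    · simp [cfg, h]
    · simp [cfg, h]
  · intro D hD
    ext x
    rw [Finset.mem_powerset] at hD
    simp [cfg]
    exact fun h => hD h
  · intro τ _
    congr 1
    funext x
    by_cases h : τ x = false
    · simp [cfg, h]
    · simp [cfg, h]

theorem fill_cfg {Λ D : Finset (ℤ × ℤ)} (hD : D ⊆ Λ) :
    fill Λ (fun _ => true) (fun x => cfg D x) = cfg D := by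
  funext x
  unfold fill
  split_ifs with h
  · rfl
  · exact (cfg_eq_true.2 fun h' => h (hD h')).symm

theorem isingFV_apply (β : ℝ) (Λ : Finset (ℤ × ℤ)) {E : Set Cfg2} (hE : MeasurableSet E) :
    isingFV β 0 Λ (fun _ => true) E = ENNReal.ofReal (plusProb β Λ E) := by
  classical
  obtain ⟨c, hc, hw⟩ := exists_isingWeight_eq β Λ
  have hsum : ∀ F : Set Cfg2, ∑ D ∈ Λ.powerset, ENNReal.ofReal (c * dropWt β D) *
      F.indicator 1 (cfg D) = ENNReal.ofReal (c * dropSum β Λ F) := fun F => by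
    rw [dropSum, Finset.mul_sum, Finset.sum_filter,
      ENNReal.ofReal_sum_of_nonneg fun D _ => by
        split_ifs
        · exact (mul_pos hc (dropWt_pos _ _)).le
        · rfl]
    refine Finset.sum_congr rfl fun D _ => ?_
    by_cases h : cfg D ∈ F <;> simp [h]
  have h1 : ∑ τ : ↥Λ → Bool, ENNReal.ofReal (isingWeight β 0 Λ (fun _ => true)
      (fill Λ (fun _ => true) τ)) = ENNReal.ofReal (c * dropSum β Λ Set.univ) := by
    rw [← hsum, sum_config_eq_sum_powerset]
    refine Finset.sum_congr rfl fun D hD => ?_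
    rw [fill_cfg (Finset.mem_powerset.1 hD), hw D (Finset.mem_powerset.1 hD)]
    simp
  have h2 : (∑ τ : ↥Λ → Bool, ENNReal.ofReal (isingWeight β 0 Λ (fun _ => true)
      (fill Λ (fun _ => true) τ)) • Measure.dirac (fill Λ (fun _ => true) τ)) E =
      ENNReal.ofReal (c * dropSum β Λ E) := by
    rw [← hsum, Measure.finsetSum_apply, sum_config_eq_sum_powerset]
    refine Finset.sum_congr rfl fun D hD => ?_
    rw [fill_cfg (Finset.mem_powerset.1 hD), hw D (Finset.mem_powerset.1 hD), Measure.smul_apply,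
      Measure.dirac_apply' _ hE, smul_eq_mul]
  have hpos : 0 < c * dropSum β Λ Set.univ := mul_pos hc (dropSum_univ_pos β Λ)
  rw [isingFV, Measure.smul_apply, h1, h2, smul_eq_mul, ← ENNReal.ofReal_inv_of_pos hpos,
    ← ENNReal.ofReal_mul (inv_pos.2 hpos).le, plusProb]
  congr 1
  field_simp

/-- Pair sums on `U` with plus spins off `Λ` in terms of droplet weights. -/
theorem exists_pairSum_eq (β : ℝ) {U Λ : Finset (ℤ × ℤ)} (hΛ : ∀ x ∈ Λ, nbrs x ⊆ U)
    (hΛU : Λ ⊆ U) : ∃ c : ℝ, 0 < c ∧ ∀ F : (↥U → Bool) → ℝ,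
      pairSum (fun x y : ↥U => β * orient x y)
        (fun η => F η * agreeOn (outside U Λ) allPlus η) =
        c * ∑ D ∈ Λ.powerset, dropWt β D * F fun x => cfg D x := by
  classical
  refine ⟨Real.exp (β * ∑ x ∈ U, ∑ y ∈ U, orient x y), Real.exp_pos _, fun F => ?_⟩
  rw [pairSum, sum_config_eq_sum_powerset, Finset.mul_sum]
  have hsub : Λ.powerset ⊆ U.powerset := Finset.powerset_mono.2 hΛU
  rw [← Finset.sum_subset hsub]
  · refine Finset.sum_congr rfl fun D hD => ?_
    rw [Finset.mem_powerset] at hD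
    have h1 : agreeOn (outside U Λ) allPlus (fun x : ↥U => cfg D x) = 1 := by
      refine if_pos fun x hx => ?_
      simp only [outside, Finset.mem_filter] at hx
      exact cfg_eq_true.2 fun h => hx.2 (hD h)
    have h2 : pairWt (fun x y : ↥U => β * orient x y) (fun x : ↥U => cfg D x) =
        Real.exp (β * ∑ x ∈ U, ∑ y ∈ U, orient x y) * dropWt β D := by
      rw [pairWt, dropWt, ← Real.exp_add]
      congr 1
      have h3 := sum_orient_spin (fun x hx => hΛ x (hD hx)) (hD.trans hΛU)
      rw [← Finset.sum_coe_sort U] at h3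
      have h4 : ∀ x : ↥U, ∑ y ∈ U, orient x y * (sval (cfg D x) * sval (cfg D y)) =
          ∑ y : ↥U, orient x y * (sval (cfg D x) * sval (cfg D y)) := fun x =>
        (Finset.sum_coe_sort U fun y => orient x y * (sval (cfg D x) * sval (cfg D y))).symm
      simp only [h4] at h3
      simp only [mul_assoc β, ← Finset.mul_sum, h3]
      ring
    rw [h1, h2]
    ring
  · intro D hD hD'
    rw [Finset.mem_powerset] at hD hD'
    obtain ⟨x, hx, hxΛ⟩ := Finset.not_subset.1 hD'
    have : agreeOn (outside U Λ) allPlus (fun x : ↥U => cfg D x) = 0 := by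
      refine if_neg fun h => ?_
      have := h ⟨x, hD hx⟩ (by simp [outside, hxΛ])
      exact cfg_eq_true.1 this hx
    simp [this]

end Bridges

section SurfaceTension

/-- Configurations which agree with `ω` on `T`. -/
def agreeSet (T : Finset (ℤ × ℤ)) (ω : Cfg2) : Set Cfg2 := {η | ∀ z ∈ T, η z = ω z}

/-- All spins in `T` are plus. -/
def plusOn (T : Finset (ℤ × ℤ)) : Set Cfg2 := agreeSet T fun _ => true

/-- All spins in `T` are minus. -/
def minusOn (T : Finset (ℤ × ℤ)) : Set Cfg2 := agreeSet T fun _ => false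

/-- The sites of `T` as a subset of `U`. -/
def liftTo (U T : Finset (ℤ × ℤ)) : Finset ↥U := Finset.univ.filter fun x => (x : ℤ × ℤ) ∈ T

theorem cfg_mem_plusOn {D T : Finset (ℤ × ℤ)} : cfg D ∈ plusOn T ↔ Disjoint T D := by
  rw [Finset.disjoint_left]
  exact forall₂_congr fun x _ => cfg_eq_true

theorem cfg_mem_minusOn {D T : Finset (ℤ × ℤ)} : cfg D ∈ minusOn T ↔ T ⊆ D :=
  forall₂_congr fun _ _ => cfg_eq_false

theorem agreeOn_liftTo {U T : Finset (ℤ × ℤ)} (hT : T ⊆ U) (ω : Cfg2) (D : Finset (ℤ × ℤ))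
    [Decidable (cfg D ∈ agreeSet T ω)] :
    agreeOn (liftTo U T) (fun x => ω x) (fun x : ↥U => cfg D x) =
      if cfg D ∈ agreeSet T ω then 1 else 0 := by
  have : (∀ x ∈ liftTo U T, cfg D x = ω x) ↔ cfg D ∈ agreeSet T ω := by
    constructor
    · intro h z hz
      exact h ⟨z, hT hz⟩ (by simp [liftTo, hz])
    · intro h x hx
      exact h x (by simpa [liftTo] using hx)
  unfold agreeOn
  simp only [this]

theorem disjoint_outside_liftTo (U : Finset (ℤ × ℤ)) {Λ T : Finset (ℤ × ℤ)} (hT : T ⊆ Λ) :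
    Disjoint (outside U Λ) (liftTo U T) := by
  rw [Finset.disjoint_left]
  intro x h1 h2
  simp only [outside, liftTo, Finset.mem_filter] at h1 h2
  exact h1.2 (hT h2.2)

theorem nbrs_subset_box {L : ℕ} {x : ℤ × ℤ} (hx : x ∈ box L) : nbrs x ⊆ box (L + 1) := by
  intro y hy
  rw [mem_nbrs] at hy
  simp only [box, Finset.mem_product, Finset.mem_Icc] at hx ⊢
  push_cast
  omega

theorem box_mono {m n : ℕ} (h : m ≤ n) : box m ⊆ box n := by
  intro x hx
  simp only [box, Finset.mem_product, Finset.mem_Icc] at hx ⊢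
  omega

theorem betaCrit_pos : 0 < betaCrit :=
  div_pos (Real.log_pos (by linarith [Real.sqrt_pos.2 (show (0 : ℝ) < 2 by norm_num)]))
    (by norm_num)

theorem exists_magnetization_bound_dropWt {β : ℝ} (hβ : betaCrit < β) :
    ∃ m₀ : ℝ, 0 < m₀ ∧ m₀ ≤ 1 ∧ ∀ (L : ℕ) (x : ℤ × ℤ),
      m₀ * ∑ D ∈ (box L).powerset, dropWt β D ≤
        ∑ D ∈ (box L).powerset, dropWt β D * sval (cfg D x) := by
  obtain ⟨m₀, hm, h⟩ := exists_magnetization_bound hβ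
  have hpos : ∀ L : ℕ, 0 < ∑ D ∈ (box L).powerset, dropWt β D := fun L => by
    rw [← dropSum_univ]; exact dropSum_univ_pos _ _
  have h1 : ∀ (L : ℕ) (x : ℤ × ℤ), x ∈ box L → m₀ * ∑ D ∈ (box L).powerset, dropWt β D ≤
        ∑ D ∈ (box L).powerset, dropWt β D * sval (cfg D x) := fun L x hx => by
    obtain ⟨U, hxU, hU, hle⟩ := h L x hx
    obtain ⟨c, hc, he⟩ := exists_pairSum_eq β (fun y hy => (nbrs_subset_box hy).trans hU)
      ((box_mono (Nat.le_succ L)).trans hU)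
    have e1 := he fun _ => 1
    simp only [one_mul, mul_one] at e1
    rw [e1, he fun η => sval (η ⟨x, hxU⟩)] at hle
    rw [mul_left_comm] at hle
    exact le_of_mul_le_mul_left hle hc
  have hle1 : ∀ (L : ℕ) (x : ℤ × ℤ), ∑ D ∈ (box L).powerset, dropWt β D * sval (cfg D x) ≤
      ∑ D ∈ (box L).powerset, dropWt β D := fun L x => by
    refine Finset.sum_le_sum fun D _ => ?_
    have : sval (cfg D x) ≤ 1 := (le_abs_self _).trans_eq (abs_sval _)
    nlinarith [dropWt_pos β D]
  have hm1 : m₀ ≤ 1 := by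
    have := (h1 0 (0, 0) (by simp [box])).trans (hle1 0 (0, 0))
    exact le_of_mul_le_mul_right (by linarith) (hpos 0)
  refine ⟨m₀, hm, hm1, fun L x => ?_⟩
  by_cases hx : x ∈ box L
  · exact h1 L x hx
  · have : ∀ D ∈ (box L).powerset, dropWt β D * sval (cfg D x) = dropWt β D := fun D hD => by
      have : x ∉ D := fun h' => hx (Finset.mem_powerset.1 hD h')
      simp [sval, cfg, this]
    rw [Finset.sum_congr rfl this]
    nlinarith [hpos L]

theorem exists_pairSum_agreeOn_eq (β : ℝ) {U Λ : Finset (ℤ × ℤ)} (hΛ : ∀ x ∈ Λ, nbrs x ⊆ U)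
    (hΛU : Λ ⊆ U) : ∃ c : ℝ, 0 < c ∧ ∀ (T : Finset (ℤ × ℤ)) (_ : T ⊆ U) (ω : Cfg2),
      pairSum (fun x y : ↥U => β * orient x y)
        (fun η => agreeOn (liftTo U T) (fun x => ω x) η * agreeOn (outside U Λ) allPlus η) =
        c * dropSum β Λ (agreeSet T ω) := by
  classical
  obtain ⟨c, hc, he⟩ := exists_pairSum_eq β hΛ hΛU
  refine ⟨c, hc, fun T hT ω => ?_⟩
  rw [he, dropSum, Finset.sum_filter]
  simp only [agreeOn_liftTo hT, mul_ite, mul_one, mul_zero]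

theorem agreeOn_union {V : Type*} [Fintype V] [DecidableEq V] (P Q : Finset V) (ω η : V → Bool) :
    agreeOn (P ∪ Q) ω η = agreeOn P ω η * agreeOn Q ω η := by
  unfold agreeOn
  by_cases h1 : ∀ x ∈ P, η x = ω x
  · by_cases h2 : ∀ x ∈ Q, η x = ω x
    · rw [if_pos h1, if_pos h2, if_pos, one_mul]
      intro x hx
      rcases Finset.mem_union.1 hx with h | h
      exacts [h1 x h, h2 x h]
    · rw [if_neg h2, if_neg fun h => h2 fun x hx => h x (Finset.mem_union_right _ hx), mul_zero]
  · rw [if_neg h1, if_neg fun h => h1 fun x hx => h x (Finset.mem_union_left _ hx), zero_mul]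

theorem agreeOn_congr_target {V : Type*} [Fintype V] [DecidableEq V] {P : Finset V} {ω ω' : V → Bool}
    (h : ∀ x ∈ P, ω x = ω' x) (η : V → Bool) : agreeOn P ω η = agreeOn P ω' η := by
  unfold agreeOn
  simp only [forall₂_congr fun x hx => (by rw [h x hx] : η x = ω x ↔ η x = ω' x)]

/-- Below the critical temperature, a row of minus spins is exponentially less likely than a row
of plus spins. -/
theorem exists_surface_tension {β : ℝ} (hβ : betaCrit < β) :
    ∃ κ : ℝ, 0 < κ ∧ ∀ (L : ℕ) (S : Finset (ℤ × ℤ)), S ⊆ box L → (∀ z ∈ S, z.2 = 0) →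
      Real.exp (κ * S.card) * plusProb β (box L) (minusOn S) ≤
        plusProb β (box L) (plusOn S) := by
  classical
  obtain ⟨β₁, h1, h2⟩ := exists_between hβ
  obtain ⟨m, hm, -, hmag⟩ := exists_magnetization_bound_dropWt h1
  refine ⟨2 * m ^ 2 * (β - β₁), mul_pos (by positivity) (by linarith), fun L S hS hS0 => ?_⟩
  set U := box (L + 1) with hU
  set Λ := box L with hΛ
  have hΛU : Λ ⊆ U := box_mono (Nat.le_succ L)
  have hn : ∀ x ∈ Λ, nbrs x ⊆ U := fun x hx => nbrs_subset_box hx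
  have hSU : S ⊆ U := hS.trans hΛU
  obtain ⟨c₁, hc₁, he₁⟩ := exists_pairSum_eq β₁ hn hΛU
  obtain ⟨c, hc, he⟩ := exists_pairSum_agreeOn_eq β hn hΛU
  have h00 : ((0, 0) : ℤ × ℤ) ∈ U := by simp [hU, box]; omega
  set v : ℤ × ℤ → ℕ → ↥U := fun z j =>
    if h : (z.1, z.2 + (j : ℤ)) ∈ U then ⟨(z.1, z.2 + (j : ℤ)), h⟩ else ⟨(0, 0), h00⟩ with hv
  have hvmem : ∀ z ∈ S, ∀ j ≤ L + 1, (z.1, z.2 + (j : ℤ)) ∈ U := fun z hz j hj => by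
    have h3 := hS hz
    have h4 := hS0 z hz
    simp only [hΛ, hU, box, Finset.mem_product, Finset.mem_Icc] at h3 ⊢
    push_cast
    omega
  have hvval : ∀ z ∈ S, ∀ j ≤ L + 1, ((v z j : ↥U) : ℤ × ℤ) = (z.1, z.2 + (j : ℤ)) :=
    fun z hz j hj => by simp only [hv, dif_pos (hvmem z hz j hj)]
  set ω : ↥U → Bool := fun x => decide ((x : ℤ × ℤ) ∉ S) with hω
  have key := surface_tension (a := fun x y : ↥U => orient x y) (fun x y => orient_nonneg x y)
    (O := outside U Λ) (P := outside U Λ ∪ liftTo U S) Finset.subset_union_left ω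
    (betaCrit_pos.trans h1).le h2.le hm (fun x => by
      have e1 := he₁ fun _ => 1
      simp only [one_mul, mul_one] at e1
      rw [e1, he₁ fun η => sval (η x)]
      have := mul_le_mul_of_nonneg_left (hmag L x) hc₁.le
      linarith) S (L + 1) v (by
      rintro ⟨z, j⟩ hp ⟨w, k⟩ hq hpq
      simp only [Finset.coe_product, Set.mem_prod, Finset.mem_coe, Finset.mem_range] at hp hq hpq
      have h3 := congrArg (Subtype.val) hpq
      rw [hvval z hp.1 j hp.2.le, hvval w hq.1 k hq.2.le, hS0 z hp.1, hS0 w hq.1] at h3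
      simp only [Prod.mk.injEq] at h3
      have h4 := hS0 z hp.1
      have h5 := hS0 w hq.1
      rw [Prod.mk.injEq, Prod.ext_iff]
      omega) (α := 1) zero_le_one (fun z hz j hj => by
      rw [hvval z hz j hj.le, hvval z hz (j + 1) hj]
      unfold orient
      rw [if_pos (Or.inr (by push_cast; simp [add_assoc]))]) (fun z hz => by
      have h3 := hvval z hz 0 (Nat.zero_le _)
      simp only [Nat.cast_zero, add_zero] at h3
      refine ⟨Finset.mem_union_right _ ?_, ?_⟩
      · simp only [liftTo, Finset.mem_filter, Finset.mem_univ, true_and, h3]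
        exact hz
      · simp only [hω, h3]
        simpa using hz) (fun z hz => by
      have h3 := hvval z hz (L + 1) le_rfl
      have h4 : (z.1, z.2 + ((L + 1 : ℕ) : ℤ)) ∉ Λ := by
        simp only [hΛ, box, Finset.mem_product, Finset.mem_Icc, hS0 z hz]
        push_cast
        omega
      refine ⟨Finset.mem_union_left _ ?_, ?_⟩
      · simp only [outside, Finset.mem_filter, Finset.mem_univ, true_and, h3]
        exact h4
      · simp only [hω, h3]
        simpa using fun h => h4 (hS h))
  have e1 : pairSum (fun x y : ↥U => β * orient x y) (agreeOn (outside U Λ ∪ liftTo U S) ω) =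
      c * dropSum β Λ (minusOn S) := by
    rw [minusOn, ← he S hSU]
    refine congrArg (pairSum _) (funext fun η => ?_)
    rw [agreeOn_union, mul_comm]
    have h3 : agreeOn (liftTo U S) ω η = agreeOn (liftTo U S) (fun _ => false) η :=
      agreeOn_congr_target (fun x hx => by
        simp only [liftTo, Finset.mem_filter] at hx
        simpa [hω] using hx.2) η
    have h4 : agreeOn (outside U Λ) ω η = agreeOn (outside U Λ) allPlus η :=
      agreeOn_congr_target (fun x hx => by
        simp only [outside, Finset.mem_filter] at hx
        simpa [hω, allPlus] using fun h => hx.2 (hS h)) η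
    rw [h3, h4]
  have e2 : pairSum (fun x y : ↥U => β * orient x y) (agreeOn (outside U Λ ∪ liftTo U S) allPlus) =
      c * dropSum β Λ (plusOn S) := by
    rw [plusOn, ← he S hSU]
    refine congrArg (pairSum _) (funext fun η => ?_)
    rw [agreeOn_union, mul_comm]
    rfl
  rw [e1, e2] at key
  have e3 : 2 * 1 * m ^ 2 * (S.card : ℝ) * (β - β₁) = 2 * m ^ 2 * (β - β₁) * S.card := by ring
  rw [e3] at key
  rw [plusProb, plusProb, ← mul_div_assoc]
  refine div_le_div_of_nonneg_right ?_ (dropSum_nonneg _ _ _)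
  exact le_of_mul_le_mul_left (by linarith) hc

/-- Conditional probability of a plus spin at `x` given the spins on `T`. -/
noncomputable def condPlus (β : ℝ) (Λ : Finset (ℤ × ℤ)) (x : ℤ × ℤ) (T : Finset (ℤ × ℤ))
    (ω : Cfg2) : ℝ :=
  dropSum β Λ (agreeSet T ω ∩ {η | η x = true}) / dropSum β Λ (agreeSet T ω)

theorem dropSum_agreeSet_pos (β : ℝ) {Λ T : Finset (ℤ × ℤ)} (hT : T ⊆ Λ) (ω : Cfg2) :
    0 < dropSum β Λ (agreeSet T ω) := by
  refine dropSum_pos (D := T.filter fun z => ω z = false)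
    ((Finset.filter_subset _ _).trans hT) fun z hz => ?_
  by_cases h : ω z = false
  · rw [h, cfg_eq_false]; simp [hz, h]
  · rw [cfg_eq_true.2 (by simp [h])]; simpa using h

/-- Comparison of the response of the spin at `x` to flipping the boundary condition `ω` on `T`
with its response to flipping a constant boundary condition on a larger set. -/
theorem condPlus_gap {β : ℝ} (hβ : 0 ≤ β) (L : ℕ) {T T' : Finset (ℤ × ℤ)} (hTT' : T ⊆ T')
    (hT' : T' ⊆ box L) {x : ℤ × ℤ} (hx : x ∈ box L) (ω : Cfg2) :
    condPlus β (box L) x T' (fun _ => true) + condPlus β (box L) x T' (fun _ => false) ≤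
      condPlus β (box L) x T ω + condPlus β (box L) x T (fun z => !ω z) := by
  classical
  set U := box (L + 1) with hU
  set Λ := box L with hΛ
  have hΛU : Λ ⊆ U := box_mono (Nat.le_succ L)
  have hn : ∀ x ∈ Λ, nbrs x ⊆ U := fun x hx => nbrs_subset_box hx
  obtain ⟨c, hc, he⟩ := exists_pairSum_eq β hn hΛU
  set J : ↥U → ↥U → ℝ := fun x y => β * orient x y with hJ
  have hmag : ∀ (B : Finset (ℤ × ℤ)), B ⊆ Λ → ∀ σ : Cfg2,
      bdMag J (outside U Λ) allPlus (liftTo U B) (fun y => σ y) ⟨x, hΛU hx⟩ =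
        2 * condPlus β Λ x B σ - 1 := fun B hB σ => by
    have h1 : ∀ F, bdSum J (outside U Λ) allPlus (liftTo U B) (fun y => σ y) F =
        c * ∑ D ∈ Λ.powerset with cfg D ∈ agreeSet B σ, dropWt β D * F fun y => cfg D y :=
      fun F => by
      have h2 := he fun η => F η * agreeOn (liftTo U B) (fun y => σ y) η
      rw [Finset.sum_filter]
      refine Eq.trans ?_ (h2.trans ?_)
      · exact congrArg (pairSum J) (funext fun η => by ring)
      · refine congrArg (c * ·) (Finset.sum_congr rfl fun D _ => ?_)
        rw [agreeOn_liftTo (hB.trans hΛU)]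
        split_ifs <;> simp
    have h3 : ∑ D ∈ Λ.powerset with cfg D ∈ agreeSet B σ, dropWt β D * sval (cfg D x) =
        2 * dropSum β Λ (agreeSet B σ ∩ {η | η x = true}) - dropSum β Λ (agreeSet B σ) := by
      have h4 : dropSum β Λ (agreeSet B σ ∩ {η | η x = true}) =
          ∑ D ∈ Λ.powerset with cfg D ∈ agreeSet B σ,
            if cfg D x = true then dropWt β D else 0 := by
        rw [← Finset.sum_filter, Finset.filter_filter, dropSum]
        exact Finset.sum_congr (by ext D; simp) fun _ _ => rfl
      rw [h4, dropSum, Finset.mul_sum, ← Finset.sum_sub_distrib]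
      refine Finset.sum_congr rfl fun D _ => ?_
      unfold sval
      split_ifs <;> ring
    have hp := dropSum_agreeSet_pos β hB σ
    rw [bdMag, h1, h1, condPlus]
    simp only [mul_one]
    rw [h3, ← dropSum, mul_div_mul_left _ _ hc.ne', sub_div, div_self hp.ne', mul_div_assoc]
  have key := bdMag_gap J (fun x y => mul_nonneg hβ (orient_nonneg _ _))
    (T := liftTo U T) (T' := liftTo U T') (fun y hy => by
      simp only [liftTo, Finset.mem_filter] at hy ⊢
      exact ⟨hy.1, hTT' hy.2⟩) (disjoint_outside_liftTo U hT') (fun y => ω y) ⟨x, hΛU hx⟩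
  have k1 := hmag T' hT' fun _ => true
  have k2 := hmag T' hT' fun _ => false
  have k3 := hmag T (hTT'.trans hT') ω
  have k4 := hmag T (hTT'.trans hT') fun z => !ω z
  change bdMag J (outside U Λ) allPlus (liftTo U T') allPlus ⟨x, hΛU hx⟩ = _ at k1
  change bdMag J (outside U Λ) allPlus (liftTo U T') allMinus ⟨x, hΛU hx⟩ = _ at k2
  linarith

end SurfaceTension

section DropletInequalities

/-- Conditioning on plus spins in `Λ' \ Λ` reduces the volume. -/
theorem dropSum_inter_plusOn_sdiff (β : ℝ) {Λ Λ' : Finset (ℤ × ℤ)} (h : Λ ⊆ Λ') (E : Set Cfg2) :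
    dropSum β Λ' (E ∩ plusOn (Λ' \ Λ)) = dropSum β Λ E := by
  classical
  refine Finset.sum_congr ?_ fun _ _ => rfl
  ext D
  simp only [Finset.mem_filter, Finset.mem_powerset, Set.mem_inter_iff, cfg_mem_plusOn]
  constructor
  · rintro ⟨h1, h2, h3⟩
    refine ⟨fun z hz => ?_, h2⟩
    by_contra h4
    exact Finset.disjoint_left.1 h3 (Finset.mem_sdiff.2 ⟨h1 hz, h4⟩) hz
  · rintro ⟨h1, h2⟩
    exact ⟨h1.trans h, h2, Finset.disjoint_left.2 fun z hz hz' => (Finset.mem_sdiff.1 hz).2 (h1 hz')⟩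

theorem dropSum_minusOn_mul_le {β : ℝ} (hβ : 0 ≤ β) {Λ Λ' S : Finset (ℤ × ℤ)} (h : Λ ⊆ Λ')
    (hS : S ⊆ Λ' \ Λ) (T : Finset (ℤ × ℤ)) :
    dropSum β Λ (minusOn T) * dropSum β Λ' (plusOn S) ≤
      dropSum β Λ' (minusOn T ∩ plusOn S) * dropSum β Λ Set.univ := by
  rw [← dropSum_inter_plusOn_sdiff β h (minusOn T), ← dropSum_inter_plusOn_sdiff β h Set.univ]
  refine dropSum_fkg hβ Λ' ?_
  rintro a ⟨ha1, ha2⟩ b hb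
  refine ⟨⟨fun z hz => ?_, fun z hz => ?_⟩, trivial, fun z hz => ?_⟩
  · simp [ha1 z hz]
  · simp [ha2 z (hS hz), hb z hz]
  · simp [ha2 z hz]

theorem plusOn_empty : plusOn ∅ = Set.univ := by ext; simp [plusOn, agreeSet]

theorem plusProb_minusOn_mono {β : ℝ} (hβ : 0 ≤ β) {Λ Λ' : Finset (ℤ × ℤ)} (h : Λ ⊆ Λ')
    (T : Finset (ℤ × ℤ)) : plusProb β Λ (minusOn T) ≤ plusProb β Λ' (minusOn T) := by
  have := dropSum_minusOn_mul_le hβ h (Finset.empty_subset _) T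
  rw [plusOn_empty, Set.inter_univ] at this
  rwa [plusProb, plusProb, div_le_div_iff₀ (dropSum_univ_pos _ _) (dropSum_univ_pos _ _)]

theorem plusProb_plusOn_anti {β : ℝ} (hβ : 0 ≤ β) {Λ Λ' : Finset (ℤ × ℤ)} (h : Λ ⊆ Λ')
    (T : Finset (ℤ × ℤ)) : plusProb β Λ' (plusOn T) ≤ plusProb β Λ (plusOn T) := by
  rw [plusProb, plusProb, div_le_div_iff₀ (dropSum_univ_pos _ _) (dropSum_univ_pos _ _),
    ← dropSum_inter_plusOn_sdiff β h (plusOn T), ← dropSum_inter_plusOn_sdiff β h Set.univ,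
    mul_comm (dropSum β Λ' (_ ∩ _))]
  refine dropSum_fkg hβ Λ' ?_
  rintro a ha b ⟨-, hb⟩
  refine ⟨trivial, fun z hz => ?_, fun z hz => ?_⟩
  · simp [ha z hz]
  · simp [hb z hz]

section Automorphisms

variable (e : ℤ × ℤ ≃ ℤ × ℤ)

theorem edgeCount_map (he : ∀ x y, e y ∈ nbrs (e x) ↔ y ∈ nbrs x) (A B : Finset (ℤ × ℤ)) :
    edgeCount (A.map e.toEmbedding) (B.map e.toEmbedding) = edgeCount A B := by
  simp only [edgeCount, adjInd, Finset.sum_map, Equiv.coe_toEmbedding, he]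

theorem bdry_map (he : ∀ x y, e y ∈ nbrs (e x) ↔ y ∈ nbrs x) (D : Finset (ℤ × ℤ)) :
    bdry (D.map e.toEmbedding) = bdry D := by
  rw [bdry, edgeCount_map e he, Finset.card_map, bdry]

theorem dropSum_map (he : ∀ x y, e y ∈ nbrs (e x) ↔ y ∈ nbrs x) (β : ℝ) (Λ : Finset (ℤ × ℤ))
    {E F : Set Cfg2} (hEF : ∀ D, cfg (D.map e.toEmbedding) ∈ F ↔ cfg D ∈ E) :
    dropSum β (Λ.map e.toEmbedding) F = dropSum β Λ E := by
  classical
  symm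
  have h1 : ∀ D : Finset (ℤ × ℤ), (D.map e.symm.toEmbedding).map e.toEmbedding = D := fun D => by
    ext z; simp
  refine Finset.sum_bij' (fun D _ => D.map e.toEmbedding) (fun D _ => D.map e.symm.toEmbedding)
    ?_ ?_ ?_ ?_ ?_
  · intro D hD
    simp only [Finset.mem_filter, Finset.mem_powerset] at hD ⊢
    exact ⟨Finset.map_subset_map.2 hD.1, (hEF D).2 hD.2⟩
  · intro D hD
    simp only [Finset.mem_filter, Finset.mem_powerset] at hD ⊢
    refine ⟨fun z hz => ?_, (hEF _).1 (by rw [h1]; exact hD.2)⟩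
    have h2 : e z ∈ D := by simpa using hz
    simpa using hD.1 h2
  · intro D _; ext z; simp
  · intro D _; exact h1 D
  · intro D _; rw [dropWt, dropWt, bdry_map e he]

theorem plusProb_map (he : ∀ x y, e y ∈ nbrs (e x) ↔ y ∈ nbrs x) (β : ℝ) (Λ : Finset (ℤ × ℤ))
    {E F : Set Cfg2} (hEF : ∀ D, cfg (D.map e.toEmbedding) ∈ F ↔ cfg D ∈ E) :
    plusProb β (Λ.map e.toEmbedding) F = plusProb β Λ E := by
  rw [plusProb, plusProb, dropSum_map e he β Λ hEF,
    dropSum_map e he β Λ (E := Set.univ) (F := Set.univ) fun _ => Iff.rfl]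

end Automorphisms

theorem addRight_mem_nbrs (v x y : ℤ × ℤ) :
    Equiv.addRight v y ∈ nbrs (Equiv.addRight v x) ↔ y ∈ nbrs x := by
  simp only [mem_nbrs, Equiv.coe_addRight, Prod.fst_add, Prod.snd_add]
  omega

theorem plusProb_translate_minusOn (β : ℝ) (Λ T : Finset (ℤ × ℤ)) (v : ℤ × ℤ) :
    plusProb β (Λ.map (Equiv.addRight v).toEmbedding)
      (minusOn (T.map (Equiv.addRight v).toEmbedding)) = plusProb β Λ (minusOn T) :=
  plusProb_map _ (addRight_mem_nbrs v) β Λ fun D => by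
    rw [cfg_mem_minusOn, cfg_mem_minusOn, Finset.map_subset_map]

theorem plusProb_translate_plusOn (β : ℝ) (Λ T : Finset (ℤ × ℤ)) (v : ℤ × ℤ) :
    plusProb β (Λ.map (Equiv.addRight v).toEmbedding)
      (plusOn (T.map (Equiv.addRight v).toEmbedding)) = plusProb β Λ (plusOn T) :=
  plusProb_map _ (addRight_mem_nbrs v) β Λ fun D => by
    rw [cfg_mem_plusOn, cfg_mem_plusOn, Finset.disjoint_map]

theorem bdry_erase_le (D : Finset (ℤ × ℤ)) {x : ℤ × ℤ} (hx : x ∈ D) :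
    bdry (D.erase x) ≤ bdry D + 4 := by
  have h := bdry_submodular (D.erase x) {x}
  have hd : Disjoint (D.erase x) {x} := by simp
  have h1 : bdry (D.erase x ∪ {x}) = bdry (D.erase x) + 4 - 2 * edgeCount {x} (D.erase x) := by
    rw [bdry, bdry, Finset.card_union_of_disjoint hd, edgeCount_union_left hd,
      edgeCount_union_right hd, edgeCount_union_right hd, edgeCount_self_singleton,
      edgeCount_comm (D.erase x) {x}]
    push_cast
    rw [Finset.card_singleton]
    push_cast
    ring
  have h2 : D.erase x ∪ {x} = D := by
    rw [Finset.union_comm]; exact Finset.insert_erase hx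
  rw [h2] at h1
  linarith [edgeCount_singleton_le x (D.erase x)]

theorem dropSum_inter_add_inter_compl (β : ℝ) (Λ : Finset (ℤ × ℤ)) (E F : Set Cfg2) :
    dropSum β Λ (E ∩ F) + dropSum β Λ (E ∩ Fᶜ) = dropSum β Λ E := by
  classical
  simp only [dropSum, Finset.sum_filter]
  rw [← Finset.sum_add_distrib]
  refine Finset.sum_congr rfl fun D _ => ?_
  by_cases h1 : cfg D ∈ E <;> by_cases h2 : cfg D ∈ F <;> simp [h1, h2]

theorem dropSum_le_mul_of_injOn {β c : ℝ} (hc : 0 ≤ c) {Λ : Finset (ℤ × ℤ)} {E F : Set Cfg2}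
    (f : Finset (ℤ × ℤ) → Finset (ℤ × ℤ)) (hf : ∀ D ⊆ Λ, cfg D ∈ E → f D ⊆ Λ ∧ cfg (f D) ∈ F)
    (hinj : ∀ D, cfg D ∈ E → ∀ D', cfg D' ∈ E → f D = f D' → D = D')
    (hw : ∀ D, cfg D ∈ E → dropWt β D ≤ c * dropWt β (f D)) :
    dropSum β Λ E ≤ c * dropSum β Λ F := by
  classical
  rw [dropSum, dropSum, Finset.mul_sum]
  calc _ ≤ ∑ D ∈ Λ.powerset with cfg D ∈ E, c * dropWt β (f D) :=
        Finset.sum_le_sum fun D hD => hw D (Finset.mem_filter.1 hD).2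
    _ = ∑ D ∈ (Λ.powerset.filter fun D => cfg D ∈ E).image f, c * dropWt β D := by
        rw [Finset.sum_image]
        intro D hD D' hD' h
        exact hinj D (Finset.mem_filter.1 hD).2 D' (Finset.mem_filter.1 hD').2 h
    _ ≤ _ := by
        refine Finset.sum_le_sum_of_subset_of_nonneg ?_ fun _ _ _ =>
          mul_nonneg hc (dropWt_pos _ _).le
        intro D' hD'
        obtain ⟨D, hD, rfl⟩ := Finset.mem_image.1 hD'
        rw [Finset.mem_filter, Finset.mem_powerset] at hD ⊢
        exact hf D hD.1 hD.2

/-- Finite energy: turning the spins in `X` to plus costs at most a constant factor. -/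
theorem dropSum_finite_energy {β : ℝ} (hβ : 0 ≤ β) (Λ X S : Finset (ℤ × ℤ)) (hXS : Disjoint X S) :
    dropSum β Λ (minusOn S) ≤
      (1 + Real.exp (8 * β)) ^ X.card * dropSum β Λ (plusOn X ∩ minusOn S) := by
  classical
  induction X using Finset.induction_on with
  | empty => simp [plusOn_empty]
  | insert x X hx ih =>
    rw [Finset.disjoint_insert_left] at hXS
    refine (ih hXS.2).trans ?_
    rw [Finset.card_insert_of_notMem hx, pow_succ, mul_assoc]
    refine mul_le_mul_of_nonneg_left ?_ (by positivity)
    have hsplit : dropSum β Λ (plusOn X ∩ minusOn S) =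
        dropSum β Λ (plusOn (insert x X) ∩ minusOn S) +
          dropSum β Λ (plusOn X ∩ minusOn S ∩ {η | η x = true}ᶜ) := by
      rw [← dropSum_inter_add_inter_compl β Λ _ {η | η x = true}]
      congr 2
      ext η
      simp only [plusOn, agreeSet, Set.mem_inter_iff, Set.mem_ofPred_eq, Finset.forall_mem_insert]
      tauto
    have hle : dropSum β Λ (plusOn X ∩ minusOn S ∩ {η | η x = true}ᶜ) ≤
        Real.exp (8 * β) * dropSum β Λ (plusOn (insert x X) ∩ minusOn S) := by
      have hmem : ∀ D, cfg D ∈ plusOn X ∩ minusOn S ∩ {η | η x = true}ᶜ → x ∈ D := fun D hD => by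
        have := hD.2
        simpa [cfg] using this
      refine dropSum_le_mul_of_injOn (Real.exp_pos _).le (fun D => D.erase x) ?_ ?_ ?_
      · intro D hD hD'
        have h1 := cfg_mem_plusOn.1 hD'.1.1
        have h2 := cfg_mem_minusOn.1 hD'.1.2
        refine ⟨(Finset.erase_subset _ _).trans hD, cfg_mem_plusOn.2 ?_,
          cfg_mem_minusOn.2 fun z hz => ?_⟩
        · rw [Finset.disjoint_insert_left]
          exact ⟨Finset.notMem_erase x D, h1.mono_right (Finset.erase_subset _ _)⟩
        · exact Finset.mem_erase.2 ⟨fun h => hXS.1 (h ▸ hz), h2 hz⟩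
      · intro D hD D' hD' h
        rw [← Finset.insert_erase (hmem D hD), ← Finset.insert_erase (hmem D' hD')]
        exact congrArg (insert x) h
      · intro D hD
        rw [dropWt, dropWt, ← Real.exp_add]
        refine Real.exp_le_exp.2 ?_
        nlinarith [mul_le_mul_of_nonneg_left (bdry_erase_le D (hmem D hD)) hβ]
    rw [hsplit]
    linarith

end DropletInequalities

section InfiniteVolume

/-- `E` depends only on the spins in `T`. -/
def DeterminedOn (T : Finset (ℤ × ℤ)) (E : Set Cfg2) : Prop :=
  ∀ η η' : Cfg2, (∀ z ∈ T, η z = η' z) → η ∈ E → η' ∈ E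

theorem measurableSet_agreeSet (T : Finset (ℤ × ℤ)) (ω : Cfg2) : MeasurableSet (agreeSet T ω) := by
  have : agreeSet T ω = ⋂ z ∈ T, (fun η : Cfg2 => η z) ⁻¹' {ω z} := by
    ext η; simp [agreeSet]
  rw [this]
  exact Finset.measurableSet_biInter T fun z _ => measurable_pi_apply z (measurableSet_singleton _)

theorem determinedOn_agreeSet (T : Finset (ℤ × ℤ)) (ω : Cfg2) : DeterminedOn T (agreeSet T ω) :=
  fun _ _ h hη z hz => (h z hz).symm.trans (hη z hz)

theorem DeterminedOn.inter {T T' : Finset (ℤ × ℤ)} {E F : Set Cfg2} (h : DeterminedOn T E)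
    (h' : DeterminedOn T' F) : DeterminedOn (T ∪ T') (E ∩ F) := fun η η' hη hE =>
  ⟨h η η' (fun z hz => hη z (Finset.mem_union_left _ hz)) hE.1,
    h' η η' (fun z hz => hη z (Finset.mem_union_right _ hz)) hE.2⟩

theorem DeterminedOn.eq_biUnion {T : Finset (ℤ × ℤ)} {E : Set Cfg2} (h : DeterminedOn T E)
    [DecidablePred fun D => cfg D ∈ E] :
    E = ⋃ D ∈ T.powerset.filter fun D => cfg D ∈ E, agreeSet T (cfg D) := by
  ext η
  simp only [Set.mem_iUnion, Finset.mem_filter, Finset.mem_powerset, exists_prop]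
  constructor
  · intro hη
    have h1 : ∀ z ∈ T, η z = cfg (T.filter fun z => η z = false) z := fun z hz => by
      by_cases h2 : η z = false
      · rw [h2, eq_comm, cfg_eq_false]; simp [hz, h2]
      · rw [cfg_eq_true.2 (by simp [h2])]; simpa using h2
    exact ⟨T.filter fun z => η z = false, ⟨Finset.filter_subset _ _, h _ _ h1 hη⟩, h1⟩
  · rintro ⟨D, ⟨-, hD⟩, hη⟩
    exact h _ _ (fun z hz => (hη z hz).symm) hD

theorem DeterminedOn.measurableSet {T : Finset (ℤ × ℤ)} {E : Set Cfg2} (h : DeterminedOn T E) :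
    MeasurableSet E := by
  classical
  rw [h.eq_biUnion]
  exact Finset.measurableSet_biUnion _ fun D _ => measurableSet_agreeSet _ _

theorem DeterminedOn.measure_eq {T : Finset (ℤ × ℤ)} {E : Set Cfg2} (h : DeterminedOn T E)
    [DecidablePred fun D => cfg D ∈ E] (μ : Measure Cfg2) :
    μ E = ∑ D ∈ T.powerset with cfg D ∈ E, μ (agreeSet T (cfg D)) := by
  conv_lhs => rw [h.eq_biUnion]
  refine measure_biUnion_finset (fun D hD D' hD' hne => ?_) fun D _ => measurableSet_agreeSet _ _
  simp only [Finset.coe_filter, Finset.mem_powerset] at hD hD'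
  refine Set.disjoint_left.2 fun η h1 h2 => hne ?_
  ext z
  by_cases hz : z ∈ T
  · have h3 := (h1 z hz).symm.trans (h2 z hz)
    rw [← not_iff_not, ← cfg_eq_true, ← cfg_eq_true, h3]
  · exact iff_of_false (fun h => hz (hD.1 h)) fun h => hz (hD'.1 h)

theorem CylTendsto.tendsto_determinedOn {μs : ℕ → Measure Cfg2} {μ : Measure Cfg2}
    (h : CylTendsto μs μ) {T : Finset (ℤ × ℤ)} {E : Set Cfg2} (hE : DeterminedOn T E) :
    Tendsto (fun n => μs n E) atTop (𝓝 (μ E)) := by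
  classical
  simp only [hE.measure_eq]
  exact tendsto_finsetSum _ fun D _ => h T (cfg D)

theorem IsPlusPhase.tendsto {β : ℝ} {μ : Measure Cfg2} (h : IsPlusPhase β 0 μ)
    {T : Finset (ℤ × ℤ)} {E : Set Cfg2} (hE : DeterminedOn T E) :
    Tendsto (fun n => plusProb β (box n) E) atTop (𝓝 (μ.real E)) := by
  have := h.1
  have h1 := h.2.tendsto_determinedOn hE
  simp only [isingFV_apply β _ hE.measurableSet] at h1
  have h2 := (ENNReal.tendsto_toReal (measure_ne_top μ E)).comp h1
  refine h2.congr fun n => ?_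
  exact ENNReal.toReal_ofReal (div_nonneg (dropSum_nonneg _ _ _) (dropSum_nonneg _ _ _))

theorem IsPlusPhase.fkg {β : ℝ} (hβ : 0 ≤ β) {μ : Measure Cfg2} (h : IsPlusPhase β 0 μ)
    {T₁ T₂ T₃ T₄ : Finset (ℤ × ℤ)} {A B C D : Set Cfg2} (hA : DeterminedOn T₁ A)
    (hB : DeterminedOn T₂ B) (hC : DeterminedOn T₃ C) (hD : DeterminedOn T₄ D)
    (hABCD : ∀ a ∈ A, ∀ b ∈ B, a ⊓ b ∈ C ∧ a ⊔ b ∈ D) :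
    μ.real A * μ.real B ≤ μ.real C * μ.real D :=
  le_of_tendsto_of_tendsto' ((h.tendsto hA).mul (h.tendsto hB)) ((h.tendsto hC).mul (h.tendsto hD))
    fun _ => plusProb_fkg hβ _ hABCD

/-- The sites `(i, 0)` with `a ≤ i < b`. -/
noncomputable def seg (a b : ℤ) : Finset (ℤ × ℤ) := Finset.Ico a b ×ˢ {0}

theorem mem_seg {a b : ℤ} {z : ℤ × ℤ} : z ∈ seg a b ↔ a ≤ z.1 ∧ z.1 < b ∧ z.2 = 0 := by
  simp only [seg, Finset.mem_product, Finset.mem_Ico, Finset.mem_singleton, and_assoc]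

theorem card_seg (a : ℤ) (k : ℕ) : (seg a (a + k)).card = k := by
  rw [seg, Finset.card_product, Int.card_Ico, Finset.card_singleton]
  simp

theorem seg_translate (a b v : ℤ) :
    (seg a b).map (Equiv.addRight (v, (0 : ℤ))).toEmbedding = seg (a + v) (b + v) := by
  ext z
  rw [Finset.mem_map_equiv]
  simp only [mem_seg, Equiv.addRight_symm, Equiv.coe_addRight, Prod.fst_add, Prod.snd_add,
    Prod.neg_mk, neg_zero, add_zero]
  omega

theorem lineMinusEvt_eq (m : ℕ) : lineMinusEvt 1 m = minusOn (seg (-m) 0) := by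
  ext η
  simp only [lineMinusEvt, minusOn, agreeSet, Set.mem_ofPred_eq, mem_seg]
  constructor
  · rintro h ⟨i, j⟩ ⟨h1, h2, rfl⟩
    exact h i h1 (by push_cast; omega)
  · intro h i h1 h2
    exact h (i, 0) ⟨h1, by push_cast at h2; omega, rfl⟩

theorem box_translate_subset (n : ℕ) (v : ℤ) :
    (box n).map (Equiv.addRight (v, (0 : ℤ))).toEmbedding ⊆ box (n + v.natAbs) := by
  intro z hz
  rw [Finset.mem_map_equiv] at hz
  simp only [box, Finset.mem_product, Finset.mem_Icc, Equiv.addRight_symm, Equiv.coe_addRight,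
    Prod.fst_add, Prod.snd_add, Prod.neg_mk] at hz ⊢
  rw [Nat.cast_add]
  omega

theorem real_minusOn_seg_le {β : ℝ} (hβ : 0 ≤ β) {μ : Measure Cfg2} (h : IsPlusPhase β 0 μ)
    (a b v : ℤ) : μ.real (minusOn (seg a b)) ≤ μ.real (minusOn (seg (a + v) (b + v))) := by
  refine le_of_tendsto_of_tendsto' (h.tendsto (determinedOn_agreeSet _ _))
    (((h.tendsto (determinedOn_agreeSet _ _))).comp (tendsto_add_atTop_nat v.natAbs)) fun n => ?_
  rw [← seg_translate]
  refine (plusProb_translate_minusOn β (box n) (seg a b) (v, 0)).ge.trans ?_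
  exact plusProb_minusOn_mono hβ (box_translate_subset n v) _

theorem real_plusOn_seg_ge {β : ℝ} (hβ : 0 ≤ β) {μ : Measure Cfg2} (h : IsPlusPhase β 0 μ)
    (a b v : ℤ) : μ.real (plusOn (seg (a + v) (b + v))) ≤ μ.real (plusOn (seg a b)) := by
  refine le_of_tendsto_of_tendsto' (((h.tendsto (determinedOn_agreeSet _ _))).comp
    (tendsto_add_atTop_nat v.natAbs)) (h.tendsto (determinedOn_agreeSet _ _)) fun n => ?_
  rw [← seg_translate]
  refine le_trans ?_ (plusProb_translate_plusOn β (box n) (seg a b) (v, 0)).le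
  exact plusProb_plusOn_anti hβ (box_translate_subset n v) _

theorem real_minusOn_seg {β : ℝ} (hβ : 0 ≤ β) {μ : Measure Cfg2} (h : IsPlusPhase β 0 μ)
    (a : ℤ) (k : ℕ) : μ.real (minusOn (seg a (a + k))) = μ.real (minusOn (seg 0 k)) := by
  refine le_antisymm ?_ ?_
  · have := real_minusOn_seg_le hβ h a (a + k) (-a)
    simpa using this
  · have := real_minusOn_seg_le hβ h 0 k a
    simpa [add_comm] using this

theorem real_plusOn_seg {β : ℝ} (hβ : 0 ≤ β) {μ : Measure Cfg2} (h : IsPlusPhase β 0 μ)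
    (a : ℤ) (k : ℕ) : μ.real (plusOn (seg a (a + k))) = μ.real (plusOn (seg 0 k)) := by
  refine le_antisymm ?_ ?_
  · have := real_plusOn_seg_ge hβ h 0 k a
    simpa [add_comm] using this
  · have := real_plusOn_seg_ge hβ h a (a + k) (-a)
    simpa using this

theorem real_minusOn_pos {β : ℝ} (hβ : 0 ≤ β) {μ : Measure Cfg2} (h : IsPlusPhase β 0 μ)
    {T : Finset (ℤ × ℤ)} {n : ℕ} (hT : T ⊆ box n) : 0 < μ.real (minusOn T) := by
  have h1 : 0 < plusProb β (box n) (minusOn T) :=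
    div_pos (dropSum_agreeSet_pos β hT _) (dropSum_univ_pos _ _)
  refine h1.trans_le (ge_of_tendsto (h.tendsto (determinedOn_agreeSet _ _)) ?_)
  filter_upwards [eventually_ge_atTop n] with k hk
  exact plusProb_minusOn_mono hβ (box_mono hk) _

theorem seg_subset_box {a b : ℤ} {n : ℕ} (ha : -(n : ℤ) ≤ a) (hb : b ≤ n) : seg a b ⊆ box n := by
  intro z hz
  rw [mem_seg] at hz
  simp only [box, Finset.mem_product, Finset.mem_Icc]
  omega

/-- Positive, nonincreasing, log-convex sequences starting from one. -/
structure IsLogConvexDecay (b : ℕ → ℝ) : Prop where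
  zero : b 0 = 1
  pos : ∀ k, 0 < b k
  anti : ∀ k, b (k + 1) ≤ b k
  logConvex : ∀ k, b (k + 1) * b (k + 1) ≤ b k * b (k + 2)

theorem IsLogConvexDecay.exists_rate {b : ℕ → ℝ} (h : IsLogConvexDecay b) :
    ∃ p : ℝ, 0 < p ∧ p ≤ 1 ∧ Tendsto (fun k => b (k + 1) / b k) atTop (𝓝 p) ∧
      (∀ k j, b (k + j) ≤ p ^ j * b k) ∧ ∀ q, 0 < q → q < p → ∃ c, 0 < c ∧ ∀ N, c * q ^ N ≤ b N := by
  set ρ : ℕ → ℝ := fun k => b (k + 1) / b k with hρ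
  have hmono : Monotone ρ := monotone_nat_of_le_succ fun k => by
    simp only [hρ]
    rw [div_le_div_iff₀ (h.pos _) (h.pos _), mul_comm (b (k + 1 + 1))]
    exact h.logConvex k
  have hle1 : ∀ k, ρ k ≤ 1 := fun k => (div_le_one (h.pos k)).2 (h.anti k)
  have hbdd : BddAbove (Set.range ρ) := ⟨1, by rintro _ ⟨k, rfl⟩; exact hle1 k⟩
  have hlim := tendsto_atTop_ciSup hmono hbdd
  set p := ⨆ k, ρ k with hp
  have hρp : ∀ k, ρ k ≤ p := fun k => le_ciSup hbdd k
  have hppos : 0 < p := (div_pos (h.pos 1) (h.pos 0)).trans_le (hρp 0)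
  have hp1 : p ≤ 1 := ciSup_le hle1
  refine ⟨p, hppos, hp1, hlim, fun k j => ?_, fun q hq hqp => ?_⟩
  · induction j with
    | zero => simp
    | succ j ih =>
      have h1 := hρp (k + j)
      simp only [hρ] at h1
      rw [div_le_iff₀ (h.pos _)] at h1
      rw [pow_succ, ← add_assoc]
      calc b (k + j + 1) ≤ p * b (k + j) := h1
        _ ≤ p * (p ^ j * b k) := mul_le_mul_of_nonneg_left ih hppos.le
        _ = p ^ j * p * b k := by ring
  · obtain ⟨K, hK⟩ := exists_lt_of_lt_ciSup hqp
    have hanti : Antitone b := antitone_nat_of_succ_le h.anti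
    have h1 : ∀ j, q ^ j * b K ≤ b (K + j) := fun j => by
      induction j with
      | zero => simp
      | succ j ih =>
        have h2 := hK.le.trans (hmono (Nat.le_add_right K j))
        simp only [hρ] at h2
        rw [le_div_iff₀ (h.pos _)] at h2
        calc q ^ (j + 1) * b K = q * (q ^ j * b K) := by ring
          _ ≤ q * b (K + j) := mul_le_mul_of_nonneg_left ih hq.le
          _ ≤ b (K + (j + 1)) := h2
    refine ⟨b K, h.pos K, fun N => ?_⟩
    have hq1 : q ≤ 1 := hqp.le.trans hp1
    rcases le_total K N with hKN | hKN
    · obtain ⟨j, rfl⟩ := Nat.exists_eq_add_of_le hKN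
      refine le_trans ?_ (h1 j)
      rw [mul_comm]
      exact mul_le_mul_of_nonneg_right (pow_le_pow_of_le_one hq.le hq1 (Nat.le_add_left j K))
        (h.pos K).le
    · calc b K * q ^ N ≤ b K * 1 := mul_le_mul_of_nonneg_left (pow_le_one₀ hq.le hq1) (h.pos K).le
        _ ≤ b N := by rw [mul_one]; exact hanti hKN

theorem isLogConvexDecay_minusOn {β : ℝ} (hβ : 0 ≤ β) {μ : Measure Cfg2} (h : IsPlusPhase β 0 μ) :
    IsLogConvexDecay fun k : ℕ => μ.real (minusOn (seg 0 k)) where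
  zero := by
    have := h.1
    have : minusOn (seg 0 ((0 : ℕ) : ℤ)) = Set.univ := by ext; simp [minusOn, agreeSet, seg]
    rw [this, probReal_univ]
  pos k := real_minusOn_pos hβ h (n := k) (seg_subset_box (by omega) le_rfl)
  anti k := by
    have := h.1
    refine measureReal_mono fun η hη z hz => hη z ?_
    rw [mem_seg] at hz ⊢
    push_cast
    omega
  logConvex k := by
    have e1 : μ.real (minusOn (seg 1 (1 + (k + 1 : ℕ)))) = _ := real_minusOn_seg hβ h 1 (k + 1)
    have e2 : μ.real (minusOn (seg 1 (1 + (k : ℕ)))) = _ := real_minusOn_seg hβ h 1 k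
    have key : μ.real (minusOn (seg 0 (k + 1 : ℕ))) * μ.real (minusOn (seg 1 (1 + (k + 1 : ℕ)))) ≤
        μ.real (minusOn (seg 0 (k + 2 : ℕ))) * μ.real (minusOn (seg 1 (1 + (k : ℕ)))) := by
      refine h.fkg hβ (determinedOn_agreeSet _ _) (determinedOn_agreeSet _ _)
        (determinedOn_agreeSet _ _) (determinedOn_agreeSet _ _) fun a ha b hb => ⟨?_, ?_⟩
      · intro z hz
        rw [mem_seg] at hz
        push_cast at hz
        by_cases h0 : z.1 = 0
        · have := ha z (mem_seg.2 (by push_cast; omega))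
          simp [this]
        · have := hb z (mem_seg.2 (by push_cast; omega))
          simp [this]
      · intro z hz
        rw [mem_seg] at hz
        have h1 := ha z (mem_seg.2 (by push_cast; omega))
        have h2 := hb z (mem_seg.2 (by push_cast; omega))
        simp [h1, h2]
    rw [e1, e2] at key
    linarith

theorem real_plusOn_seg_ge_exp {β : ℝ} {μ : Measure Cfg2} (h : IsPlusPhase β 0 μ) {κ : ℝ}
    (hκ : ∀ (L : ℕ) (S : Finset (ℤ × ℤ)), S ⊆ box L → (∀ z ∈ S, z.2 = 0) →
      Real.exp (κ * S.card) * plusProb β (box L) (minusOn S) ≤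
        plusProb β (box L) (plusOn S)) (k : ℕ) :
    Real.exp (κ * k) * μ.real (minusOn (seg 0 k)) ≤ μ.real (plusOn (seg 0 k)) := by
  refine le_of_tendsto_of_tendsto ((h.tendsto (determinedOn_agreeSet _ _)).const_mul _)
    (h.tendsto (determinedOn_agreeSet _ _)) ?_
  filter_upwards [eventually_ge_atTop k] with n hn
  have h1 := hκ n (seg 0 k) (seg_subset_box (by omega) (by omega)) fun z hz => (mem_seg.1 hz).2.2
  have h2 : (seg 0 (k : ℤ)).card = k := by simpa using card_seg 0 k
  rwa [h2] at h1

theorem isLogConvexDecay_plusOn {β : ℝ} (hβ : 0 ≤ β) {μ : Measure Cfg2} (h : IsPlusPhase β 0 μ)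
    (hpos : ∀ k : ℕ, 0 < μ.real (plusOn (seg 0 k))) :
    IsLogConvexDecay fun k : ℕ => μ.real (plusOn (seg 0 k)) where
  zero := by
    have := h.1
    have : plusOn (seg 0 ((0 : ℕ) : ℤ)) = Set.univ := by ext; simp [plusOn, agreeSet, seg]
    rw [this, probReal_univ]
  pos := hpos
  anti k := by
    have := h.1
    refine measureReal_mono fun η hη z hz => hη z ?_
    rw [mem_seg] at hz ⊢
    push_cast
    omega
  logConvex k := by
    have e1 : μ.real (plusOn (seg 1 (1 + (k + 1 : ℕ)))) = _ := real_plusOn_seg hβ h 1 (k + 1)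
    have e2 : μ.real (plusOn (seg 1 (1 + (k : ℕ)))) = _ := real_plusOn_seg hβ h 1 k
    have key : μ.real (plusOn (seg 0 (k + 1 : ℕ))) * μ.real (plusOn (seg 1 (1 + (k + 1 : ℕ)))) ≤
        μ.real (plusOn (seg 1 (1 + (k : ℕ)))) * μ.real (plusOn (seg 0 (k + 2 : ℕ))) := by
      refine h.fkg hβ (determinedOn_agreeSet _ _) (determinedOn_agreeSet _ _)
        (determinedOn_agreeSet _ _) (determinedOn_agreeSet _ _) fun a ha b hb => ⟨?_, ?_⟩
      · intro z hz
        rw [mem_seg] at hz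
        have h1 := ha z (mem_seg.2 (by push_cast; omega))
        have h2 := hb z (mem_seg.2 (by push_cast; omega))
        simp [h1, h2]
      · intro z hz
        rw [mem_seg] at hz
        push_cast at hz
        by_cases h0 : z.1 = 0
        · have := ha z (mem_seg.2 (by push_cast; omega))
          simp [this]
        · have := hb z (mem_seg.2 (by push_cast; omega))
          simp [this]
    rw [e1, e2] at key
    exact key

/-- The decay rate of rows of plus spins is strictly larger than that of rows of minus spins. -/
theorem exists_rates {β : ℝ} (hβ : betaCrit < β) {μ : Measure Cfg2} (h : IsPlusPhase β 0 μ) :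
    ∃ p p' : ℝ, 0 < p ∧ p < p' ∧ p' ≤ 1 ∧
      Tendsto (fun k : ℕ => μ.real (minusOn (seg 0 (k + 1 : ℕ))) / μ.real (minusOn (seg 0 k))) atTop
        (𝓝 p) ∧
      Tendsto (fun k : ℕ => μ.real (plusOn (seg 0 (k + 1 : ℕ))) / μ.real (plusOn (seg 0 k))) atTop
        (𝓝 p') ∧
      (∀ k j : ℕ, μ.real (minusOn (seg 0 (k + j : ℕ))) ≤ p ^ j * μ.real (minusOn (seg 0 k))) ∧
      ∀ q, 0 < q → q < p → ∃ c, 0 < c ∧ ∀ N : ℕ, c * q ^ N ≤ μ.real (minusOn (seg 0 N)) := by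
  have hβ0 : 0 ≤ β := (betaCrit_pos.trans hβ).le
  obtain ⟨κ, hκ, hst⟩ := exists_surface_tension hβ
  have hge := real_plusOn_seg_ge_exp h hst
  have hm := isLogConvexDecay_minusOn hβ0 h
  have hp := isLogConvexDecay_plusOn hβ0 h fun k =>
    (mul_pos (Real.exp_pos _) (hm.pos k)).trans_le (hge k)
  obtain ⟨p, hp0, -, hlim, hle, hlow⟩ := hm.exists_rate
  obtain ⟨p', hp0', hp1', hlim', hle', -⟩ := hp.exists_rate
  refine ⟨p, p', hp0, ?_, hp1', hlim, hlim', hle, hlow⟩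
  have hexp : 1 < Real.exp (κ / 2) := Real.one_lt_exp_iff.2 (by linarith)
  have hq0 : 0 < p * Real.exp (-(κ / 2)) := mul_pos hp0 (Real.exp_pos _)
  obtain ⟨c, hc, hcq⟩ := hlow (p * Real.exp (-(κ / 2))) hq0
    (mul_lt_of_lt_one_right hp0 (Real.exp_lt_one_iff.2 (by linarith)))
  by_contra hcon
  push Not at hcon
  have h1 : ∀ N : ℕ, c * Real.exp (κ / 2) ^ N ≤ 1 := fun N => by
    have h2 := hle' 0 N
    simp only [hp.zero, zero_add, mul_one] at h2
    have h3 := (mul_le_mul_of_nonneg_left (hcq N) (Real.exp_pos (κ * N)).le).trans (hge N)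
    have h4 : Real.exp (κ * N) * (c * (p * Real.exp (-(κ / 2))) ^ N) =
        c * Real.exp (κ / 2) ^ N * p ^ N := by
      rw [mul_pow, ← Real.exp_nat_mul, ← Real.exp_nat_mul]
      have : Real.exp (κ * N) = Real.exp (N * (κ / 2)) * Real.exp (N * (κ / 2)) := by
        rw [← Real.exp_add]; congr 1; ring
      rw [this, show (N : ℝ) * -(κ / 2) = -(N * (κ / 2)) by ring, Real.exp_neg]
      field_simp
    rw [h4] at h3
    have h5 : p' ^ N ≤ p ^ N := pow_le_pow_left₀ hp0'.le hcon N
    have h6 : 0 < p ^ N := pow_pos hp0 N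
    exact le_of_mul_le_mul_right (by linarith) h6
  obtain ⟨N, hN⟩ := pow_unbounded_of_one_lt (1 / c) hexp
  have := h1 N
  rw [div_lt_iff₀ hc] at hN
  linarith

end InfiniteVolume

section ReflectionComparison

theorem bdry_union {A B : Finset (ℤ × ℤ)} (h : Disjoint A B) :
    bdry (A ∪ B) = bdry A + bdry B - 2 * edgeCount A B := by
  unfold bdry
  rw [edgeCount_union_left h, edgeCount_union_right h, edgeCount_union_right h,
    edgeCount_comm B A, Finset.card_union_of_disjoint h]
  push_cast
  ring

variable (e : ℤ × ℤ ≃ ℤ × ℤ)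

theorem mem_map_involutive (hinv : ∀ x, e (e x) = x) {A : Finset (ℤ × ℤ)} {z : ℤ × ℤ} :
    z ∈ A.map e.toEmbedding ↔ e z ∈ A := by
  rw [Finset.mem_map_equiv, e.symm_apply_eq.2 (hinv z).symm]

theorem bdry_union_sdiff_map (he : ∀ x y, e y ∈ nbrs (e x) ↔ y ∈ nbrs x)
    {ζ Δ a : Finset (ℤ × ℤ)} (hζ : Disjoint ζ Δ) (hΔ : Δ.map e.toEmbedding = Δ) (ha : a ⊆ Δ) :
    bdry (ζ ∪ (Δ \ a.map e.toEmbedding)) = bdry (ζ ∪ a) + (bdry Δ - 2 * edgeCount ζ Δ) +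
      (-8 * a.card + 2 * edgeCount a Δ + 2 * edgeCount ζ (a.map e.toEmbedding) +
        2 * edgeCount ζ a) := by
  have hr : a.map e.toEmbedding ⊆ Δ := by
    rw [← hΔ]; exact Finset.map_subset_map.2 ha
  set r := a.map e.toEmbedding with hrdef
  have hd : Disjoint (Δ \ r) r := Finset.sdiff_disjoint
  have hu : Δ \ r ∪ r = Δ := Finset.sdiff_union_of_subset hr
  have h1 := bdry_union hd
  have h2 := edgeCount_union_right hd ζ
  have h3 := edgeCount_union_left hd r
  rw [hu] at h1 h2 h3
  have h4 : edgeCount Δ r = edgeCount a Δ := by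
    conv_lhs => rw [← hΔ]
    rw [hrdef, edgeCount_map e he, edgeCount_comm]
  have h5 : bdry r = bdry a := bdry_map e he a
  have h6 : edgeCount r r = edgeCount a a := edgeCount_map e he a a
  rw [bdry_union (hζ.mono_right Finset.sdiff_subset), bdry_union (hζ.mono_right ha)]
  have h7 : bdry a = 4 * a.card - edgeCount a a := rfl
  linarith

theorem sum_nonneg_of_shielded (he : ∀ x y, e y ∈ nbrs (e x) ↔ y ∈ nbrs x)
    (hinv : ∀ x, e (e x) = x) {ζ Δ a : Finset (ℤ × ℤ)}
    (hbc : ∀ u ∈ Δ, ∀ y ∈ nbrs u, y ∈ Δ ∨ y ∈ ζ ∨ e y ∈ ζ) (ha : a ⊆ Δ) :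
    4 * (a.card : ℝ) ≤ edgeCount a Δ + edgeCount ζ (a.map e.toEmbedding) + edgeCount ζ a := by
  have h1 : edgeCount ζ (a.map e.toEmbedding) = edgeCount a (ζ.map e.toEmbedding) := by
    rw [edgeCount_comm, ← edgeCount_map e he, Finset.map_map]
    congr 1
    ext z
    simp [hinv]
  rw [h1, edgeCount_comm ζ a]
  simp only [edgeCount, ← Finset.sum_add_distrib]
  have : 4 * (a.card : ℝ) = ∑ _x ∈ a, (4 : ℝ) := by simp [mul_comm]
  rw [this]
  refine Finset.sum_le_sum fun x hx => ?_
  have h2 : ∀ T : Finset (ℤ × ℤ), ∑ y ∈ T, adjInd x y = ∑ y ∈ nbrs x, if y ∈ T then 1 else 0 :=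
    fun T => by
      simp only [adjInd, Finset.sum_ite_mem, Finset.inter_comm]
  simp only [h2, ← Finset.sum_add_distrib]
  have h3 : (4 : ℝ) = ∑ _y ∈ nbrs x, (1 : ℝ) := by simp [card_nbrs]
  rw [h3]
  refine Finset.sum_le_sum fun y hy => ?_
  have h4 := hbc x (ha hx) y hy
  rw [← mem_map_involutive e hinv] at h4
  by_cases h5 : y ∈ Δ <;> by_cases h6 : y ∈ ζ <;> by_cases h7 : y ∈ ζ.map e.toEmbedding <;>
    simp only [h5, h6, h7, if_true, if_false, or_self] at h4 ⊢ <;> norm_num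

theorem shielded_inter_le (he : ∀ x y, e y ∈ nbrs (e x) ↔ y ∈ nbrs x)
    (hinv : ∀ x, e (e x) = x) {ζ Δ a b : Finset (ℤ × ℤ)}
    (hbc : ∀ u ∈ Δ, ∀ y ∈ nbrs u, y ∈ Δ ∨ y ∈ ζ ∨ e y ∈ ζ) (ha : a ⊆ Δ) :
    edgeCount (a ∩ b) Δ + edgeCount ζ ((a ∩ b).map e.toEmbedding) + edgeCount ζ (a ∩ b) -
        4 * ((a ∩ b).card : ℝ) ≤
      edgeCount a Δ + edgeCount ζ (a.map e.toEmbedding) + edgeCount ζ a - 4 * (a.card : ℝ) := by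
  have hd : Disjoint (a \ b) (a ∩ b) := Finset.disjoint_sdiff_inter a b
  have hu : a \ b ∪ a ∩ b = a := Finset.sdiff_union_inter a b
  have hd' := (Finset.disjoint_map e.toEmbedding).2 hd
  have h0 := sum_nonneg_of_shielded e he hinv hbc (Finset.sdiff_subset.trans ha : a \ b ⊆ Δ)
  have h1 := edgeCount_union_left hd Δ
  have h2 := edgeCount_union_right hd' ζ
  have h3 := edgeCount_union_right hd ζ
  have h4 := Finset.card_union_of_disjoint hd
  rw [← Finset.map_union] at h2
  rw [hu] at h1 h2 h3 h4
  rw [h4]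
  push_cast
  linarith

theorem reflected_holley {β : ℝ} (hβ : 0 ≤ β) (he : ∀ x y, e y ∈ nbrs (e x) ↔ y ∈ nbrs x)
    (hinv : ∀ x, e (e x) = x) {ζ Δ a b : Finset (ℤ × ℤ)} (hζ : Disjoint ζ Δ)
    (hΔ : Δ.map e.toEmbedding = Δ)
    (hbc : ∀ u ∈ Δ, ∀ y ∈ nbrs u, y ∈ Δ ∨ y ∈ ζ ∨ e y ∈ ζ) (ha : a ⊆ Δ) :
    dropWt β (ζ ∪ (Δ \ a.map e.toEmbedding)) * dropWt β (ζ ∪ b) ≤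
      dropWt β (ζ ∪ (Δ \ (a ∩ b).map e.toEmbedding)) * dropWt β (ζ ∪ (a ∪ b)) := by
  have h1 := bdry_union_sdiff_map e he hζ hΔ ha
  have h2 := bdry_union_sdiff_map e he hζ hΔ (Finset.inter_subset_left.trans ha : a ∩ b ⊆ Δ)
  have h3 := shielded_inter_le e he hinv hbc ha (b := b)
  have h4 := bdry_submodular (ζ ∪ a) (ζ ∪ b)
  rw [← Finset.union_inter_distrib_left, ← Finset.union_union_distrib_left] at h4
  simp only [dropWt, ← Real.exp_add]
  refine Real.exp_le_exp.2 ?_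
  have h5 : bdry (ζ ∪ (Δ \ (a ∩ b).map e.toEmbedding)) + bdry (ζ ∪ (a ∪ b)) ≤
      bdry (ζ ∪ (Δ \ a.map e.toEmbedding)) + bdry (ζ ∪ b) := by linarith
  nlinarith [mul_le_mul_of_nonneg_left h5 hβ]

/-- Inside a reflection-invariant region whose boundary condition is dominated by its reflected
spin flip, an all-plus invariant set is at most as likely as an all-minus one. -/
theorem sum_disjoint_le_sum_subset {β : ℝ} (hβ : 0 ≤ β)
    (he : ∀ x y, e y ∈ nbrs (e x) ↔ y ∈ nbrs x) (hinv : ∀ x, e (e x) = x)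
    {ζ Δ W : Finset (ℤ × ℤ)} (hζ : Disjoint ζ Δ) (hΔ : Δ.map e.toEmbedding = Δ)
    (hbc : ∀ u ∈ Δ, ∀ y ∈ nbrs u, y ∈ Δ ∨ y ∈ ζ ∨ e y ∈ ζ) (hW : W.map e.toEmbedding = W)
    (hWΔ : W ⊆ Δ) :
    ∑ τ ∈ Δ.powerset with Disjoint W τ, dropWt β (ζ ∪ τ) ≤
      ∑ τ ∈ Δ.powerset with W ⊆ τ, dropWt β (ζ ∪ τ) := by
  set w : Finset (ℤ × ℤ) → ℝ := fun τ => dropWt β (ζ ∪ τ) with hw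
  set θ : Finset (ℤ × ℤ) → Finset (ℤ × ℤ) := fun τ => Δ \ τ.map e.toEmbedding with hθ
  have hwpos : ∀ τ, 0 < w τ := fun τ => dropWt_pos _ _
  have hθmem : ∀ τ z, z ∈ θ τ ↔ z ∈ Δ ∧ e z ∉ τ := fun τ z => by
    rw [hθ, Finset.mem_sdiff, mem_map_involutive e hinv]
  have hΔmem : ∀ z, e z ∈ Δ ↔ z ∈ Δ := fun z => by rw [← mem_map_involutive e hinv, hΔ]
  have hWmem : ∀ z, e z ∈ W ↔ z ∈ W := fun z => by rw [← mem_map_involutive e hinv, hW]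
  have hθsub : ∀ τ, θ τ ⊆ Δ := fun τ => Finset.sdiff_subset
  have hθθ : ∀ τ ⊆ Δ, θ (θ τ) = τ := fun τ hτ => by
    ext z
    rw [hθmem, hθmem, hinv, hΔmem]
    have := @hτ z
    tauto
  have hsum : ∀ (P P' : Finset (ℤ × ℤ) → Prop) [DecidablePred P] [DecidablePred P'],
      (∀ τ ⊆ Δ, P τ → P' (θ τ)) → (∀ τ ⊆ Δ, P' τ → P (θ τ)) →
      ∑ τ ∈ Δ.powerset with P τ, w (θ τ) = ∑ τ ∈ Δ.powerset with P' τ, w τ := by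
    intro P P' _ _ h h'
    refine Finset.sum_nbij' θ θ ?_ ?_ ?_ ?_ fun _ _ => rfl
    · intro τ hτ
      rw [Finset.mem_filter, Finset.mem_powerset] at hτ ⊢
      exact ⟨hθsub _, h τ hτ.1 hτ.2⟩
    · intro τ hτ
      rw [Finset.mem_filter, Finset.mem_powerset] at hτ ⊢
      exact ⟨hθsub _, h' τ hτ.1 hτ.2⟩
    · intro τ hτ
      rw [Finset.mem_filter, Finset.mem_powerset] at hτ
      exact hθθ τ hτ.1
    · intro τ hτ
      rw [Finset.mem_filter, Finset.mem_powerset] at hτ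
      exact hθθ τ hτ.1
  have e1 : ∑ τ ∈ Δ.powerset with W ⊆ τ, w (θ τ) = ∑ τ ∈ Δ.powerset with Disjoint W τ, w τ := by
    refine hsum _ _ (fun τ _ h => Finset.disjoint_left.2 fun z hz hz' => ?_)
      fun τ _ h z hz => (hθmem _ _).2 ⟨hWΔ hz, Finset.disjoint_left.1 h ((hWmem z).2 hz)⟩
    exact ((hθmem _ _).1 hz').2 (h ((hWmem z).2 hz))
  have e2 : ∑ τ ∈ Δ.powerset, w (θ τ) = ∑ τ ∈ Δ.powerset, w τ := by
    simpa using hsum (fun _ => True) (fun _ => True) (fun _ _ _ => trivial) fun _ _ _ => trivial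
  have hff := Finset.four_functions_theorem Δ (f₁ := fun τ => w (θ τ)) (f₂ := w)
    (f₃ := fun τ => w (θ τ)) (f₄ := w) (fun _ => (hwpos _).le) (fun _ => (hwpos _).le)
    (fun _ => (hwpos _).le) (fun _ => (hwpos _).le)
    (fun s hs t _ => reflected_holley e hβ he hinv hζ hΔ hbc hs)
    (Finset.filter_subset (fun τ => W ⊆ τ) Δ.powerset) (subset_refl Δ.powerset)
  rw [e1] at hff
  have hnn : ∀ T : Finset (Finset (ℤ × ℤ)), 0 ≤ ∑ D ∈ T, w D := fun T =>
    Finset.sum_nonneg fun _ _ => (hwpos _).le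
  have hpos : 0 < ∑ τ ∈ Δ.powerset, w τ :=
    Finset.sum_pos (fun _ _ => hwpos _) ⟨∅, by simp⟩
  refine le_of_mul_le_mul_right (hff.trans ?_) hpos
  rw [mul_comm]
  refine mul_le_mul ?_ ?_ (Finset.sum_nonneg fun _ _ => (hwpos _).le) (hnn _)
  · refine Finset.sum_le_sum_of_subset_of_nonneg (fun T hT => ?_) fun _ _ _ => (hwpos _).le
    obtain ⟨S, hS, S', hS', rfl⟩ := Finset.mem_sups.1 hT
    rw [Finset.mem_filter, Finset.mem_powerset] at hS
    rw [Finset.mem_powerset] at hS'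
    rw [Finset.mem_filter, Finset.mem_powerset, Finset.sup_eq_union]
    exact ⟨Finset.union_subset hS.1 hS', hS.2.trans Finset.subset_union_left⟩
  · rw [← e2]
    refine Finset.sum_le_sum_of_subset_of_nonneg (fun T hT => ?_) fun _ _ _ => (hwpos _).le
    obtain ⟨S, hS, S', hS', rfl⟩ := Finset.mem_infs.1 hT
    rw [Finset.mem_filter, Finset.mem_powerset] at hS
    rw [Finset.mem_powerset, Finset.inf_eq_inter]
    exact Finset.inter_subset_left.trans hS.1

end ReflectionComparison

section ReflectionComparisonConditioned

theorem sum_filter_mul_sum_filter_le {Δ : Finset (ℤ × ℤ)} {w : Finset (ℤ × ℤ) → ℝ}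
    (hw : ∀ τ, 0 < w τ) (hsuper : ∀ s t, w s * w t ≤ w (s ∩ t) * w (s ∪ t))
    {P₁ P₂ P₃ P₄ : Finset (ℤ × ℤ) → Prop} [DecidablePred P₁] [DecidablePred P₂] [DecidablePred P₃]
    [DecidablePred P₄] (h : ∀ s t, P₁ s → P₂ t → P₃ (s ∩ t) ∧ P₄ (s ∪ t)) :
    (∑ τ ∈ Δ.powerset with P₁ τ, w τ) * ∑ τ ∈ Δ.powerset with P₂ τ, w τ ≤
      (∑ τ ∈ Δ.powerset with P₃ τ, w τ) * ∑ τ ∈ Δ.powerset with P₄ τ, w τ := by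
  have hnn : ∀ T : Finset (Finset (ℤ × ℤ)), 0 ≤ ∑ D ∈ T, w D := fun T =>
    Finset.sum_nonneg fun _ _ => (hw _).le
  refine (Finset.four_functions_theorem Δ (f₁ := w) (f₂ := w) (f₃ := w) (f₄ := w)
    (fun _ => (hw _).le) (fun _ => (hw _).le) (fun _ => (hw _).le) (fun _ => (hw _).le)
    (fun s _ t _ => hsuper s t) (Finset.filter_subset _ _) (Finset.filter_subset _ _)).trans ?_
  refine mul_le_mul ?_ ?_ (hnn _) (hnn _)
  · refine Finset.sum_le_sum_of_subset_of_nonneg (fun T hT => ?_) fun _ _ _ => (hw _).le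
    obtain ⟨S, hS, S', hS', rfl⟩ := Finset.mem_infs.1 hT
    rw [Finset.mem_filter, Finset.mem_powerset] at hS hS' ⊢
    exact ⟨Finset.inter_subset_left.trans hS.1, (h _ _ hS.2 hS'.2).1⟩
  · refine Finset.sum_le_sum_of_subset_of_nonneg (fun T hT => ?_) fun _ _ _ => (hw _).le
    obtain ⟨S, hS, S', hS', rfl⟩ := Finset.mem_sups.1 hT
    rw [Finset.mem_filter, Finset.mem_powerset] at hS hS' ⊢
    exact ⟨Finset.union_subset hS.1 hS'.1, (h _ _ hS.2 hS'.2).2⟩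

theorem sum_disjoint_subset_le {β : ℝ} (hβ : 0 ≤ β) (e : ℤ × ℤ ≃ ℤ × ℤ)
    (he : ∀ x y, e y ∈ nbrs (e x) ↔ y ∈ nbrs x) (hinv : ∀ x, e (e x) = x)
    {ζ Δ W : Finset (ℤ × ℤ)} (hζ : Disjoint ζ Δ) (hΔ : Δ.map e.toEmbedding = Δ)
    (hbc : ∀ u ∈ Δ, ∀ y ∈ nbrs u, y ∈ Δ ∨ y ∈ ζ ∨ e y ∈ ζ) (hW : W.map e.toEmbedding = W)
    (hWΔ : W ⊆ Δ) (S : Finset (ℤ × ℤ)) :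
    ∑ τ ∈ Δ.powerset with Disjoint W τ ∧ S ⊆ ζ ∪ τ, dropWt β (ζ ∪ τ) ≤
      ∑ τ ∈ Δ.powerset with W ⊆ τ ∧ S ⊆ ζ ∪ τ, dropWt β (ζ ∪ τ) := by
  have hw : ∀ τ, 0 < dropWt β (ζ ∪ τ) := fun τ => dropWt_pos _ _
  have hsuper : ∀ s t, dropWt β (ζ ∪ s) * dropWt β (ζ ∪ t) ≤
      dropWt β (ζ ∪ (s ∩ t)) * dropWt β (ζ ∪ (s ∪ t)) := fun s t => by
    rw [Finset.union_inter_distrib_left, Finset.union_union_distrib_left]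
    exact dropWt_supermodular hβ _ _
  have h0 := sum_disjoint_le_sum_subset e hβ he hinv hζ hΔ hbc hW hWΔ
  have hmono : ∀ {s t : Finset (ℤ × ℤ)}, s ⊆ t → S ⊆ ζ ∪ s → S ⊆ ζ ∪ t := fun hst h =>
    h.trans (Finset.union_subset_union subset_rfl hst)
  have h1 := sum_filter_mul_sum_filter_le (Δ := Δ) hw hsuper
    (P₁ := fun τ => Disjoint W τ ∧ S ⊆ ζ ∪ τ) (P₂ := fun _ => True)
    (P₃ := fun τ => Disjoint W τ) (P₄ := fun τ => S ⊆ ζ ∪ τ)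
    fun s t hs _ => ⟨hs.1.mono_right Finset.inter_subset_left,
      hmono Finset.subset_union_left hs.2⟩
  have h2 := sum_filter_mul_sum_filter_le (Δ := Δ) hw hsuper
    (P₁ := fun τ => W ⊆ τ) (P₂ := fun τ => S ⊆ ζ ∪ τ)
    (P₃ := fun _ => True) (P₄ := fun τ => W ⊆ τ ∧ S ⊆ ζ ∪ τ)
    fun s t hs ht => ⟨trivial, hs.trans Finset.subset_union_left,
      hmono Finset.subset_union_right ht⟩
  have hpos : 0 < ∑ τ ∈ Δ.powerset with True, dropWt β (ζ ∪ τ) :=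
    Finset.sum_pos (fun _ _ => hw _) ⟨∅, by simp⟩
  refine le_of_mul_le_mul_right (h1.trans ?_) hpos
  rw [mul_comm _ (∑ τ ∈ Δ.powerset with True, dropWt β (ζ ∪ τ))]
  refine le_trans (mul_le_mul_of_nonneg_right h0 ?_) h2
  exact Finset.sum_nonneg fun _ _ => (hw _).le

end ReflectionComparisonConditioned

section Exploration

/-- The reflection of `ℤ²` in the column `x = n`. -/
def columnRefl (n : ℤ) : ℤ × ℤ ≃ ℤ × ℤ where
  toFun z := (2 * n - z.1, z.2)
  invFun z := (2 * n - z.1, z.2)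
  left_inv z := by simp
  right_inv z := by simp

theorem columnRefl_apply (n : ℤ) (z : ℤ × ℤ) : columnRefl n z = (2 * n - z.1, z.2) := rfl

theorem columnRefl_columnRefl (n : ℤ) (z : ℤ × ℤ) : columnRefl n (columnRefl n z) = z :=
  (columnRefl n).left_inv z

theorem columnRefl_mem_nbrs (n : ℤ) (x y : ℤ × ℤ) :
    columnRefl n y ∈ nbrs (columnRefl n x) ↔ y ∈ nbrs x := by
  simp only [mem_nbrs, columnRefl_apply]
  omega

/-- The part of the box of radius `M` around `(n, 0)` that lies in `{x ≤ n}`. -/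
noncomputable def halfBox (n : ℤ) (M : ℕ) : Finset (ℤ × ℤ) :=
  Finset.Icc (n - M) n ×ˢ Finset.Icc (-(M : ℤ)) M

theorem mem_halfBox {n : ℤ} {M : ℕ} {z : ℤ × ℤ} :
    z ∈ halfBox n M ↔ n - M ≤ z.1 ∧ z.1 ≤ n ∧ -(M : ℤ) ≤ z.2 ∧ z.2 ≤ M := by
  simp only [halfBox, Finset.mem_product, Finset.mem_Icc, and_assoc]

/-- The sites of `halfBox n M` at distance `M` from `(n, 0)`. -/
def OnRim (n : ℤ) (M : ℕ) (z : ℤ × ℤ) : Prop := z.1 = n - M ∨ z.2 = M ∨ z.2 = -M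

/-- The sites of `halfBox n M` joined to its rim by plus spins. -/
inductive Explored (n : ℤ) (M : ℕ) (η : Cfg2) : ℤ × ℤ → Prop
  | rim (z : ℤ × ℤ) (hz : z ∈ halfBox n M) (hr : OnRim n M z) (h : η z = true) : Explored n M η z
  | step (x y : ℤ × ℤ) (hx : Explored n M η x) (hxy : y ∈ nbrs x) (hy : y ∈ halfBox n M)
      (h : η y = true) : Explored n M η y

theorem Explored.mem {n : ℤ} {M : ℕ} {η : Cfg2} {z : ℤ × ℤ} (h : Explored n M η z) :
    z ∈ halfBox n M := by
  cases h <;> assumption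

theorem Explored.eq_true {n : ℤ} {M : ℕ} {η : Cfg2} {z : ℤ × ℤ} (h : Explored n M η z) :
    η z = true := by
  cases h <;> assumption

/-- The sites of `halfBox n M` whose spins are not needed to explore from the rim. -/
def Sheltered (n : ℤ) (M : ℕ) (η : Cfg2) (z : ℤ × ℤ) : Prop :=
  z ∈ halfBox n M ∧ ¬OnRim n M z ∧ ¬Explored n M η z ∧ ∀ y ∈ nbrs z, ¬Explored n M η y

open Classical in
/-- The sheltered sites together with their reflections. -/
noncomputable def shelter (n : ℤ) (M : ℕ) (η : Cfg2) : Finset (ℤ × ℤ) :=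
  {z ∈ halfBox n M ∪ (halfBox n M).map (columnRefl n).toEmbedding |
    Sheltered n M η z ∨ Sheltered n M η (columnRefl n z)}

theorem mem_shelter {n : ℤ} {M : ℕ} {η : Cfg2} {z : ℤ × ℤ} :
    z ∈ shelter n M η ↔ Sheltered n M η z ∨ Sheltered n M η (columnRefl n z) := by
  classical
  rw [shelter, Finset.mem_filter, Finset.mem_union,
    mem_map_involutive _ (columnRefl_columnRefl n), and_iff_right_iff_imp]
  exact fun h => h.imp And.left And.left

theorem shelter_map (n : ℤ) (M : ℕ) (η : Cfg2) :
    (shelter n M η).map (columnRefl n).toEmbedding = shelter n M η := by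
  ext z
  rw [mem_map_involutive _ (columnRefl_columnRefl n), mem_shelter, mem_shelter,
    columnRefl_columnRefl, or_comm]

theorem mem_shelter_of_mem_halfBox {n : ℤ} {M : ℕ} {η : Cfg2} {z : ℤ × ℤ}
    (hz : z ∈ halfBox n M) : z ∈ shelter n M η ↔ Sheltered n M η z := by
  rw [mem_shelter, or_iff_left_iff_imp]
  intro h
  have h1 := h.1
  rw [mem_halfBox] at hz
  rw [mem_halfBox, columnRefl_apply] at h1
  rwa [show columnRefl n z = z by rw [columnRefl_apply]; ext <;> simp; omega] at h

theorem explored_congr {n : ℤ} {M : ℕ} {η η' : Cfg2}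
    (h : ∀ z ∉ shelter n M η, η z = η' z) (z : ℤ × ℤ) :
    Explored n M η' z ↔ Explored n M η z := by
  have h' : ∀ z ∈ halfBox n M, ¬Sheltered n M η z → η z = η' z := fun z hz hs =>
    h z (by rwa [mem_shelter_of_mem_halfBox hz])
  constructor
  · intro hz
    induction hz with
    | rim z hz hr hp => exact .rim z hz hr ((h' z hz fun hs => hs.2.1 hr).trans hp)
    | step x y hx hxy hy hp ih =>
      exact .step x y ih hxy hy ((h' y hy fun hs => hs.2.2.2 x (mem_nbrs_comm.1 hxy) ih).trans hp)
  · intro hz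
    induction hz with
    | rim z hz hr hp => exact .rim z hz hr ((h' z hz fun hs => hs.2.1 hr).symm.trans hp)
    | step x y hx hxy hy hp ih =>
      exact .step x y ih hxy hy
        ((h' y hy fun hs => hs.2.2.2 x (mem_nbrs_comm.1 hxy) hx).symm.trans hp)

theorem shelter_congr {n : ℤ} {M : ℕ} {η η' : Cfg2}
    (h : ∀ z ∉ shelter n M η, η z = η' z) : shelter n M η' = shelter n M η := by
  ext z
  simp only [mem_shelter, Sheltered, explored_congr h]

theorem Sheltered.nbr {n : ℤ} {M : ℕ} {η : Cfg2} {u y : ℤ × ℤ} (hu : Sheltered n M η u)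
    (hy : y ∈ nbrs u) (hys : y ∉ shelter n M η) :
    η y = false ∨ η (columnRefl n y) = false := by
  have key : ∀ z, z ∈ nbrs u → z ∈ halfBox n M → ¬Sheltered n M η z → η z = false := by
    intro z hz hzb hzs
    by_contra hp
    rw [Bool.not_eq_false] at hp
    refine hzs ⟨hzb, fun hr => hu.2.2.2 z hz (.rim z hzb hr hp), hu.2.2.2 z hz, fun y hy hye => ?_⟩
    exact hu.2.2.2 z hz (.step y z hye (mem_nbrs_comm.1 hy) hzb hp)
  rw [mem_shelter, not_or] at hys
  by_cases hyb : y ∈ halfBox n M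
  · exact Or.inl (key y hy hyb hys.1)
  · have h1 := hu.1
    have h2 := hu.2.1
    have h3 := mem_nbrs.1 hy
    rw [mem_halfBox] at hyb h1
    rw [OnRim] at h2
    refine Or.inr (key _ ?_ ?_ hys.2)
    · rw [mem_nbrs, columnRefl_apply]
      dsimp only
      omega
    · rw [mem_halfBox, columnRefl_apply]
      dsimp only
      omega

theorem nbr_of_mem_shelter {n : ℤ} {M : ℕ} {η : Cfg2} {u y : ℤ × ℤ} (hu : u ∈ shelter n M η)
    (hy : y ∈ nbrs u) (hys : y ∉ shelter n M η) :
    η y = false ∨ η (columnRefl n y) = false := by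
  rcases mem_shelter.1 hu with h | h
  · exact h.nbr hy hys
  · have h1 := h.nbr ((columnRefl_mem_nbrs n u y).2 hy) fun h2 => hys ?_
    · rw [columnRefl_columnRefl] at h1
      exact h1.symm
    · rw [mem_shelter] at h2 ⊢
      rw [columnRefl_columnRefl] at h2
      exact h2.symm

/-- Some site of the row from `(n - l, 0)` to `(n, 0)` is next to an explored site. -/
def rowReached (n : ℤ) (l M : ℕ) : Set Cfg2 :=
  {η | ∃ z ∈ seg (n - l) (n + 1), Explored n M η z ∨ ∃ y ∈ nbrs z, Explored n M η y}

theorem seg_subset_shelter {n : ℤ} {l M : ℕ} (hlM : l < M) {η : Cfg2} (hη : η ∉ rowReached n l M) :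
    seg (n - l) (n + l + 1) ⊆ shelter n M η := by
  have key : ∀ z ∈ seg (n - l) (n + 1), Sheltered n M η z := by
    intro z hz
    have h1 := mem_seg.1 hz
    refine ⟨by rw [mem_halfBox]; omega, by rw [OnRim]; omega, fun he => hη ⟨z, hz, Or.inl he⟩,
      fun y hy he => hη ⟨z, hz, Or.inr ⟨y, hy, he⟩⟩⟩
  intro z hz
  rw [mem_seg] at hz
  rw [mem_shelter]
  rcases le_total z.1 n with h | h
  · exact Or.inl (key z (by rw [mem_seg]; omega))
  · refine Or.inr (key _ ?_)
    rw [mem_seg, columnRefl_apply]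
    dsimp only
    omega

end Exploration

section RowReflection

theorem shelter_subset_box {n : ℤ} {M L : ℕ} (h : n.natAbs + M ≤ L) (η : Cfg2) :
    shelter n M η ⊆ box L := by
  intro z hz
  rw [mem_shelter] at hz
  simp only [box, Finset.mem_product, Finset.mem_Icc]
  rcases hz with hz | hz
  · have := mem_halfBox.1 hz.1
    omega
  · have := mem_halfBox.1 hz.1
    rw [columnRefl_apply] at this
    dsimp only at this
    omega

theorem shelter_cfg_union {n : ℤ} {M : ℕ} {ζ τ : Finset (ℤ × ℤ)}
    (hτ : τ ⊆ shelter n M (cfg ζ)) : ∀ z ∉ shelter n M (cfg ζ), cfg ζ z = cfg (ζ ∪ τ) z := by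
  intro z hz
  have : z ∉ τ := fun h => hz (hτ h)
  simp [cfg, this]

theorem sum_shelter_fiber {β : ℝ} {Λ : Finset (ℤ × ℤ)} {n : ℤ} {M : ℕ}
    (hΛ : ∀ η, shelter n M η ⊆ Λ) {ζ : Finset (ℤ × ℤ)} (hζΛ : ζ ⊆ Λ)
    (hζ : Disjoint ζ (shelter n M (cfg ζ))) (P : Finset (ℤ × ℤ) → Prop) [DecidablePred P] :
    ∑ D ∈ Λ.powerset.filter P with D \ shelter n M (cfg D) = ζ, dropWt β D =
      ∑ τ ∈ (shelter n M (cfg ζ)).powerset with P (ζ ∪ τ), dropWt β (ζ ∪ τ) := by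
  set Δ := shelter n M (cfg ζ) with hΔ
  have hfib : ∀ τ ⊆ Δ, shelter n M (cfg (ζ ∪ τ)) = Δ := fun τ hτ =>
    shelter_congr (shelter_cfg_union hτ)
  have hfib' : ∀ D : Finset (ℤ × ℤ), D \ shelter n M (cfg D) = ζ → shelter n M (cfg D) = Δ := by
    rintro D rfl
    rw [hΔ]
    symm
    refine shelter_congr fun z hz => ?_
    simp [cfg, hz]
  symm
  refine Finset.sum_nbij' (fun τ => ζ ∪ τ) (fun D => D ∩ Δ) ?_ ?_ ?_ ?_ fun _ _ => rfl
  · intro τ hτ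
    rw [Finset.mem_filter, Finset.mem_powerset] at hτ
    simp only [Finset.mem_filter, Finset.mem_powerset]
    refine ⟨⟨Finset.union_subset hζΛ (hτ.1.trans (hΛ _)), hτ.2⟩, ?_⟩
    rw [hfib τ hτ.1, Finset.union_sdiff_distrib, Finset.sdiff_eq_empty_iff_subset.2 hτ.1,
      Finset.union_empty, Finset.sdiff_eq_self_of_disjoint hζ]
  · intro D hD
    simp only [Finset.mem_filter, Finset.mem_powerset] at hD ⊢
    refine ⟨Finset.inter_subset_right, ?_⟩
    have h1 := hD.2
    rw [hfib' D hD.2] at h1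
    rw [← h1, Finset.sdiff_union_inter]
    exact hD.1.2
  · intro τ hτ
    rw [Finset.mem_filter, Finset.mem_powerset] at hτ
    rw [Finset.union_inter_distrib_right, Finset.disjoint_iff_inter_eq_empty.1 hζ,
      Finset.inter_eq_left.2 hτ.1, Finset.empty_union]
  · intro D hD
    simp only [Finset.mem_filter, Finset.mem_powerset] at hD ⊢
    have h1 := hD.2
    rw [hfib' D hD.2] at h1
    conv_lhs => rw [← h1]
    exact Finset.sdiff_union_inter D Δ

theorem cfg_mem_compl_rowReached_congr {n : ℤ} {l M : ℕ} {ζ τ : Finset (ℤ × ℤ)}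
    (hτ : τ ⊆ shelter n M (cfg ζ)) :
    cfg (ζ ∪ τ) ∈ rowReached n l M ↔ cfg ζ ∈ rowReached n l M := by
  simp only [rowReached, Set.mem_ofPred_eq, explored_congr (shelter_cfg_union hτ)]

theorem columnRefl_map_seg (n : ℤ) (l : ℕ) :
    (seg (n - l) (n + l + 1)).map (columnRefl n).toEmbedding = seg (n - l) (n + l + 1) := by
  ext z
  rw [mem_map_involutive _ (columnRefl_columnRefl n), mem_seg, mem_seg, columnRefl_apply]
  dsimp only
  omega

/-- Unless the row is reached from far away inside the left half-plane, a symmetric row of plus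
spins is at most as likely as one of minus spins, even given minus spins elsewhere. -/
theorem dropSum_plusOn_row_le {β : ℝ} (hβ : 0 ≤ β) {Λ : Finset (ℤ × ℤ)} {n : ℤ} {l M : ℕ}
    (hlM : l < M) (hΛ : ∀ η, shelter n M η ⊆ Λ) (S : Finset (ℤ × ℤ)) :
    dropSum β Λ (plusOn (seg (n - l) (n + l + 1)) ∩ minusOn S) ≤
      dropSum β Λ (minusOn (seg (n - l) (n + l + 1)) ∩ minusOn S) +
        dropSum β Λ (rowReached n l M ∩ minusOn S) := by
  classical
  set W := seg (n - l) (n + l + 1) with hWdef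
  have key : dropSum β Λ ((plusOn W ∩ minusOn S) ∩ (rowReached n l M)ᶜ) ≤
      dropSum β Λ ((minusOn W ∩ minusOn S) ∩ (rowReached n l M)ᶜ) := by
    have hform : ∀ E : Set Cfg2, dropSum β Λ E = ∑ ζ ∈ Λ.powerset,
        ∑ D ∈ Λ.powerset.filter (fun D => cfg D ∈ E) with D \ shelter n M (cfg D) = ζ,
          dropWt β D := fun E => by
      rw [Finset.sum_fiberwise_of_maps_to]
      · exact Finset.sum_congr (by ext D; simp) fun _ _ => rfl
      · intro D hD
        rw [Finset.mem_filter, Finset.mem_powerset] at hD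
        exact Finset.mem_powerset.2 (Finset.sdiff_subset.trans hD.1)
    rw [hform, hform]
    refine Finset.sum_le_sum fun ζ hζΛ => ?_
    rw [Finset.mem_powerset] at hζΛ
    by_cases hζ : Disjoint ζ (shelter n M (cfg ζ)) ∧ cfg ζ ∉ rowReached n l M
    · rw [sum_shelter_fiber hΛ hζΛ hζ.1, sum_shelter_fiber hΛ hζΛ hζ.1]
      set Δ := shelter n M (cfg ζ) with hΔ
      have hWΔ : W ⊆ Δ := seg_subset_shelter hlM hζ.2
      have h1 := sum_disjoint_subset_le hβ (columnRefl n) (columnRefl_mem_nbrs n)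
        (columnRefl_columnRefl n) hζ.1 (shelter_map n M (cfg ζ)) (W := W) (fun u hu y hy => by
          by_cases hys : y ∈ Δ
          · exact Or.inl hys
          · have := nbr_of_mem_shelter hu hy hys
            rw [cfg_eq_false, cfg_eq_false] at this
            exact Or.inr this) (columnRefl_map_seg n l) hWΔ S
      have hWζ : Disjoint W ζ := (hζ.1.mono_right hWΔ).symm
      refine le_of_eq_of_le ?_ (h1.trans_eq ?_)
      · refine Finset.sum_congr ?_ fun _ _ => rfl
        ext τ
        simp only [Finset.mem_filter, Finset.mem_powerset, and_congr_right_iff]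
        intro hτ
        rw [Set.mem_inter_iff, Set.mem_inter_iff, cfg_mem_plusOn, cfg_mem_minusOn,
          Set.mem_compl_iff, cfg_mem_compl_rowReached_congr hτ, Finset.disjoint_union_right]
        have := hζ.2
        tauto
      · refine Finset.sum_congr ?_ fun _ _ => rfl
        ext τ
        simp only [Finset.mem_filter, Finset.mem_powerset, and_congr_right_iff]
        intro hτ
        rw [Set.mem_inter_iff, Set.mem_inter_iff, cfg_mem_minusOn, cfg_mem_minusOn,
          Set.mem_compl_iff, cfg_mem_compl_rowReached_congr hτ]
        have h2 := hζ.2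
        have h3 : W ⊆ ζ ∪ τ ↔ W ⊆ τ := ⟨fun h z hz => (Finset.mem_union.1 (h hz)).resolve_left
          (Finset.disjoint_left.1 hWζ hz), fun h => h.trans Finset.subset_union_right⟩
        tauto
    · refine le_of_eq_of_le (Finset.sum_eq_zero fun D hD => ?_)
        (Finset.sum_nonneg fun _ _ => (dropWt_pos _ _).le)
      exfalso
      simp only [Finset.mem_filter, Finset.mem_powerset] at hD
      obtain ⟨⟨-, hD1⟩, rfl⟩ := hD
      have hag : ∀ z ∉ shelter n M (cfg D), cfg D z = cfg (D \ shelter n M (cfg D)) z :=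
        fun z hz => by simp [cfg, hz]
      refine hζ ⟨?_, ?_⟩
      · rw [shelter_congr hag]
        exact Finset.sdiff_disjoint
      · intro h
        refine hD1.2 ?_
        simpa only [rowReached, Set.mem_ofPred_eq, explored_congr hag] using h
  rw [← dropSum_inter_add_inter_compl β Λ (plusOn W ∩ minusOn S) (rowReached n l M), add_comm]
  refine add_le_add (key.trans ?_) ?_
  · exact dropSum_mono β Λ fun D _ h => h.1
  · exact dropSum_mono β Λ fun D _ h => ⟨h.2, h.1.2⟩

end RowReflection

section PlusPaths

theorem adj2_iff_mem_nbrs {x y : ℤ × ℤ} : adj2 x y ↔ y ∈ nbrs x := by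
  rw [adj2, mem_nbrs]
  omega

/-- A self-avoiding path `γ 0, …, γ M` of plus spins in `{x ≤ n}` starting at `(n, 0)`. -/
def IsPlusPath (n M : ℕ) (η : Cfg2) (γ : ℕ → ℤ × ℤ) : Prop :=
  γ 0 = ((n : ℤ), 0) ∧ (∀ j < M, adj2 (γ j) (γ (j + 1))) ∧
    (∀ i ≤ M, ∀ j ≤ M, γ i = γ j → i = j) ∧ ∀ j ≤ M, (γ j).1 ≤ (n : ℤ) ∧ η (γ j) = true

/-- There is a self-avoiding path of `M` steps of plus spins in `{x ≤ n}` starting at `(n, 0)`. -/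
def finitePathEvt (n M : ℕ) : Set Cfg2 := {η | ∃ γ, IsPlusPath n M η γ}

theorem IsPlusPath.mono {n M M' : ℕ} {η : Cfg2} {γ : ℕ → ℤ × ℤ} (h : IsPlusPath n M' η γ)
    (hM : M ≤ M') : IsPlusPath n M η γ :=
  ⟨h.1, fun j hj => h.2.1 j (hj.trans_le hM),
    fun i hi j hj => h.2.2.1 i (hi.trans hM) j (hj.trans hM), fun j hj => h.2.2.2 j (hj.trans hM)⟩

theorem IsPlusPath.dist_le {n M : ℕ} {η : Cfg2} {γ : ℕ → ℤ × ℤ} (h : IsPlusPath n M η γ) (j : ℕ)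
    (hj : j ≤ M) : ((γ j).1 - n).natAbs ≤ j ∧ (γ j).2.natAbs ≤ j := by
  induction j with
  | zero => rw [h.1]; simp
  | succ j ih =>
    have h1 := h.2.1 j (by omega)
    have h2 := ih (by omega)
    rw [adj2] at h1
    omega

theorem IsPlusPath.mem_box {n M : ℕ} {η : Cfg2} {γ : ℕ → ℤ × ℤ} (h : IsPlusPath n M η γ) (j : ℕ)
    (hj : j ≤ M) : γ j ∈ box (n + j) := by
  have := h.dist_le j hj
  simp only [box, Finset.mem_product, Finset.mem_Icc]
  omega

theorem determinedOn_finitePathEvt (n M : ℕ) : DeterminedOn (box (n + M)) (finitePathEvt n M) := by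
  rintro η η' h ⟨γ, hγ⟩
  refine ⟨γ, hγ.1, hγ.2.1, hγ.2.2.1, fun j hj => ⟨(hγ.2.2.2 j hj).1, ?_⟩⟩
  rw [← h _ (box_mono (by omega) (hγ.mem_box j hj))]
  exact (hγ.2.2.2 j hj).2

theorem antitone_finitePathEvt (n : ℕ) : Antitone (finitePathEvt n) :=
  fun _ _ h _ ⟨γ, hγ⟩ => ⟨γ, hγ.mono h⟩

theorem iInter_finitePathEvt_subset (n : ℕ) : ⋂ M, finitePathEvt n M ⊆ plusPathEvt n := by
  intro η hη
  rw [Set.mem_iInter] at hη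
  set K : Set (ℕ → ℤ × ℤ) := Set.univ.pi fun j => (box (n + j) : Set (ℤ × ℤ)) with hK
  have hKc : IsCompact K := isCompact_univ_pi fun j => (Finset.finite_toSet _).isCompact
  have hclosed : ∀ M, IsClosed {γ | IsPlusPath n M η γ} := fun M => by
    have c1 : ∀ (j : ℕ) (s : Set (ℤ × ℤ)), IsClosed {γ : ℕ → ℤ × ℤ | γ j ∈ s} := fun j s =>
      (isClosed_discrete s).preimage (continuous_apply j)
    have c2 : ∀ (i j : ℕ) (s : Set ((ℤ × ℤ) × (ℤ × ℤ))),
        IsClosed {γ : ℕ → ℤ × ℤ | (γ i, γ j) ∈ s} := fun i j s =>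
      (isClosed_discrete s).preimage ((continuous_apply i).prodMk (continuous_apply j))
    refine (c1 0 {((n : ℤ), 0)}).inter (IsClosed.inter ?_ (IsClosed.inter ?_ ?_))
    · have : {γ : ℕ → ℤ × ℤ | ∀ j < M, adj2 (γ j) (γ (j + 1))} =
          ⋂ j, ⋂ (_ : j < M), {γ | (γ j, γ (j + 1)) ∈ {p : (ℤ × ℤ) × (ℤ × ℤ) | adj2 p.1 p.2}} := by
        ext γ; simp
      refine (congrArg IsClosed this).mpr <| isClosed_iInter fun j => isClosed_iInter fun _ => c2 _ _ _
    · have : {γ : ℕ → ℤ × ℤ | ∀ i ≤ M, ∀ j ≤ M, γ i = γ j → i = j} =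
          ⋂ i, ⋂ (_ : i ≤ M), ⋂ j, ⋂ (_ : j ≤ M),
            {γ | (γ i, γ j) ∈ {p : (ℤ × ℤ) × (ℤ × ℤ) | p.1 = p.2 → i = j}} := by
        ext γ; simp
      refine (congrArg IsClosed this).mpr <| isClosed_iInter fun i => isClosed_iInter fun _ => isClosed_iInter fun j =>
        isClosed_iInter fun _ => c2 _ _ _
    · have : {γ : ℕ → ℤ × ℤ | ∀ j ≤ M, (γ j).1 ≤ (n : ℤ) ∧ η (γ j) = true} =
          ⋂ j, ⋂ (_ : j ≤ M), {γ | γ j ∈ {p : ℤ × ℤ | p.1 ≤ (n : ℤ) ∧ η p = true}} := by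
        ext γ; simp
      refine (congrArg IsClosed this).mpr <| isClosed_iInter fun j => isClosed_iInter fun _ => c1 _ _
  obtain ⟨γ, hγ⟩ := IsCompact.nonempty_iInter_of_sequence_nonempty_isCompact_isClosed
    (fun M => K ∩ {γ | IsPlusPath n M η γ})
    (fun M => Set.inter_subset_inter_right _ fun γ (h : IsPlusPath n (M + 1) η γ) =>
      h.mono (Nat.le_succ M))
    (fun M => by
      obtain ⟨γ, hγ⟩ := hη M
      refine ⟨fun j => γ (min j M), fun j _ => ?_, ?_, fun j hj => ?_, fun i hi j hj => ?_,
        fun j hj => ?_⟩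
      · exact box_mono (by omega) (hγ.mem_box (min j M) (min_le_right _ _))
      · simpa using hγ.1
      · simp only [min_eq_left hj.le, min_eq_left (Nat.succ_le_of_lt hj)]
        exact hγ.2.1 j hj
      · simp only [min_eq_left hi, min_eq_left hj]
        exact hγ.2.2.1 i hi j hj
      · simp only [min_eq_left hj]
        exact hγ.2.2.2 j hj)
    (hKc.inter_right (hclosed 0)) (fun M => hKc.isClosed.inter (hclosed M))
  rw [Set.mem_iInter] at hγ
  refine ⟨γ, (hγ 0).2.1, fun j => (hγ (j + 1)).2.2.1 j (Nat.lt_succ_self j), fun i j hij => ?_,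
    fun j => ((hγ j).2.2.2.2 j le_rfl).1, fun j => ((hγ j).2.2.2.2 j le_rfl).2⟩
  exact (hγ (max i j)).2.2.2.1 i (le_max_left _ _) j (le_max_right _ _) hij

/-- The graph of neighbouring plus spins in `{x ≤ n}`. -/
def plusGraph (n : ℤ) (η : Cfg2) : SimpleGraph (ℤ × ℤ) where
  Adj x y := adj2 x y ∧ (x.1 ≤ n ∧ η x = true) ∧ y.1 ≤ n ∧ η y = true
  symm := ⟨fun x y h => ⟨by have := h.1; rw [adj2] at this ⊢; omega, h.2.2, h.2.1⟩⟩
  loopless := ⟨fun x h => by have := h.1; simp [adj2] at this⟩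

theorem mem_finitePathEvt_of_reachable {n M : ℕ} {η : Cfg2} (h0 : η ((n : ℤ), 0) = true)
    {w : ℤ × ℤ} (hw : OnRim n M w) (h : (plusGraph n η).Reachable ((n : ℤ), 0) w) :
    η ∈ finitePathEvt n M := by
  obtain ⟨p, hp⟩ := h.exists_isPath
  have hpath : IsPlusPath n p.length η p.getVert := by
    refine ⟨p.getVert_zero, fun j hj => (p.adj_getVert_succ hj).1,
      fun i hi j hj hij => hp.getVert_injOn hi hj hij, fun j hj => ?_⟩
    rcases j with _ | j
    · rw [p.getVert_zero]
      exact ⟨le_rfl, h0⟩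
    · exact (p.adj_getVert_succ (Nat.lt_of_succ_le hj)).2.2
  have h1 := hpath.dist_le p.length le_rfl
  rw [p.getVert_length] at h1
  rw [OnRim] at hw
  exact ⟨_, hpath.mono (by omega)⟩

theorem Explored.exists_reachable {n : ℤ} {M : ℕ} {η : Cfg2} {z : ℤ × ℤ} (h : Explored n M η z) :
    ∃ w, OnRim n M w ∧ (plusGraph n η).Reachable z w := by
  induction h with
  | rim z hz hr h => exact ⟨z, hr, SimpleGraph.Reachable.refl _⟩
  | step x y hx hxy hy h ih =>
    obtain ⟨w, hw, hr⟩ := ih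
    refine ⟨w, hw, SimpleGraph.Reachable.trans (SimpleGraph.Adj.reachable ?_) hr⟩
    exact ⟨adj2_iff_mem_nbrs.2 (mem_nbrs_comm.1 hxy), ⟨(mem_halfBox.1 hy).2.1, h⟩,
      (mem_halfBox.1 hx.mem).2.1, hx.eq_true⟩

theorem plusOn_inter_rowReached_subset (n l M : ℕ) :
    plusOn (seg (n - l) (n + 1)) ∩ rowReached n l M ⊆ finitePathEvt n M := by
  rintro η ⟨hplus, z, hz, hreach⟩
  have hplus' : ∀ z ∈ seg ((n : ℤ) - l) (n + 1), η z = true := hplus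
  have h0 : η ((n : ℤ), 0) = true := hplus' _ (by rw [mem_seg]; dsimp only; omega)
  have hrow : ∀ k : ℕ, k ≤ l → (plusGraph n η).Reachable ((n : ℤ), 0) ((n : ℤ) - k, 0) := by
    intro k
    induction k with
    | zero => intro _; simp
    | succ k ih =>
      intro hk
      refine (ih (by omega)).trans (SimpleGraph.Adj.reachable ?_)
      refine ⟨?_, ⟨?_, hplus' _ ?_⟩, ?_, hplus' _ ?_⟩
      · rw [adj2]; push_cast; omega
      · dsimp only; omega
      · rw [mem_seg]; dsimp only; omega
      · push_cast; omega
      · rw [mem_seg]; dsimp only; omega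
  have hz' := mem_seg.1 hz
  have hz0 : (plusGraph n η).Reachable ((n : ℤ), 0) z := by
    have := hrow (n - z.1).natAbs (by omega)
    rwa [show ((n : ℤ) - ((n - z.1).natAbs : ℕ), (0 : ℤ)) = z by
      ext
      · dsimp only; omega
      · exact hz'.2.2.symm] at this
  rcases hreach with h | ⟨y, hy, h⟩
  · obtain ⟨w, hw, hr⟩ := h.exists_reachable
    exact mem_finitePathEvt_of_reachable h0 hw (hz0.trans hr)
  · obtain ⟨w, hw, hr⟩ := h.exists_reachable
    refine mem_finitePathEvt_of_reachable h0 hw (hz0.trans (SimpleGraph.Reachable.trans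
      (SimpleGraph.Adj.reachable ⟨adj2_iff_mem_nbrs.2 hy, ⟨by omega, hplus' z hz⟩, ?_, ?_⟩) hr))
    · exact (mem_halfBox.1 h.mem).2.1
    · exact h.eq_true

theorem Explored.mono {n : ℤ} {M : ℕ} {η η' : Cfg2}
    (h : ∀ z ∈ halfBox n M, η z = true → η' z = true) {z : ℤ × ℤ} (hz : Explored n M η z) :
    Explored n M η' z := by
  induction hz with
  | rim z hz hr hp => exact .rim z hz hr (h z hz hp)
  | step x y _ hxy hy hp ih => exact .step x y ih hxy hy (h y hy hp)

theorem rowReached_mono {n : ℤ} {l M : ℕ} {η η' : Cfg2}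
    (h : ∀ z ∈ halfBox n M, η z = true → η' z = true) (hη : η ∈ rowReached n l M) :
    η' ∈ rowReached n l M := by
  obtain ⟨z, hz, h1⟩ := hη
  exact ⟨z, hz, h1.imp (Explored.mono h) fun ⟨y, hy, h2⟩ => ⟨y, hy, h2.mono h⟩⟩

theorem determinedOn_rowReached (n : ℤ) (l M : ℕ) :
    DeterminedOn (halfBox n M) (rowReached n l M) :=
  fun _ _ h => rowReached_mono fun z hz hp => (h z hz).symm.trans hp

theorem tendsto_finitePathEvt {n : ℕ} {μ : Measure Cfg2} [IsProbabilityMeasure μ]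
    (h : μ (plusPathEvt n) = 0) : Tendsto (fun M => μ.real (finitePathEvt n M)) atTop (𝓝 0) := by
  have h1 := tendsto_measure_iInter_atTop (μ := μ) (s := finitePathEvt n)
    (fun M => (determinedOn_finitePathEvt n M).measurableSet.nullMeasurableSet)
    (antitone_finitePathEvt n) ⟨0, measure_ne_top _ _⟩
  rw [measure_mono_null (iInter_finitePathEvt_subset n) h] at h1
  exact (ENNReal.tendsto_toReal ENNReal.zero_ne_top).comp h1

end PlusPaths

section ConditionedMeasure

theorem tendsto_cond_lineMinus {μp μh : Measure Cfg2} [IsProbabilityMeasure μh]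
    (hμh : CylTendsto (fun m => μp[|lineMinusEvt 1 m]) μh) {T : Finset (ℤ × ℤ)} {E : Set Cfg2}
    (hE : DeterminedOn T E) :
    Tendsto (fun m : ℕ => μp.real (minusOn (seg (-m) 0) ∩ E) / μp.real (minusOn (seg (-m) 0)))
      atTop (𝓝 (μh.real E)) := by
  have h1 := (ENNReal.tendsto_toReal (measure_ne_top μh E)).comp (hμh.tendsto_determinedOn hE)
  refine h1.congr fun m => ?_
  rw [Function.comp_apply, lineMinusEvt_eq]
  have hm : MeasurableSet (minusOn (seg (-(m : ℤ)) 0)) := measurableSet_agreeSet _ _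
  rw [cond_apply hm, ENNReal.toReal_mul, ENNReal.toReal_inv, mul_comm]
  rfl

variable {β : ℝ} {μp μh : Measure Cfg2}

theorem real_lineMinus_pos (hβ : 0 ≤ β) (hμp : IsPlusPhase β 0 μp) (m : ℕ) :
    0 < μp.real (minusOn (seg (-m) 0)) :=
  real_minusOn_pos hβ hμp (seg_subset_box (n := m) le_rfl (by omega))

theorem conditioned_fkg (hβ : 0 ≤ β) (hμp : IsPlusPhase β 0 μp) [IsProbabilityMeasure μh]
    (hμh : CylTendsto (fun m => μp[|lineMinusEvt 1 m]) μh) {T T' : Finset (ℤ × ℤ)}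
    {A B : Set Cfg2} (hA : DeterminedOn T A) (hB : DeterminedOn T' B) (hA' : IsUpperSet A)
    (hB' : IsUpperSet B) : μh.real A * μh.real B ≤ μh.real (A ∩ B) := by
  refine le_of_tendsto_of_tendsto' ((tendsto_cond_lineMinus hμh hA).mul
    (tendsto_cond_lineMinus hμh hB)) (tendsto_cond_lineMinus hμh (hA.inter hB)) fun m => ?_
  have hpos := real_lineMinus_pos hβ hμp m
  have hS := determinedOn_agreeSet (seg (-(m : ℤ)) 0) (fun _ => false)
  rw [div_mul_div_comm, div_le_div_iff₀ (mul_pos hpos hpos) hpos]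
  have h1 := hμp.fkg hβ (hS.inter hA) (hS.inter hB) hS (hS.inter (hA.inter hB))
    fun a ha b hb => ⟨?_, ?_, hA' le_sup_left ha.2, hB' le_sup_right hb.2⟩
  · change μp.real (minusOn _ ∩ A) * μp.real (minusOn _ ∩ B) ≤
      μp.real (minusOn _) * μp.real (minusOn _ ∩ (A ∩ B)) at h1
    nlinarith
  · intro z hz
    have := ha.1 z hz
    simp [this]
  · intro z hz
    have h2 := ha.1 z hz
    have h3 := hb.1 z hz
    simp only [Pi.sup_apply, h2, h3]
    rfl

theorem isUpperSet_plusOn (T : Finset (ℤ × ℤ)) : IsUpperSet (plusOn T) := by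
  intro a b hab ha z hz
  have h1 := ha z hz
  have h2 := hab z
  rw [h1] at h2
  exact top_le_iff.1 h2

theorem isUpperSet_rowReached (n : ℤ) (l M : ℕ) : IsUpperSet (rowReached n l M) :=
  fun a b hab => rowReached_mono fun z _ hz => by
    have h2 := hab z
    rw [hz] at h2
    exact top_le_iff.1 h2

theorem conditioned_plusOn_pos (hβ : 0 ≤ β) (hμp : IsPlusPhase β 0 μp) [IsProbabilityMeasure μh]
    (hμh : CylTendsto (fun m => μp[|lineMinusEvt 1 m]) μh) {X : Finset (ℤ × ℤ)}
    (hX : ∀ z ∈ X, 0 ≤ z.1) : 0 < μh.real (plusOn X) := by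
  set C := (1 + Real.exp (8 * β)) ^ X.card with hC
  have hCpos : 0 < C := by positivity
  refine (one_div_pos.2 hCpos).trans_le ?_
  refine ge_of_tendsto' (tendsto_cond_lineMinus hμh (determinedOn_agreeSet X _)) fun m => ?_
  have hS := determinedOn_agreeSet (seg (-(m : ℤ)) 0) (fun _ => false)
  have hdisj : Disjoint X (seg (-(m : ℤ)) 0) := Finset.disjoint_left.2 fun z hz hz' => by
    have h1 := hX z hz
    have h2 := mem_seg.1 hz'
    omega
  rw [div_le_div_iff₀ hCpos (real_lineMinus_pos hβ hμp m), one_mul]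
  refine le_of_tendsto_of_tendsto' (hμp.tendsto hS) ((hμp.tendsto (hS.inter
    (determinedOn_agreeSet X _))).mul_const C) fun L => ?_
  have h1 := dropSum_finite_energy hβ (box L) X (seg (-(m : ℤ)) 0) hdisj
  rw [Set.inter_comm, mul_comm] at h1
  rw [plusProb, plusProb, div_mul_eq_mul_div]
  exact div_le_div_of_nonneg_right h1 (dropSum_univ_pos _ _).le

/-- If there is no infinite plus path then the row is reached from far away with vanishing
probability. -/
theorem tendsto_rowReached (hβ : 0 ≤ β) (hμp : IsPlusPhase β 0 μp) [IsProbabilityMeasure μh]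
    (hμh : CylTendsto (fun m => μp[|lineMinusEvt 1 m]) μh) {n l : ℕ} (hln : l ≤ n)
    (h0 : μh (plusPathEvt n) = 0) :
    Tendsto (fun M => μh.real (rowReached n l M)) atTop (𝓝 0) := by
  set c := μh.real (plusOn (seg (n - l) (n + 1))) with hc
  have hcpos : 0 < c := conditioned_plusOn_pos hβ hμp hμh fun z hz => by
    have := mem_seg.1 hz
    omega
  have h1 := (tendsto_finitePathEvt h0).const_mul c⁻¹
  rw [mul_zero] at h1
  refine squeeze_zero (fun _ => measureReal_nonneg) (fun M => ?_) h1
  rw [le_inv_mul_iff₀ hcpos]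
  refine (conditioned_fkg hβ hμp hμh (determinedOn_agreeSet _ _) (determinedOn_rowReached _ _ _)
    (isUpperSet_plusOn _) (isUpperSet_rowReached _ _ _)).trans ?_
  exact measureReal_mono (plusOn_inter_rowReached_subset n l M)

end ConditionedMeasure

theorem agreeSet_seg_inter {a b : ℤ} (hab : a ≤ b) (s : Bool) :
    agreeSet (seg a b) (fun _ => s) ∩ {η | η (b, 0) = s} = agreeSet (seg a (b + 1)) fun _ => s := by
  ext η
  constructor
  · rintro ⟨h1, h2⟩ z hz
    rw [mem_seg] at hz
    rcases eq_or_ne z.1 b with h | h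
    · have : z = (b, 0) := Prod.ext h hz.2.2
      rw [this]
      exact h2
    · exact h1 z (mem_seg.2 (by omega))
  · intro h
    refine ⟨fun z hz => h z ?_, h _ ?_⟩
    · rw [mem_seg] at hz ⊢
      omega
    · rw [mem_seg]
      dsimp only
      omega

theorem compl_eq_true_spin (x : ℤ × ℤ) : ({η : Cfg2 | η x = true} : Set Cfg2)ᶜ = {η | η x = false} := by
  ext η
  simp

theorem dropSum_inter_eq_false (β : ℝ) {Λ T : Finset (ℤ × ℤ)} (hT : T ⊆ Λ) (x : ℤ × ℤ) (ω : Cfg2) :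
    dropSum β Λ (agreeSet T ω ∩ {η | η x = false}) / dropSum β Λ (agreeSet T ω) =
      1 - condPlus β Λ x T ω := by
  have hpos := dropSum_agreeSet_pos β hT ω
  have h := dropSum_inter_add_inter_compl β Λ (agreeSet T ω) {η | η x = true}
  rw [compl_eq_true_spin] at h
  rw [condPlus, eq_sub_iff_add_eq, ← add_div, div_eq_one_iff_eq hpos.ne']
  linarith

/-- If the conditional probabilities of extending a row of plus and of minus spins differ by at
least `δ`, then forcing minus spins next to a plus row is exponentially harder than forcing plus
spins next to a minus row. -/
theorem dropSum_minusOn_row_le_pow {β δ : ℝ} (hβ : 0 ≤ β) (hδ : 0 ≤ δ) (hδ1 : δ ≤ 1) {L : ℕ} {a c d : ℤ}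
    (hac : a ≤ c) (hcd : c ≤ d) {N : ℕ} (hL : seg a (d + N) ⊆ box L)
    (hgap : ∀ k < N, dropSum β (box L) (minusOn (seg a (d + k + 1))) /
        dropSum β (box L) (minusOn (seg a (d + k))) + δ ≤
      dropSum β (box L) (plusOn (seg a (d + k + 1))) / dropSum β (box L) (plusOn (seg a (d + k)))) :
    dropSum β (box L) (minusOn (seg d (d + N)) ∩ plusOn (seg a c)) *
        dropSum β (box L) (minusOn (seg a c)) ≤
      (1 - δ) ^ N * (dropSum β (box L) (plusOn (seg d (d + N)) ∩ minusOn (seg a c)) *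
        dropSum β (box L) (plusOn (seg a c))) := by
  classical
  set Λ := box L
  set S := seg a c with hS
  let σ : Cfg2 := fun z => decide (z ∉ S)
  have hsub : ∀ k : ℕ, k ≤ N → S ∪ seg d (d + k) ⊆ Λ := fun k hk z hz => hL <| by
    rw [Finset.mem_union, hS, mem_seg, mem_seg] at hz
    rw [mem_seg]
    omega
  have hdisj : ∀ k : ℕ, ∀ z ∈ seg d (d + k), z ∉ S := fun k z hz hz' => by
    rw [mem_seg] at hz
    rw [hS, mem_seg] at hz'
    omega
  have hf : ∀ k : ℕ, plusOn (seg d (d + k)) ∩ minusOn S = agreeSet (S ∪ seg d (d + k)) σ := by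
    intro k
    ext η
    constructor
    · rintro ⟨h1, h2⟩ z hz
      by_cases hzS : z ∈ S
      · simpa [σ, hzS] using h2 z hzS
      · simpa [σ, hzS] using h1 z ((Finset.mem_union.1 hz).resolve_left hzS)
    · intro h
      refine ⟨fun z hz => ?_, fun z hz => ?_⟩
      · simpa [σ, hdisj k z hz] using h z (Finset.mem_union_right _ hz)
      · simpa [σ, hz] using h z (Finset.mem_union_left _ hz)
  have hg : ∀ k : ℕ, minusOn (seg d (d + k)) ∩ plusOn S =
      agreeSet (S ∪ seg d (d + k)) fun z => !σ z := by
    intro k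
    ext η
    constructor
    · rintro ⟨h1, h2⟩ z hz
      by_cases hzS : z ∈ S
      · simpa [σ, hzS] using h2 z hzS
      · simpa [σ, hzS] using h1 z ((Finset.mem_union.1 hz).resolve_left hzS)
    · intro h
      refine ⟨fun z hz => ?_, fun z hz => ?_⟩
      · simpa [σ, hdisj k z hz] using h z (Finset.mem_union_right _ hz)
      · simpa [σ, hz] using h z (Finset.mem_union_left _ hz)
  have hmain : ∀ k ≤ N, dropSum β Λ (minusOn (seg d (d + k)) ∩ plusOn S) * dropSum β Λ (minusOn S) ≤
      (1 - δ) ^ k * (dropSum β Λ (plusOn (seg d (d + k)) ∩ minusOn S) *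
        dropSum β Λ (plusOn S)) := by
    intro k
    induction k with
    | zero =>
      intro _
      have h0 : seg d (d + (0 : ℕ)) = ∅ := by
        ext z
        rw [mem_seg]
        simp only [Finset.notMem_empty, iff_false]
        omega
      rw [h0]
      have h1 : plusOn (∅ : Finset (ℤ × ℤ)) = Set.univ := plusOn_empty
      have h2 : minusOn (∅ : Finset (ℤ × ℤ)) = Set.univ := by
        ext
        simp [minusOn, agreeSet]
      rw [h1, h2, Set.univ_inter, Set.univ_inter, pow_zero, one_mul, mul_comm]
    | succ k ih =>
      intro hk
      have ih := ih (by omega)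
      have hx : ((d + k, 0) : ℤ × ℤ) ∈ Λ := hL (by rw [mem_seg]; dsimp only; omega)
      have hT' : seg a (d + k) ⊆ Λ := fun z hz => hL (by rw [mem_seg] at hz ⊢; omega)
      have hTT' : S ∪ seg d (d + k) ⊆ seg a (d + k) := fun z hz => by
        rw [Finset.mem_union, hS, mem_seg, mem_seg] at hz
        rw [mem_seg]
        omega
      have key := condPlus_gap hβ L hTT' hT' hx σ
      have hfpos := dropSum_agreeSet_pos β (hsub k (by omega)) σ
      have hgpos := dropSum_agreeSet_pos β (hsub k (by omega)) fun z => !σ z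
      have hgap := hgap k (by omega)
      have e1 : minusOn (seg a (d + k + 1)) = minusOn (seg a (d + k)) ∩ {η | η (d + k, 0) = false} :=
        (agreeSet_seg_inter (by omega) false).symm
      have e2 : plusOn (seg a (d + k + 1)) = plusOn (seg a (d + k)) ∩ {η | η (d + k, 0) = true} :=
        (agreeSet_seg_inter (by omega) true).symm
      have e3 : plusOn (seg d (d + (k + 1 : ℕ))) = plusOn (seg d (d + k)) ∩ {η | η (d + k, 0) = true} := by
        rw [Nat.cast_add, Nat.cast_one, ← add_assoc]
        exact (agreeSet_seg_inter (by omega) true).symm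
      have e4 : minusOn (seg d (d + (k + 1 : ℕ))) =
          minusOn (seg d (d + k)) ∩ {η | η (d + k, 0) = false} := by
        rw [Nat.cast_add, Nat.cast_one, ← add_assoc]
        exact (agreeSet_seg_inter (by omega) false).symm
      rw [e1, e2] at hgap
      have e5 : dropSum β Λ (minusOn (seg a (d + k)) ∩ {η | η (d + k, 0) = false}) /
          dropSum β Λ (minusOn (seg a (d + k))) = _ := dropSum_inter_eq_false β hT' _ _
      rw [e5] at hgap
      change _ ≤ condPlus β Λ (d + k, 0) (seg a (d + k)) _ at hgap
      have e6 := dropSum_inter_eq_false β (hsub k (by omega)) (d + k, 0) fun z => !σ z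
      have e7 : condPlus β Λ (d + k, 0) (S ∪ seg d (d + k)) σ ≤ 1 :=
        div_le_one_of_le₀ (dropSum_mono _ _ fun _ _ h => h.1) hfpos.le
      rw [e3, e4, Set.inter_right_comm, Set.inter_right_comm (plusOn _), hf k, hg k]
      rw [hf k, hg k] at ih
      set u := condPlus β Λ (d + k, 0) (S ∪ seg d (d + k)) σ with hu
      set v := condPlus β Λ (d + k, 0) (S ∪ seg d (d + k)) fun z => !σ z
      rw [condPlus, eq_div_iff hfpos.ne'] at hu
      rw [div_eq_iff hgpos.ne'] at e6
      have hu0 : 0 ≤ u := by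
        by_contra! h
        nlinarith [dropSum_nonneg β Λ (agreeSet (S ∪ seg d (d + k)) σ ∩ {η | η (d + k, 0) = true})]
      rw [e6, ← hu]
      have h1 : 1 - v ≤ (1 - δ) * u := by nlinarith
      have hm : 0 ≤ dropSum β Λ (minusOn S) := dropSum_nonneg _ _ _
      calc (1 - v) * dropSum β Λ _ * dropSum β Λ (minusOn S)
          = (1 - v) * (dropSum β Λ (agreeSet (S ∪ seg d (d + k)) fun z => !σ z) *
              dropSum β Λ (minusOn S)) := by ring
        _ ≤ (1 - δ) * u * (dropSum β Λ (agreeSet (S ∪ seg d (d + k)) fun z => !σ z) *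
              dropSum β Λ (minusOn S)) := mul_le_mul_of_nonneg_right h1 (mul_nonneg hgpos.le hm)
        _ ≤ (1 - δ) * u * _ := mul_le_mul_of_nonneg_left ih (mul_nonneg (by linarith) hu0)
        _ = _ := by ring
  exact hmain N le_rfl

theorem real_plusOn_seg_pos {β : ℝ} (hβ : betaCrit < β) {μ : Measure Cfg2} (h : IsPlusPhase β 0 μ)
    (a : ℤ) (k : ℕ) : 0 < μ.real (plusOn (seg a (a + k))) := by
  have hβ0 : 0 ≤ β := (betaCrit_pos.trans hβ).le
  obtain ⟨κ, -, hst⟩ := exists_surface_tension hβ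
  rw [real_plusOn_seg hβ0 h]
  refine (mul_pos (Real.exp_pos _) ?_).trans_le (real_plusOn_seg_ge_exp h hst k)
  exact real_minusOn_pos hβ0 h (seg_subset_box (n := k) (by omega) le_rfl)

/-- The conditional probabilities of extending a long row of plus spins by a plus spin and a long
row of minus spins by a minus spin are separated. -/
theorem exists_eventually_gap {β : ℝ} (hβ : 0 ≤ β) {μ : Measure Cfg2} (h : IsPlusPhase β 0 μ)
    (hpos : ∀ (a : ℤ) (k : ℕ), 0 < μ.real (plusOn (seg a (a + k)))) {p p' δ : ℝ} (hδ : p + δ < p')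
    (hp : Tendsto (fun k : ℕ => μ.real (minusOn (seg 0 (k + 1 : ℕ))) / μ.real (minusOn (seg 0 k)))
      atTop (𝓝 p))
    (hp' : Tendsto (fun k : ℕ => μ.real (plusOn (seg 0 (k + 1 : ℕ))) / μ.real (plusOn (seg 0 k)))
      atTop (𝓝 p')) :
    ∃ m₁ : ℕ, ∀ (a b : ℤ), a + m₁ ≤ b → ∀ᶠ L in atTop,
      dropSum β (box L) (minusOn (seg a (b + 1))) / dropSum β (box L) (minusOn (seg a b)) + δ ≤
        dropSum β (box L) (plusOn (seg a (b + 1))) / dropSum β (box L) (plusOn (seg a b)) := by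
  obtain ⟨m₁, hm₁⟩ := eventually_atTop.1 ((hp.add_const δ).eventually_lt hp' hδ)
  refine ⟨m₁, fun a b hab => ?_⟩
  obtain ⟨k, hk⟩ : ∃ k : ℕ, b = a + k := ⟨(b - a).toNat, by omega⟩
  subst hk
  have hgap := hm₁ k (by omega)
  have hcast : a + (k : ℤ) + 1 = a + (k + 1 : ℕ) := by push_cast; ring
  rw [← real_minusOn_seg hβ h a, ← real_minusOn_seg hβ h a, ← real_plusOn_seg hβ h a,
    ← real_plusOn_seg hβ h a, ← hcast] at hgap
  have hne : μ.real (minusOn (seg a (a + k))) ≠ 0 :=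
    (real_minusOn_pos hβ h (seg_subset_box (n := a.natAbs + k) (by omega) (by omega))).ne'
  have hcancel : ∀ (L : ℕ) (E F : Set Cfg2), plusProb β (box L) E / plusProb β (box L) F =
      dropSum β (box L) E / dropSum β (box L) F := fun L E F =>
    div_div_div_cancel_right₀ (dropSum_univ_pos _ _).ne' _ _
  have h1 := (h.tendsto (determinedOn_agreeSet (seg a (a + k + 1)) fun _ => false)).div
    (h.tendsto (determinedOn_agreeSet (seg a (a + k)) fun _ => false)) hne
  have h2 := (h.tendsto (determinedOn_agreeSet (seg a (a + k + 1)) fun _ => true)).div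
    (h.tendsto (determinedOn_agreeSet (seg a (a + k)) fun _ => true)) (hpos a k).ne'
  filter_upwards [(h1.add_const δ).eventually_lt h2 hgap] with L hL
  simp only [Pi.div_apply, hcancel] at hL
  exact hL.le

/-- Shielding: in the infinite volume, given any spins in the left half-plane a row of minus spins
is at least as likely as in a finite box disjoint from that half-plane. -/
theorem plusProb_mul_real_plusOn_le {β : ℝ} (hβ : 0 ≤ β) {μ : Measure Cfg2} (h : IsPlusPhase β 0 μ)
    {l n m : ℕ} (hln : l < n) :
    plusProb β (box (n - 1)) (minusOn (seg (-l) (l + 1))) * μ.real (plusOn (seg (-m) 0)) ≤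
      μ.real (minusOn (seg (n - l) (n + l + 1)) ∩ plusOn (seg (-m) 0)) := by
  set Λ := (box (n - 1)).map (Equiv.addRight ((n : ℤ), (0 : ℤ))).toEmbedding with hΛ
  have htrans : plusProb β (box (n - 1)) (minusOn (seg (-l) (l + 1))) =
      plusProb β Λ (minusOn (seg (n - l) (n + l + 1))) := by
    rw [← plusProb_translate_minusOn β _ _ ((n : ℤ), (0 : ℤ)), seg_translate]
    congr 3 <;> ring
  rw [htrans]
  refine le_of_tendsto_of_tendsto ((h.tendsto (determinedOn_agreeSet _ _)).const_mul _)
    (h.tendsto ((determinedOn_agreeSet _ _).inter (determinedOn_agreeSet _ _))) ?_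
  filter_upwards [eventually_ge_atTop (n - 1 + n), eventually_ge_atTop m] with L hL hm
  have hsub : Λ ⊆ box L := (box_translate_subset _ _).trans (box_mono (by simpa using hL))
  have hS : seg (-m) 0 ⊆ box L \ Λ := by
    intro z hz
    refine Finset.mem_sdiff.2 ⟨seg_subset_box (by omega) (by omega) hz, fun hz' => ?_⟩
    rw [hΛ, Finset.mem_map_equiv] at hz'
    rw [mem_seg] at hz
    simp only [box, Finset.mem_product, Finset.mem_Icc, Equiv.addRight_symm, Equiv.coe_addRight,
      Prod.fst_add, Prod.neg_mk] at hz'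
    omega
  have key := dropSum_minusOn_mul_le hβ hsub hS (seg (n - l) (n + l + 1))
  change plusProb β Λ (minusOn _) * plusProb β (box L) (plusOn _) ≤
    plusProb β (box L) (minusOn _ ∩ plusOn _)
  rw [plusProb, plusProb, plusProb, div_mul_div_comm, div_le_div_iff₀ (mul_pos
    (dropSum_univ_pos _ _) (dropSum_univ_pos _ _)) (dropSum_univ_pos _ _)]
  calc _ ≤ _ := mul_le_mul_of_nonneg_right key (dropSum_univ_pos _ _).le
    _ = _ := by ring

theorem real_minusOn_inter_le {β : ℝ} (hβ : 0 ≤ β) {μ : Measure Cfg2} (h : IsPlusPhase β 0 μ) {p : ℝ}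
    (hle : ∀ k j : ℕ, μ.real (minusOn (seg 0 (k + j : ℕ))) ≤ p ^ j * μ.real (minusOn (seg 0 k)))
    {l n m : ℕ} (hln : l ≤ n) :
    μ.real (minusOn (seg (n - l) (n + l + 1)) ∩ minusOn (seg (-m) 0)) ≤
      p ^ (2 * l + 1) * μ.real (minusOn (seg (-m) 0)) := by
  have hX : seg (-(m : ℤ)) (n - l) = seg (-m) (-m + (m + (n - l) : ℕ)) := by
    congr 1; push_cast [hln]; ring
  have hY : seg (-(m : ℤ)) (n + l + 1) = seg (-m) (-m + (m + (n - l) + (2 * l + 1) : ℕ)) := by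
    congr 1; push_cast [hln]; ring
  have hpos : 0 < μ.real (minusOn (seg (-(m : ℤ)) (n - l))) :=
    real_minusOn_pos hβ h (seg_subset_box (n := m + n) (by omega) (by omega))
  have hfkg := h.fkg hβ
    ((determinedOn_agreeSet (seg (n - l) (n + l + 1)) fun _ => false).inter
      (determinedOn_agreeSet (seg (-(m : ℤ)) 0) fun _ => false))
    (determinedOn_agreeSet (seg (-(m : ℤ)) (n - l)) fun _ => false)
    (determinedOn_agreeSet (seg (-(m : ℤ)) (n + l + 1)) fun _ => false)
    (determinedOn_agreeSet (seg (-(m : ℤ)) 0) fun _ => false)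
    fun a ha b hb => ⟨fun z hz => ?_, fun z hz => ?_⟩
  · have h1 := hle (m + (n - l)) (2 * l + 1)
    rw [← real_minusOn_seg hβ h (-m), ← real_minusOn_seg hβ h (-m), ← hX, ← hY] at h1
    have h2 := mul_le_mul_of_nonneg_right h1 (measureReal_nonneg (μ := μ) (s := minusOn (seg (-m) 0)))
    refine le_of_mul_le_mul_right (hfkg.trans (h2.trans_eq ?_)) hpos
    change _ = p ^ (2 * l + 1) * _ * μ.real (minusOn (seg (-(m : ℤ)) (n - l)))
    ring
  · rw [mem_seg] at hz
    by_cases hz1 : z.1 < n - l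
    · have := hb z (mem_seg.2 (by omega))
      simp [this]
    · have := ha.1 z (mem_seg.2 (by omega))
      simp [this]
  · have h1 := ha.2 z hz
    have h2 := hb z (by rw [mem_seg] at hz ⊢; omega)
    simp [h1, h2]

/-- The infinite-volume comparison of a row of minus spins given plus spins on `{-m, …, -1}` with
the same row given minus spins there. -/
theorem real_minusOn_row_mul_le {β δ : ℝ} (hβ : 0 ≤ β) {μ : Measure Cfg2} (h : IsPlusPhase β 0 μ)
    (hδ : 0 ≤ δ) (hδ1 : δ ≤ 1) {m₁ m n l M : ℕ} (hln : l ≤ n) (hlM : l < M) (hm : m₁ ≤ m)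
    (hgap : ∀ (a b : ℤ), a + m₁ ≤ b → ∀ᶠ L in atTop,
      dropSum β (box L) (minusOn (seg a (b + 1))) / dropSum β (box L) (minusOn (seg a b)) + δ ≤
        dropSum β (box L) (plusOn (seg a (b + 1))) / dropSum β (box L) (plusOn (seg a b))) :
    μ.real (minusOn (seg (n - l) (n + l + 1)) ∩ plusOn (seg (-m) 0)) *
        μ.real (minusOn (seg (-m) 0)) ≤
      (1 - δ) ^ (2 * l + 1) *
        ((μ.real (minusOn (seg (n - l) (n + l + 1)) ∩ minusOn (seg (-m) 0)) +
          μ.real (rowReached n l M ∩ minusOn (seg (-m) 0))) * μ.real (plusOn (seg (-m) 0))) := by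
  have hW : (n : ℤ) + l + 1 = n - l + (2 * l + 1 : ℕ) := by push_cast; ring
  have tm := fun T => h.tendsto (determinedOn_agreeSet T fun _ => false)
  have tp := fun T => h.tendsto (determinedOn_agreeSet T fun _ => true)
  refine le_of_tendsto_of_tendsto ((h.tendsto ((determinedOn_agreeSet _ _).inter
    (determinedOn_agreeSet _ _))).mul (tm _)) ((((h.tendsto ((determinedOn_agreeSet _ _).inter
    (determinedOn_agreeSet _ _))).add (h.tendsto ((determinedOn_rowReached n l M).inter
    (determinedOn_agreeSet _ _)))).mul (tp _)).const_mul _) ?_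
  filter_upwards [eventually_ge_atTop (m + n + l + 1 + M), (Finset.eventually_all
    (Finset.range (2 * l + 1))).2 fun k _ => hgap (-m) (n - l + k) (by omega)] with L hL hgapL
  have h1 := dropSum_minusOn_row_le_pow hβ hδ hδ1 (L := L) (a := -m) (c := 0) (d := n - l)
    (N := 2 * l + 1) (by omega) (by omega) (seg_subset_box (by omega) (by omega)) fun k hk =>
      hgapL k (Finset.mem_range.2 hk)
  rw [← hW] at h1
  have h2 := dropSum_plusOn_row_le hβ (Λ := box L) (n := n) hlM
    (fun η => shelter_subset_box (by omega) η) (seg (-m) 0)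
  change plusProb β (box L) (minusOn _ ∩ plusOn _) * plusProb β (box L) (minusOn _) ≤
    _ * ((plusProb β (box L) (minusOn _ ∩ minusOn _) + _) * plusProb β (box L) (plusOn _))
  simp only [plusProb]
  rw [← add_div, div_mul_div_comm, div_mul_div_comm, ← mul_div_assoc]
  refine div_le_div_of_nonneg_right (h1.trans ?_)
    (mul_pos (dropSum_univ_pos _ _) (dropSum_univ_pos _ _)).le
  exact mul_le_mul_of_nonneg_left (mul_le_mul_of_nonneg_right h2 (dropSum_nonneg _ _ _))
    (pow_nonneg (by linarith) _)

/-- Let `β > β_c`, `h = 0`, and let `μ̂` be the weak limit of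
`μ⁺(·|η(i,0) = −1, i ∈ {−m,…,−1})` as `m → ∞`. Then for all large `n` the event `A_n` (an
infinite nearest-neighbour path of `+1` spins starting at `(n,0)` and contained in
`{x ≤ n}`) has positive `μ̂`-probability. -/
theorem conditioned_measure_percolates_in_half_plane
    (β : ℝ) (hβ : betaCrit < β) (μp : Measure Cfg2) (hμp : IsPlusPhase β 0 μp)
    (μh : Measure Cfg2) (hμhP : IsProbabilityMeasure μh)
    (hμh : CylTendsto (fun m => μp[|lineMinusEvt 1 m]) μh) :
    ∃ n₀ : ℕ, ∀ n : ℕ, n₀ ≤ n → 0 < μh (plusPathEvt n) := by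
  have hβ0 : 0 ≤ β := (betaCrit_pos.trans hβ).le
  have := hμp.1
  obtain ⟨p, p', hp0, hpp, hp1, hp, hp', hle, hlow⟩ := exists_rates hβ hμp
  have hpos := real_plusOn_seg_pos hβ hμp
  set δ := (p' - p) / 2 with hδ
  have hδ0 : 0 < δ := by linarith
  have hδ1 : δ < 1 := by linarith
  obtain ⟨m₁, hgap⟩ := exists_eventually_gap hβ0 hμp hpos (δ := δ) (by linarith) hp hp'
  have hrp0 : 0 < (1 - δ) * p := mul_pos (by linarith) hp0
  obtain ⟨q, hq, hqp⟩ := exists_between (show (1 - δ) * p < p by nlinarith)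
  have hq0 := hrp0.trans hq
  obtain ⟨c, hc, hcq⟩ := hlow q hq0 hqp
  obtain ⟨l, hl⟩ : ∃ l : ℕ, 2 * ((1 - δ) * p) ^ (2 * l + 1) < c * q ^ (2 * l + 1) := by
    have h1 := tendsto_pow_atTop_nhds_zero_of_lt_one (div_pos hrp0 hq0).le ((div_lt_one hq0).2 hq)
    obtain ⟨N, hN⟩ := eventually_atTop.1 (h1.eventually_lt_const (half_pos hc))
    refine ⟨N, ?_⟩
    have h2 := hN (2 * N + 1) (by omega)
    rw [div_pow, div_lt_iff₀ (pow_pos hq0 _)] at h2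
    linarith
  have hrow : μp.real (minusOn (seg (-l) (l + 1))) = μp.real (minusOn (seg 0 (2 * l + 1 : ℕ))) := by
    rw [← real_minusOn_seg hβ0 hμp (-l)]
    congr 3
    push_cast
    ring
  have hlim := hμp.tendsto (determinedOn_agreeSet (seg (-l) (l + 1)) fun _ => false)
  have hbig : ((1 - δ) * p) ^ (2 * l + 1) < μp.real (minusOn (seg (-l) (l + 1))) := by
    rw [hrow]
    have := hcq (2 * l + 1)
    nlinarith [pow_pos hrp0 (2 * l + 1)]
  obtain ⟨k₀, hk₀⟩ := eventually_atTop.1 (hlim.eventually_const_lt hbig)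
  refine ⟨max (k₀ + 1) (l + 1), fun n hn => ?_⟩
  by_contra hnot
  have h0 : μh (plusPathEvt n) = 0 := by simpa using hnot
  have hn1 : k₀ ≤ n - 1 := by have := le_max_left (k₀ + 1) (l + 1); omega
  have hn2 : l < n := by have := le_max_right (k₀ + 1) (l + 1); omega
  refine (hk₀ (n - 1) hn1).not_ge ?_
  set b := plusProb β (box (n - 1)) (agreeSet (seg (-l) (l + 1)) fun _ => false) with hb
  have hfin : ∀ M, l < M → b ≤ (1 - δ) ^ (2 * l + 1) *
      (p ^ (2 * l + 1) + μh.real (rowReached n l M)) := by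
    intro M hM
    refine le_of_tendsto_of_tendsto tendsto_const_nhds ((tendsto_const_nhds.add
      (tendsto_cond_lineMinus hμh (determinedOn_rowReached n l M))).const_mul _) ?_
    filter_upwards [eventually_ge_atTop m₁] with m hm
    have h1 := real_minusOn_row_mul_le hβ0 hμp hδ0.le hδ1.le hn2.le hM hm hgap
    have h2 := plusProb_mul_real_plusOn_le hβ0 hμp (m := m) hn2
    have h3 := real_minusOn_inter_le hβ0 hμp hle (m := m) hn2.le
    have hmpos := real_lineMinus_pos hβ0 hμp m
    have hppos : 0 < μp.real (plusOn (seg (-m) 0)) := by simpa using hpos (-m) m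
    rw [Set.inter_comm (minusOn (seg (-(m : ℤ)) 0)), add_div' _ _ _ hmpos.ne', ← mul_div_assoc,
      le_div_iff₀ hmpos]
    refine le_of_mul_le_mul_right ?_ hppos
    calc b * μp.real (minusOn (seg (-m) 0)) * μp.real (plusOn (seg (-m) 0))
        = b * μp.real (plusOn (seg (-m) 0)) * μp.real (minusOn (seg (-m) 0)) := by ring
      _ ≤ _ := mul_le_mul_of_nonneg_right h2 hmpos.le
      _ ≤ _ := h1
      _ ≤ (1 - δ) ^ (2 * l + 1) * ((p ^ (2 * l + 1) * μp.real (minusOn (seg (-m) 0)) +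
          μp.real (rowReached n l M ∩ minusOn (seg (-m) 0))) * μp.real (plusOn (seg (-m) 0))) := by
        have : 0 ≤ 1 - δ := by linarith
        gcongr
      _ = _ := by ring
  have hlim2 := ((tendsto_rowReached hβ0 hμp hμh hn2.le h0).const_add
    (p ^ (2 * l + 1))).const_mul ((1 - δ) ^ (2 * l + 1))
  rw [add_zero, ← mul_pow] at hlim2
  exact ge_of_tendsto hlim2 ((eventually_gt_atTop l).mono hfin)
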